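/- Let D be a bounded open connected subset of R^d, a ∈ (0,|D|), and let Ω* be any solution of the problem: minimize λ₁(Ω) over open Ω ⊂ D with |Ω| = a. Then Ω* has locally finite perimeter in D and H^{d−1}((∂Ω* \ ∂*Ω*) ∩ D) = 0, where H^{d−1} is the (d−1)-dimensional Hausdorff measure and ∂*Ω* is the reduced boundary of Ω* in the sense of sets of finite perimeter. -/

import Mathlib

open MeasureTheory Filter Metric Set
open scoped RealInnerProductSpace ENNReal Topology NNReal

noncomputable section

abbrev Euc (d : ℕ) := EuclideanSpace ℝ (Fin d)

variable {d : ℕ}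

/-- Real-valued Lebesgue volume of a set. -/
def mvol (s : Set (Euc d)) : ℝ := (volume s).toReal

/-- Smooth scalar test function compactly supported in `Ω`. -/
def TestFun (Ω : Set (Euc d)) (φ : Euc d → ℝ) : Prop :=
  ContDiff ℝ (⊤ : ℕ∞) φ ∧ HasCompactSupport φ ∧ tsupport φ ⊆ Ω

/-- Smooth vector field compactly supported in `Ω`. -/
def VecTestFun (Ω : Set (Euc d)) (Φ : Euc d → Euc d) : Prop :=
  ContDiff ℝ (⊤ : ℕ∞) Φ ∧ HasCompactSupport Φ ∧ tsupport Φ ⊆ Ω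

/-- Membership in `H¹₀(Ω)`, encoded through `L²` integrability of the function and of its
(a.e. defined) gradient, together with approximation in the `H¹` norm by smooth functions
compactly supported in `Ω`. -/
def MemH10 (Ω : Set (Euc d)) (v : Euc d → ℝ) : Prop :=
  MemLp v 2 (volume : Measure (Euc d)) ∧
  MemLp (fun x => gradient v x) 2 (volume : Measure (Euc d)) ∧
  ∃ φ : ℕ → Euc d → ℝ, (∀ n, TestFun Ω (φ n)) ∧
    Tendsto (fun n => ∫ x, ((v x - φ n x) ^ 2 + ‖gradient v x - gradient (φ n) x‖ ^ 2))
      atTop (nhds 0)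

/-- First Dirichlet eigenvalue of `Ω`, via the Rayleigh quotient variational characterization. -/
def lam1 (Ω : Set (Euc d)) : ℝ :=
  sInf {t : ℝ | ∃ v : Euc d → ℝ, MemH10 Ω v ∧ (∫ x, (v x) ^ 2) = 1 ∧
    t = ∫ x, ‖gradient v x‖ ^ 2}

/-- `u` is a normalized first Dirichlet eigenfunction of `Ω`. -/
def IsFirstEigenfun (Ω : Set (Euc d)) (u : Euc d → ℝ) : Prop :=
  MemH10 Ω u ∧ (∫ x, (u x) ^ 2) = 1 ∧ (∫ x, ‖gradient u x‖ ^ 2) = lam1 Ω ∧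
  ∀ φ : Euc d → ℝ, TestFun Ω φ →
    (∫ x, ⟪gradient u x, gradient φ x⟫) = lam1 Ω * ∫ x, u x * φ x

/-- `Ω` solves the shape optimization problem: it minimizes `λ₁` among open subsets of `D` of
measure `a`. -/
structure IsOptimalShape (D : Set (Euc d)) (a : ℝ) (Ω : Set (Euc d)) : Prop where
  isOpen : IsOpen Ω
  subset : Ω ⊆ D
  meas : mvol Ω = a
  minim : ∀ Ω' : Set (Euc d), IsOpen Ω' → Ω' ⊆ D → mvol Ω' = a → lam1 Ω ≤ lam1 Ω'

/-- `u` is locally Lipschitz continuous in `s`. -/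
def LocLipOn (s : Set (Euc d)) (u : Euc d → ℝ) : Prop :=
  ∀ x ∈ s, ∃ t, t ∈ 𝓝 x ∧ t ⊆ s ∧ ∃ K : ℝ≥0, LipschitzOnWith K u t

/-- Divergence of a vector field. -/
def divg (Φ : Euc d → Euc d) (x : Euc d) : ℝ :=
  ∑ i, fderiv ℝ Φ x (EuclideanSpace.single i 1) i

/-- `Ω` has locally finite perimeter in `D` (its characteristic function has locally bounded
variation in `D`). -/
def HasLocFinPerimeterIn (D Ω : Set (Euc d)) : Prop :=
  ∀ K : Set (Euc d), IsCompact K → K ⊆ D → ∃ C : ℝ,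
    ∀ Φ : Euc d → Euc d, VecTestFun K Φ → (∀ x, ‖Φ x‖ ≤ 1) →
      (∫ x in Ω, divg Φ x) ≤ C

/-- The reduced boundary of `Ω`: points where `Ω` blows up to a half space, in the sense that the
symmetric difference with a half space is of vanishing density. -/
def reducedBoundary (Ω : Set (Euc d)) : Set (Euc d) :=
  {x | ∃ ν : Euc d, ‖ν‖ = 1 ∧
    Tendsto (fun r : ℝ =>
        volume (symmDiff (Ω ∩ ball x r) ({y | ⟪y - x, ν⟫ ≤ 0} ∩ ball x r)) /
          ENNReal.ofReal (r ^ d))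
      (𝓝[>] 0) (𝓝 0)}

/-- `S` is an analytic hypersurface in `D`: near each of its points in `D` it is the zero set of
an analytic function with nonvanishing gradient. -/
def IsAnalyticHypersurfaceIn (D S : Set (Euc d)) : Prop :=
  ∀ x ∈ S ∩ D, ∃ U : Set (Euc d), IsOpen U ∧ x ∈ U ∧ U ⊆ D ∧
    ∃ f : Euc d → ℝ, AnalyticOn ℝ f U ∧ (∀ y ∈ U, fderiv ℝ f y ≠ 0) ∧
      S ∩ U = {y ∈ U | f y = 0}

/-- The functional `J(v) = ∫ |∇v|² - λ ∫ v²`. -/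
def Jfun (lam : ℝ) (v : Euc d → ℝ) : ℝ :=
  (∫ x, ‖gradient v x‖ ^ 2) - lam * ∫ x, (v x) ^ 2

/-- `Ω_v = {x ∈ D : v(x) ≠ 0}`. -/
def Om (D : Set (Euc d)) (v : Euc d → ℝ) : Set (Euc d) := {x ∈ D | v x ≠ 0}

/-- The optimal value `λ_a` of `λ₁` among open subsets of `D` of measure `a`. -/
def lamOpt (D : Set (Euc d)) (a : ℝ) : ℝ :=
  sInf {t : ℝ | ∃ Ω : Set (Euc d), IsOpen Ω ∧ Ω ⊆ D ∧ mvol Ω = a ∧ t = lam1 Ω}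

/-- `u` minimizes `J` among functions of `H¹₀(D)` with `|Ω_w| ≤ a`. -/
def IsJMinimizer (D : Set (Euc d)) (a lam : ℝ) (u : Euc d → ℝ) : Prop :=
  MemH10 D u ∧ mvol (Om D u) ≤ a ∧
  ∀ w : Euc d → ℝ, MemH10 D w → mvol (Om D w) ≤ a → Jfun lam u ≤ Jfun lam w

/-- The class `F` of perturbations of `u` supported in `B`. -/
def Fcal (D B : Set (Euc d)) (u v : Euc d → ℝ) : Prop :=
  MemH10 D v ∧ MemH10 B (fun x => u x - v x)

/-- The set of penalization constants `μ₋` admissible for `h` (inward perturbations). -/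
def Mminus (D : Set (Euc d)) (a lam : ℝ) (u : Euc d → ℝ) (B : Set (Euc d)) (h : ℝ) :
    Set ℝ :=
  {μ : ℝ | 0 ≤ μ ∧ ∀ v : Euc d → ℝ, Fcal D B u v →
    a - h ≤ mvol (Om D v) → mvol (Om D v) ≤ a →
    Jfun lam u + μ * mvol (Om D u) ≤ Jfun lam v + μ * mvol (Om D v)}

/-- The set of penalization constants `μ₊` admissible for `h` (outward perturbations). -/
def Mplus (D : Set (Euc d)) (a lam : ℝ) (u : Euc d → ℝ) (B : Set (Euc d)) (h : ℝ) :
    Set ℝ :=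
  {μ : ℝ | 0 ≤ μ ∧ ∀ v : Euc d → ℝ, Fcal D B u v →
    a ≤ mvol (Om D v) → mvol (Om D v) ≤ a + h →
    Jfun lam u + μ * mvol (Om D u) ≤ Jfun lam v + μ * mvol (Om D v)}

/-- `μ₋(h)`: the biggest admissible inward penalization constant. -/
def muMinus (D : Set (Euc d)) (a lam : ℝ) (u : Euc d → ℝ) (B : Set (Euc d)) (h : ℝ) : ℝ :=
  sSup (Mminus D a lam u B h)

/-- `μ₊(h)`: the smallest admissible outward penalization constant. -/
def muPlus (D : Set (Euc d)) (a lam : ℝ) (u : Euc d → ℝ) (B : Set (Euc d)) (h : ℝ) : ℝ :=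
  sInf (Mplus D a lam u B h)

/-- Average of `u` on the sphere `∂B(x,r)`, with respect to the `(d-1)`-Hausdorff measure. -/
def sphAvg (u : Euc d → ℝ) (x : Euc d) (r : ℝ) : ℝ :=
  (∫ y in sphere x r, u y ∂(μH[(d : ℝ) - 1])) / ((μH[(d : ℝ) - 1]) (sphere x r)).toReal

section
def LC (f : Euc d → ℝ) : Prop := (∃ K, LipschitzWith K f) ∧ HasCompactSupport f

structure BC {E : Type*} [NormedAddCommGroup E] (F : Euc d → E) : Prop where
  meas : AEStronglyMeasurable F volume
  bd : ∃ C, ∀ x, ‖F x‖ ≤ C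
  cs : ∃ R, ∀ x, R < ‖x‖ → F x = 0

section bc
variable {E : Type*} [NormedAddCommGroup E]

theorem BC.integrable {F : Euc d → E} (h : BC F) : Integrable F := by
  obtain ⟨C, hC⟩ := h.bd
  obtain ⟨R, hR⟩ := h.cs
  have hs : Function.support F ⊆ closedBall 0 R := by
    intro x hx
    by_contra hc
    exact hx (hR x (by simpa using hc))
  rw [← integrableOn_iff_integrable_of_support_subset hs]
  exact IntegrableOn.of_bound (measure_closedBall_lt_top) h.meas.restrict C
    (Eventually.of_forall hC)

theorem BC.of_le {E' : Type*} [NormedAddCommGroup E'] {F : Euc d → E} (h : BC F) {G : Euc d → E'}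
    (hG : AEStronglyMeasurable G volume) (C : ℝ) (hC : ∀ x, ‖G x‖ ≤ C * ‖F x‖) : BC G := by
  obtain ⟨C', hC'⟩ := h.bd
  obtain ⟨R, hR⟩ := h.cs
  refine ⟨hG, ⟨|C| * C', fun x => (hC x).trans ?_⟩, R, fun x hx => ?_⟩
  · calc C * ‖F x‖ ≤ |C| * ‖F x‖ := by gcongr; exact le_abs_self C
      _ ≤ |C| * C' := by gcongr; exact hC' x
  · have := hC x
    rw [hR x hx] at this
    simpa using this

theorem BC.add {F G : Euc d → E} (h : BC F) (h' : BC G) : BC (fun x => F x + G x) := by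
  obtain ⟨C, hC⟩ := h.bd
  obtain ⟨R, hR⟩ := h.cs
  obtain ⟨C', hC'⟩ := h'.bd
  obtain ⟨R', hR'⟩ := h'.cs
  refine ⟨h.meas.add h'.meas, ⟨C + C', fun x => (norm_add_le _ _).trans
    (add_le_add (hC x) (hC' x))⟩, max R R', fun x hx => ?_⟩
  rw [hR x (lt_of_le_of_lt (le_max_left _ _) hx), hR' x (lt_of_le_of_lt (le_max_right _ _) hx),
    add_zero]

theorem BC.neg {F : Euc d → E} (h : BC F) : BC (fun x => - F x) :=
  h.of_le h.meas.neg 1 (fun x => by simp)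

theorem BC.sub {F G : Euc d → E} (h : BC F) (h' : BC G) : BC (fun x => F x - G x) := by
  simpa only [sub_eq_add_neg] using h.add h'.neg

theorem BC.norm {F : Euc d → E} (h : BC F) : BC (fun x => ‖F x‖) :=
  h.of_le h.meas.norm 1 (fun x => by simp)

theorem BC.mulB {F g : Euc d → ℝ} (h : BC F) (hg : AEStronglyMeasurable g volume)
    (hb : ∃ C, ∀ x, |g x| ≤ C) : BC (fun x => F x * g x) := by
  obtain ⟨C, hC⟩ := hb
  refine h.of_le (h.meas.mul hg) C (fun x => ?_)
  rw [norm_mul, mul_comm]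
  exact mul_le_mul_of_nonneg_right (hC x) (norm_nonneg _)

theorem BC.mul {F g : Euc d → ℝ} (h : BC F) (hg : BC g) : BC (fun x => F x * g x) :=
  h.mulB hg.meas hg.bd

theorem BC.const_mul {F : Euc d → ℝ} (h : BC F) (c : ℝ) : BC (fun x => c * F x) :=
  h.of_le (h.meas.const_mul c) |c| (fun x => by simp)

theorem BC.pow2 {F : Euc d → ℝ} (h : BC F) : BC (fun x => F x ^ 2) := by
  simpa only [sq] using h.mul h

theorem BC.abs {F : Euc d → ℝ} (h : BC F) : BC (fun x => |F x|) := h.norm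

theorem BC.ind {F : Euc d → E} (h : BC F) {s : Set (Euc d)} (hs : MeasurableSet s) :
    BC (s.indicator F) :=
  h.of_le (h.meas.indicator hs) 1 (fun x => by
    rw [one_mul]; exact norm_indicator_le_norm_self _ _)

theorem BC.inner {F G : Euc d → Euc d} (h : BC F) (hg : BC G) : BC (fun x => ⟪F x, G x⟫) := by
  obtain ⟨C, hC⟩ := hg.bd
  refine h.of_le (h.meas.inner hg.meas) C (fun x => ?_)
  refine (norm_inner_le_norm _ _).trans ?_
  rw [mul_comm]
  exact mul_le_mul_of_nonneg_right (hC x) (norm_nonneg _)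

theorem BC.innerc {F : Euc d → Euc d} (h : BC F) (e : Euc d) : BC (fun x => ⟪F x, e⟫) := by
  refine h.of_le (h.meas.inner aestronglyMeasurable_const) ‖e‖ (fun x => ?_)
  refine (norm_inner_le_norm _ _).trans ?_
  rw [mul_comm]

theorem BC.trans {F : Euc d → E} (h : BC F) (z : Euc d) : BC (fun x => F (x + z)) := by
  obtain ⟨C, hC⟩ := h.bd
  obtain ⟨R, hR⟩ := h.cs
  refine ⟨h.meas.comp_measurePreserving (measurePreserving_add_right volume z),
    ⟨C, fun x => hC _⟩, R + ‖z‖, fun x hx => hR _ ?_⟩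
  have := norm_sub_le (x + z) z
  simp only [add_sub_cancel_right] at this
  linarith

theorem BC.memLp {F : Euc d → E} (h : BC F) (p : ℝ≥0∞) : MemLp F p := by
  obtain ⟨C, hC⟩ := h.bd
  obtain ⟨R, hR⟩ := h.cs
  have hs : F = (closedBall 0 R).indicator F := by
    ext x
    by_cases hx : x ∈ closedBall (0 : Euc d) R
    · rw [indicator_of_mem hx]
    · rw [indicator_of_notMem hx]; exact hR x (by simpa using hx)
  rw [hs, memLp_indicator_iff_restrict measurableSet_closedBall]
  have : IsFiniteMeasure ((volume : Measure (Euc d)).restrict (closedBall 0 R)) :=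
    ⟨by simpa using measure_closedBall_lt_top⟩
  exact MemLp.of_bound h.meas.restrict C (Eventually.of_forall hC)

end bc

theorem LC.cont {f : Euc d → ℝ} (h : LC f) : Continuous f := by
  obtain ⟨⟨K, hK⟩, _⟩ := h
  exact hK.continuous

theorem cs_bound {f : Euc d → ℝ} (h : HasCompactSupport f) : ∃ R, ∀ x, R < ‖x‖ → x ∉ tsupport f := by
  obtain ⟨R, hR⟩ := h.isBounded.subset_closedBall 0
  refine ⟨R, fun x hx hc => ?_⟩
  have := hR hc
  simp at this
  linarith

theorem LC.bc {f : Euc d → ℝ} (h : LC f) : BC f := by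
  refine ⟨h.cont.aestronglyMeasurable, ?_, ?_⟩
  · exact h.2.exists_bound_of_continuous h.cont
  · obtain ⟨R, hR⟩ := cs_bound h.2
    exact ⟨R, fun x hx => image_eq_zero_of_notMem_tsupport (hR x hx)⟩

theorem norm_grad (f : Euc d → ℝ) (x : Euc d) : ‖gradient f x‖ = ‖fderiv ℝ f x‖ := by
  simp [gradient]

theorem inner_grad (f : Euc d → ℝ) (x e : Euc d) : ⟪gradient f x, e⟫ = fderiv ℝ f x e :=
  inner_gradient_left

theorem meas_grad (f : Euc d → ℝ) : Measurable (gradient f) := by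
  have : gradient f = fun x => (InnerProductSpace.toDual ℝ (Euc d)).symm (fderiv ℝ f x) := rfl
  rw [this]
  exact (LinearIsometryEquiv.continuous _).measurable.comp (measurable_fderiv ℝ f)

theorem grad_bound {f : Euc d → ℝ} {K : ℝ≥0} (h : LipschitzWith K f) (x : Euc d) :
    ‖gradient f x‖ ≤ K := by
  rw [norm_grad]; exact norm_fderiv_le_of_lipschitz ℝ h

theorem grad_zero_of_notMem {f : Euc d → ℝ} {x : Euc d} (h : x ∉ tsupport f) :
    gradient f x = 0 := by
  have : f =ᶠ[𝓝 x] fun _ => 0 := notMem_tsupport_iff_eventuallyEq.mp h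
  rw [this.gradient_eq]; exact gradient_fun_const x 0

theorem LC.gbc {f : Euc d → ℝ} (h : LC f) : BC (gradient f) := by
  obtain ⟨⟨K, hK⟩, hc⟩ := h
  refine ⟨(meas_grad f).aestronglyMeasurable, ⟨K, grad_bound hK⟩, ?_⟩
  obtain ⟨R, hR⟩ := cs_bound hc
  exact ⟨R, fun x hx => grad_zero_of_notMem (hR x hx)⟩

theorem LC.diff {f : Euc d → ℝ} (h : LC f) : ∀ᵐ x, DifferentiableAt ℝ f x := by
  obtain ⟨⟨K, hK⟩, _⟩ := h
  exact hK.ae_differentiableAt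

theorem grad_add {f g : Euc d → ℝ} {x : Euc d} (hf : DifferentiableAt ℝ f x)
    (hg : DifferentiableAt ℝ g x) :
    gradient (fun y => f y + g y) x = gradient f x + gradient g x := by
  simp only [gradient]; rw [fderiv_fun_add hf hg, map_add]

theorem grad_neg {f : Euc d → ℝ} {x : Euc d} :
    gradient (fun y => - f y) x = - gradient f x := by
  simp only [gradient]; rw [fderiv_fun_neg, map_neg]

theorem grad_sub {f g : Euc d → ℝ} {x : Euc d} (hf : DifferentiableAt ℝ f x)
    (hg : DifferentiableAt ℝ g x) :
    gradient (fun y => f y - g y) x = gradient f x - gradient g x := by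
  simp only [gradient]; rw [fderiv_fun_sub hf hg, map_sub]

theorem grad_cmul {f : Euc d → ℝ} {x : Euc d} (c : ℝ) (hf : DifferentiableAt ℝ f x) :
    gradient (fun y => c * f y) x = c • gradient f x := by
  simp only [gradient]; rw [fderiv_const_mul hf, map_smul]

theorem grad_mul {f g : Euc d → ℝ} {x : Euc d} (hf : DifferentiableAt ℝ f x)
    (hg : DifferentiableAt ℝ g x) :
    gradient (fun y => f y * g y) x = f x • gradient g x + g x • gradient f x := by
  simp only [gradient]; rw [fderiv_fun_mul hf hg, map_add, map_smul, map_smul]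

theorem LC.add {f g : Euc d → ℝ} (h : LC f) (h' : LC g) : LC (fun x => f x + g x) := by
  obtain ⟨⟨K, hK⟩, hc⟩ := h
  obtain ⟨⟨K', hK'⟩, hc'⟩ := h'
  exact ⟨⟨K + K', hK.add hK'⟩, hc.add hc'⟩

theorem LC.neg {f : Euc d → ℝ} (h : LC f) : LC (fun x => - f x) := by
  obtain ⟨⟨K, hK⟩, hc⟩ := h
  exact ⟨⟨K, hK.neg⟩, hc.neg⟩

theorem LC.sub {f g : Euc d → ℝ} (h : LC f) (h' : LC g) : LC (fun x => f x - g x) := by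
  simpa only [sub_eq_add_neg] using h.add h'.neg

theorem LC.mul {f g : Euc d → ℝ} (h : LC f) (h' : LC g) : LC (fun x => f x * g x) := by
  obtain ⟨C, hC⟩ := h.bc.bd
  obtain ⟨C', hC'⟩ := h'.bc.bd
  obtain ⟨⟨K, hK⟩, hc⟩ := h
  obtain ⟨⟨K', hK'⟩, hc'⟩ := h'
  refine ⟨⟨Real.toNNReal (C * K' + C' * K), ?_⟩, hc.mul_right⟩
  have hC0 : 0 ≤ C := (norm_nonneg _).trans (hC 0)
  have hC0' : 0 ≤ C' := (norm_nonneg _).trans (hC' 0)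
  refine LipschitzWith.of_dist_le_mul fun x y => ?_
  rw [Real.coe_toNNReal _ (by positivity), Real.dist_eq]
  have h1 := hK.dist_le_mul x y
  have h2 := hK'.dist_le_mul x y
  rw [Real.dist_eq] at h1 h2
  have e : f x * g x - f y * g y = f x * (g x - g y) + g y * (f x - f y) := by ring
  rw [e]
  refine (abs_add_le _ _).trans ?_
  rw [abs_mul, abs_mul]
  have := mul_le_mul (hC x) h2 (abs_nonneg _) hC0
  have := mul_le_mul (hC' y) h1 (abs_nonneg _) hC0'
  simp only [Real.norm_eq_abs] at *
  linarith

theorem LC.cmul {f : Euc d → ℝ} (h : LC f) (c : ℝ) : LC (fun x => c * f x) := by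
  obtain ⟨⟨K, hK⟩, hc⟩ := h
  refine ⟨⟨‖c‖₊ * K, ?_⟩, hc.mul_left⟩
  exact (lipschitzWith_smul c).comp hK

theorem LC.of_lip_le {f g : Euc d → ℝ} (h : LC f) (hg : ∃ K, LipschitzWith K g)
    (h0 : ∀ x, f x = 0 → g x = 0) : LC g :=
  ⟨hg, h.2.mono fun x hx hc => hx (h0 x hc)⟩

theorem LC.posl {f : Euc d → ℝ} (h : LC f) {ε : ℝ} (hε : 0 ≤ ε) :
    LC (fun x => max (f x - ε) 0) := by
  refine h.of_lip_le ?_ fun x hx => by rw [hx]; simp [hε]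
  obtain ⟨⟨K, hK⟩, _⟩ := h
  refine ⟨K, LipschitzWith.max_const ?_ 0⟩
  exact LipschitzWith.of_dist_le_mul fun x y => by simpa using hK.dist_le_mul x y

theorem LC.max0 {f : Euc d → ℝ} (h : LC f) : LC (fun x => max (f x) 0) := by
  simpa using h.posl le_rfl

theorem LC.trans {f : Euc d → ℝ} (h : LC f) (z : Euc d) : LC (fun x => f (x + z)) := by
  obtain ⟨⟨K, hK⟩, hc⟩ := h
  refine ⟨⟨K, LipschitzWith.of_dist_le_mul fun x y => by simpa using hK.dist_le_mul (x + z) (y + z)⟩, ?_⟩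
  exact hc.comp_homeomorph (Homeomorph.addRight z)

theorem grad_trans (f : Euc d → ℝ) (z x : Euc d) :
    gradient (fun y => f (y + z)) x = gradient f (x + z) := by
  simp only [gradient]; rw [fderiv_comp_add_right]

/-- Gradient of the positive part. -/
theorem grad_pos {f : Euc d → ℝ} (h : Continuous f) (x : Euc d) :
    gradient (fun y => max (f y) 0) x = if 0 < f x then gradient f x else 0 := by
  by_cases h1 : 0 < f x
  · rw [if_pos h1]
    have : (fun y => max (f y) 0) =ᶠ[𝓝 x] f := by
      filter_upwards [h.continuousAt.eventually (lt_mem_nhds h1)] with y hy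
      exact max_eq_left hy.le
    exact this.gradient_eq
  · rw [if_neg h1]
    have : IsLocalMin (fun y => max (f y) 0) x := by
      filter_upwards with y
      rw [max_eq_right (not_lt.mp h1)]
      exact le_max_right _ _
    simp only [gradient]; rw [this.fderiv_eq_zero, map_zero]

theorem grad_zero_ae {f : Euc d → ℝ} {K : ℝ≥0} (h : LipschitzWith K f) (c : ℝ) :
    ∀ᵐ x, f x = c → gradient f x = 0 := by
  have hf : LipschitzWith K (fun y => f y - c) :=
    LipschitzWith.of_dist_le_mul fun x y => by simpa using h.dist_le_mul x y
  filter_upwards [(hf.max_const 0).ae_differentiableAt, (hf.neg.max_const 0).ae_differentiableAt]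
    with x h1 h2 hx
  have h3 := grad_pos hf.continuous x
  have h4 := grad_pos hf.neg.continuous x
  have e : f = fun y => (max (f y - c) 0 - max (-(fun y => f y - c) y) 0) + c := by
    ext y
    rcases le_total (f y) c with h | h <;> simp [h]
  have h5 := grad_sub h1 h2
  rw [h3] at h5
  simp only [Pi.neg_apply] at h4 h5
  rw [h4] at h5
  simp only [hx, sub_self, lt_irrefl, if_false, neg_zero] at h5
  rw [e]
  simp only [gradient] at h5 ⊢
  rw [fderiv_add_const]
  exact h5

theorem lineDeriv_grad {f : Euc d → ℝ} {x : Euc d} (h : DifferentiableAt ℝ f x) (e : Euc d) :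
    lineDeriv ℝ f x e = ⟪gradient f x, e⟫ := by
  rw [h.lineDeriv_eq_fderiv, inner_grad]

/-- integration by parts -/
theorem ibp {f g : Euc d → ℝ} {K : ℝ≥0} (hf : LipschitzWith K f) (hg : LC g) (e : Euc d) :
    ∫ x, ⟪gradient f x, e⟫ * g x = - ∫ x, f x * ⟪gradient g x, e⟫ := by
  obtain ⟨⟨K', hK'⟩, hc⟩ := id hg
  have := hf.integral_lineDeriv_mul_eq (μ := volume) hK' hc e
  rw [integral_congr_ae (g := fun x => ⟪gradient f x, e⟫ * g x)] at this
  · rw [this, ← integral_neg]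
    refine integral_congr_ae ?_
    filter_upwards [hg.diff] with x hx
    beta_reduce
    rw [lineDeriv_grad hx, inner_neg_right]; ring
  · filter_upwards [hf.ae_differentiableAt] with x hx
    beta_reduce
    rw [lineDeriv_grad hx]

theorem int_grad_zero {g : Euc d → ℝ} (hg : LC g) (e : Euc d) :
    ∫ x, ⟪gradient g x, e⟫ = 0 := by
  have := ibp (f := fun _ => (1 : ℝ)) (LipschitzWith.const 1) hg e
  simp only [gradient_fun_const, inner_zero_left, zero_mul, integral_zero, one_mul] at this
  linarith

/-- Lemma D -/
theorem lemD {f k : Euc d → ℝ} (hf : Integrable f) (hk : LC k) (z : Euc d) (s : ℝ) :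
    HasDerivAt (fun s : ℝ => ∫ w, f w * k (w + s • z))
      (∫ w, f w * ⟪gradient k (w + s • z), z⟫) s := by
  obtain ⟨⟨K, hK⟩, hc⟩ := id hk
  obtain ⟨C, hC⟩ := hk.bc.bd
  have hcont : ∀ s : ℝ, Continuous (fun w : Euc d => k (w + s • z)) := fun s =>
    hk.cont.comp (by fun_prop)
  have hm : ∀ s : ℝ, AEStronglyMeasurable (fun w : Euc d => f w * k (w + s • z)) volume := fun s =>
    hf.aestronglyMeasurable.mul (hcont s).aestronglyMeasurable
  refine (hasDerivAt_integral_of_dominated_loc_of_lip (s := univ)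
    (bound := fun w => |f w| * (K * ‖z‖)) univ_mem (Eventually.of_forall hm)
    (hf.mul_bdd (c := C) (hcont s).aestronglyMeasurable (Eventually.of_forall fun x => hC _)) ?_ ?_ ?_ ?_).2
  · refine hf.aestronglyMeasurable.mul (Measurable.aestronglyMeasurable ?_)
    exact ((meas_grad k).comp (measurable_id.add_const _)).inner measurable_const
  · refine Eventually.of_forall fun w => ?_
    refine LipschitzOnWith.of_dist_le_mul fun t _ t' _ => ?_
    have := hK.dist_le_mul (w + t • z) (w + t' • z)
    rw [dist_add_left, dist_eq_norm (t • z), ← sub_smul, norm_smul] at this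
    simp only [Real.dist_eq, Real.norm_eq_abs, Real.coe_nnabs, abs_mul, abs_norm,
      abs_abs, NNReal.abs_eq] at this ⊢
    rw [← mul_sub, abs_mul]
    calc |f w| * |k (w + t • z) - k (w + t' • z)| ≤ |f w| * (K * (|t - t'| * ‖z‖)) := by gcongr
      _ = _ := by ring
  · exact hf.abs.mul_const _
  · have : ∀ᵐ w : Euc d, DifferentiableAt ℝ k (w + s • z) :=
      (measurePreserving_add_right volume (s • z)).quasiMeasurePreserving.ae hk.diff
    filter_upwards [this] with w hw
    refine HasDerivAt.const_mul (f w) ?_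
    have h1 : HasDerivAt (fun t : ℝ => w + t • z) z s := by
      simpa using ((hasDerivAt_id s).smul_const z).const_add w
    have := hw.hasFDerivAt.comp_hasDerivAt s h1
    rw [inner_grad]
    exact this
end

section
def mollB (k : ℕ) : ContDiffBump (0 : Euc d) :=
  ⟨1 / ((k : ℝ) + 1), 2 / ((k : ℝ) + 1), by positivity, by gcongr; norm_num⟩

def moll {E : Type*} [NormedAddCommGroup E] [NormedSpace ℝ E] (k : ℕ) (g : Euc d → E) :
    Euc d → E :=
  convolution ((mollB k : ContDiffBump (0 : Euc d)).normed volume) g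
    (ContinuousLinearMap.lsmul ℝ ℝ) volume

section
variable {E : Type*} [NormedAddCommGroup E] [NormedSpace ℝ E]

theorem moll_eq (k : ℕ) (g : Euc d → E) (x : Euc d) :
    moll k g x = ∫ t, (mollB k : ContDiffBump (0 : Euc d)).normed volume t • g (x - t) := rfl

theorem mollB_tendsto : Tendsto (fun k : ℕ => (mollB k : ContDiffBump (0 : Euc d)).rOut) atTop (𝓝 0) := by
  have h := (tendsto_one_div_add_atTop_nhds_zero_nat (𝕜 := ℝ)).const_mul 2
  simp only [mul_zero, mul_one_div] at h
  exact h

theorem moll_ae [CompleteSpace E] {g : Euc d → E} (hg : LocallyIntegrable g volume) :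
    ∀ᵐ x, Tendsto (fun k => moll k g x) atTop (𝓝 (g x)) := by
  refine ContDiffBump.ae_convolution_tendsto_right_of_locallyIntegrable (K := 2)
    mollB_tendsto (Eventually.of_forall fun k => ?_) hg
  simp only [mollB]
  exact le_of_eq (by ring)

theorem moll_bound {g : Euc d → E} {C : ℝ} (hC : ∀ x, ‖g x‖ ≤ C) (k : ℕ) (x : Euc d) :
    ‖moll k g x‖ ≤ C := by
  rw [moll_eq]
  have hi := (mollB k : ContDiffBump (0 : Euc d)).integrable_normed (μ := volume)
  calc _ ≤ ∫ t, (mollB k : ContDiffBump (0 : Euc d)).normed volume t * C := by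
        refine norm_integral_le_of_norm_le (hi.mul_const C) (Eventually.of_forall fun t => ?_)
        rw [norm_smul, Real.norm_of_nonneg (ContDiffBump.nonneg_normed _ _)]
        exact mul_le_mul_of_nonneg_left (hC _) (ContDiffBump.nonneg_normed _ _)
    _ = C := by rw [integral_mul_const, ContDiffBump.integral_normed, one_mul]

theorem moll_tsupport (g : Euc d → E) (k : ℕ) :
    tsupport (moll k g) ⊆ cthickening (2 / ((k : ℝ) + 1)) (Function.support g) := by
  refine closure_minimal ?_ isClosed_cthickening
  refine (support_convolution_subset _).trans ?_
  rw [ContDiffBump.support_normed_eq]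
  rintro _ ⟨a, ha, b, hb, rfl⟩
  refine mem_cthickening_of_dist_le _ b _ _ hb ?_
  simp only [mollB, mem_ball, dist_zero_right] at ha
  simpa using ha.le

theorem moll_smooth {g : Euc d → E} (hg : LocallyIntegrable g volume) (k : ℕ) :
    ContDiff ℝ (⊤ : ℕ∞) (moll k g) :=
  HasCompactSupport.contDiff_convolution_left _ (ContDiffBump.hasCompactSupport_normed _)
    (ContDiffBump.contDiff_normed _) hg

theorem moll_cs {g : Euc d → E} (hg : ∃ R, ∀ x, R < ‖x‖ → g x = 0) (k : ℕ) :
    HasCompactSupport (moll k g) := by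
  obtain ⟨R, hR⟩ := hg
  have hs : Function.support g ⊆ closedBall 0 R := by
    intro x hx
    by_contra hc
    exact hx (hR x (by simpa using hc))
  refine HasCompactSupport.intro (isCompact_closedBall (0 : Euc d) (R + 2 / ((k : ℝ) + 1) + 1)) ?_
  intro x hx
  by_contra hc
  apply hx
  have h1 := moll_tsupport g k (subset_tsupport _ hc)
  have h2 := cthickening_subset_of_subset (2 / ((k : ℝ) + 1)) hs h1
  have h3 := cthickening_subset_thickening' (δ₂ := 2 / ((k : ℝ) + 1) + 1) (by positivity) (by linarith) _ h2
  rw [mem_thickening_iff] at h3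
  obtain ⟨z, hz, hz'⟩ := h3
  rw [mem_closedBall] at hz ⊢
  linarith [dist_triangle x z 0]
end

theorem smooth_LC {f : Euc d → ℝ} (h1 : ContDiff ℝ (⊤ : ℕ∞) f) (h2 : HasCompactSupport f) : LC f := by
  refine ⟨?_, h2⟩
  exact ContDiff.lipschitzWith_of_hasCompactSupport h2 h1 (by simp)

theorem moll_grad {w : Euc d → ℝ} (hw : LC w) (k : ℕ) (x : Euc d) :
    gradient (moll k w) x = moll k (gradient w) x := by
  obtain ⟨⟨K, hK⟩, hc⟩ := id hw
  obtain ⟨C, hC⟩ := hw.bc.bd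
  set b := (mollB k : ContDiffBump (0 : Euc d)).normed volume with hb
  have hbi : Integrable b := (mollB k : ContDiffBump (0 : Euc d)).integrable_normed (μ := volume)
  have hcont : ∀ x : Euc d, Continuous (fun t : Euc d => w (x - t)) := fun s =>
    hw.cont.comp (by fun_prop)
  have hdm : AEStronglyMeasurable (fun t => b t • fderiv ℝ w (x - t)) volume :=
    hbi.aestronglyMeasurable.smul
      ((measurable_fderiv ℝ w).comp (measurable_const.sub measurable_id)).aestronglyMeasurable
  have key := (hasFDerivAt_integral_of_dominated_loc_of_lip (s := univ) (x₀ := x)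
    (F := fun x t => b t * w (x - t)) (F' := fun t => b t • fderiv ℝ w (x - t)) (μ := volume)
    (bound := fun t => |b t| * K) (𝕜 := ℝ) univ_mem
    (Eventually.of_forall fun x => hbi.aestronglyMeasurable.mul (hcont x).aestronglyMeasurable)
    (hbi.mul_bdd (c := C) (hcont x).aestronglyMeasurable (Eventually.of_forall fun x => hC _))
    hdm ?_ (hbi.abs.mul_const _) ?_)
  · have e : moll k (gradient w) x = ∫ t, (InnerProductSpace.toDual ℝ (Euc d)).symm.toContinuousLinearEquiv.toContinuousLinearMap (b t • fderiv ℝ w (x - t)) := by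
      rw [moll_eq]
      refine integral_congr_ae (Eventually.of_forall fun t => ?_)
      simp [gradient, hb]
    have e2 : moll k w = fun x => ∫ t, b t * w (x - t) := rfl
    rw [e, ContinuousLinearMap.integral_comp_comm _ key.1, ← key.2.fderiv, e2]
    rfl
  · refine Eventually.of_forall fun t => LipschitzOnWith.of_dist_le_mul fun y _ y' _ => ?_
    have := hK.dist_le_mul (y - t) (y' - t)
    rw [dist_sub_right] at this
    simp only [Real.dist_eq, Real.coe_nnabs, abs_mul, abs_abs, NNReal.abs_eq] at this ⊢
    rw [← mul_sub, abs_mul, mul_assoc]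
    gcongr
  · have : ∀ᵐ t : Euc d, DifferentiableAt ℝ w (x - t) :=
      (Measure.measurePreserving_sub_left volume x).quasiMeasurePreserving.ae hw.diff
    filter_upwards [this] with t ht
    refine HasFDerivAt.const_mul ?_ (b t)
    exact ht.hasFDerivAt.comp x (f := fun y => y - t) ((hasFDerivAt_id x).sub_const t)

def Jf (lam : ℝ) (f : Euc d → ℝ) : ℝ := ∫ x, (‖gradient f x‖ ^ 2 - lam * f x ^ 2)

def Bf (lam : ℝ) (f g : Euc d → ℝ) : ℝ := ∫ x, (⟪gradient f x, gradient g x⟫ - lam * (f x * g x))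

theorem LC.g2 {f : Euc d → ℝ} (h : LC f) : BC (fun x => ‖gradient f x‖ ^ 2) := h.gbc.norm.pow2

theorem LC.jbc {f : Euc d → ℝ} (h : LC f) (lam : ℝ) : BC (fun x => ‖gradient f x‖ ^ 2 - lam * f x ^ 2) :=
  h.g2.sub (h.bc.pow2.const_mul lam)

theorem LC.bbc {f g : Euc d → ℝ} (h : LC f) (h' : LC g) (lam : ℝ) :
    BC (fun x => ⟪gradient f x, gradient g x⟫ - lam * (f x * g x)) :=
  (h.gbc.inner h'.gbc).sub ((h.bc.mul h'.bc).const_mul lam)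

theorem Jf_eq {f : Euc d → ℝ} (h : LC f) (lam : ℝ) :
    Jf lam f = (∫ x, ‖gradient f x‖ ^ 2) - lam * ∫ x, f x ^ 2 := by
  rw [Jf, integral_sub h.g2.integrable (h.bc.pow2.const_mul lam).integrable, integral_const_mul]

theorem Jf_add {f g : Euc d → ℝ} (h : LC f) (h' : LC g) (lam t : ℝ) :
    Jf lam (fun x => f x + t * g x) = Jf lam f + 2 * t * Bf lam f g + t ^ 2 * Jf lam g := by
  rw [Jf, Jf, Bf, Jf, ← integral_const_mul, ← integral_const_mul,
    ← integral_add (h.jbc lam).integrable ((h.bbc h' lam).const_mul _).integrable,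
    ← integral_add ((h.jbc lam).add ((h.bbc h' lam).const_mul _)).integrable
      ((h'.jbc lam).const_mul _).integrable]
  refine integral_congr_ae ?_
  filter_upwards [h.diff, h'.diff] with x hx hx'
  have h3 : gradient (fun x => f x + t * g x) x = gradient f x + t • gradient g x := by
    rw [grad_add hx (hx'.const_mul t), grad_cmul t hx']
  rw [h3, norm_add_sq_real, inner_smul_right, norm_smul, mul_pow, Real.norm_eq_abs, sq_abs]
  ring

theorem Jf_cmul {f : Euc d → ℝ} (h : LC f) (lam t : ℝ) :
    Jf lam (fun x => t * f x) = t ^ 2 * Jf lam f := by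
  have := Jf_add ((h.cmul 0)) h lam t
  have h0 : ∀ g, Jf lam (fun x => 0 * f x) = 0 ∧ Bf lam (fun x => 0 * f x) g = 0 := by
    intro g; simp [Jf, Bf, gradient_fun_const]
  rw [(h0 f).1, (h0 f).2] at this
  simpa using this

/-- Cauchy-Schwarz for a form nonnegative on the span. -/
theorem Bf_sq_le {f g : Euc d → ℝ} (h : LC f) (h' : LC g) (lam : ℝ)
    (hp : ∀ t : ℝ, 0 ≤ Jf lam (fun x => f x + t * g x)) :
    Bf lam f g ^ 2 ≤ Jf lam f * Jf lam g := by
  have h1 : ∀ t : ℝ, 0 ≤ Jf lam g * (t * t) + 2 * Bf lam f g * t + Jf lam f := by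
    intro t
    have := hp t
    rw [Jf_add h h'] at this
    nlinarith
  have := discrim_le_zero h1
  rw [discrim] at this
  nlinarith

theorem moll_J {w : Euc d → ℝ} (hw : LC w) (lam : ℝ) :
    Tendsto (fun k => Jf lam (moll k w)) atTop (𝓝 (Jf lam w)) := by
  obtain ⟨C, hC⟩ := hw.bc.bd
  obtain ⟨C', hC'⟩ := hw.gbc.bd
  have hL : ∀ k, LC (moll k w) := fun k =>
    smooth_LC (moll_smooth hw.bc.integrable.locallyIntegrable k) (moll_cs hw.bc.cs k)
  obtain ⟨R, hR⟩ := cs_bound hw.2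
  have hs : Function.support w ⊆ closedBall 0 R := by
    intro x hx
    by_contra hc
    exact hR x (by simpa using hc) (subset_tsupport _ hx)
  have hz : ∀ k, ∀ x, x ∉ closedBall (0 : Euc d) (R + 3) → x ∉ tsupport (moll k w) := by
    intro k x hx hc
    apply hx
    have h1 := cthickening_subset_of_subset (2 / ((k : ℝ) + 1)) hs (moll_tsupport w k hc)
    have h0 : (2 : ℝ) / ((k : ℝ) + 1) ≤ 2 := div_le_self (by norm_num) (by linarith [k.cast_nonneg (α := ℝ)])
    have h3 := cthickening_subset_thickening' (δ₂ := 3) (by norm_num) (by linarith) _ h1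
    rw [mem_thickening_iff] at h3
    obtain ⟨z, hz, hz'⟩ := h3
    rw [mem_closedBall] at hz ⊢
    linarith [dist_triangle x z 0]
  refine tendsto_integral_of_dominated_convergence
    ((closedBall (0 : Euc d) (R + 3)).indicator (fun _ => C' ^ 2 + |lam| * C ^ 2))
    (fun k => ((hL k).jbc lam).meas) ?_ ?_ ?_
  · rw [integrable_indicator_iff measurableSet_closedBall]
    exact integrableOn_const (by exact measure_closedBall_lt_top.ne)
  · refine fun k => Eventually.of_forall fun x => ?_
    by_cases hx : x ∈ closedBall (0 : Euc d) (R + 3)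
    · rw [indicator_of_mem hx]
      refine (norm_sub_le _ _).trans ?_
      rw [norm_pow, norm_mul, norm_norm, norm_pow, moll_grad hw]
      have := moll_bound hC k x
      have := moll_bound hC' k x
      simp only [Real.norm_eq_abs] at *
      gcongr
    · rw [indicator_of_notMem hx]
      rw [grad_zero_of_notMem (hz k x hx), image_eq_zero_of_notMem_tsupport (hz k x hx)]
      simp
  · filter_upwards [moll_ae hw.bc.integrable.locallyIntegrable,
      moll_ae hw.gbc.integrable.locallyIntegrable] with x h1 h2
    simp only [moll_grad hw]
    exact (h2.norm.pow 2).sub ((h1.pow 2).const_mul lam)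

theorem J_nonneg_of_test {U : Set (Euc d)} (hU : IsOpen U) {lam : ℝ} {w : Euc d → ℝ} (hw : LC w)
    (hs : tsupport w ⊆ U) (h : ∀ v, TestFun U v → 0 ≤ Jf lam v) : 0 ≤ Jf lam w := by
  obtain ⟨δ, hδ, hδ'⟩ := hw.2.isCompact.exists_cthickening_subset_open hU hs
  refine ge_of_tendsto (moll_J hw lam) ?_
  have h1 := (mollB_tendsto (d := d)).eventually (gt_mem_nhds hδ)
  filter_upwards [h1] with k hk
  refine h _ ⟨moll_smooth hw.bc.integrable.locallyIntegrable k, moll_cs hw.bc.cs k, ?_⟩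
  refine (moll_tsupport w k).trans (Subset.trans ?_ hδ')
  refine (cthickening_mono (le_of_lt hk) _).trans (cthickening_subset_of_subset _ (subset_tsupport _))

theorem Jf_posl_le {f : Euc d → ℝ} (h : LC f) {lam ε : ℝ} (hl : 0 ≤ lam) (hε : 0 ≤ ε) (h0 : ∀ x, 0 ≤ f x) :
    Jf lam (fun x => max (f x - ε) 0) + ∫ x in {x | f x < ε}, ‖gradient f x‖ ^ 2
      ≤ Jf lam f + 2 * lam * ε * ∫ x, f x := by
  have hm : MeasurableSet {x | f x < ε} := measurableSet_lt h.cont.measurable measurable_const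
  rw [← integral_indicator hm, Jf, Jf, ← integral_const_mul,
    ← integral_add ((h.posl hε).jbc lam).integrable (h.g2.ind hm).integrable,
    ← integral_add (h.jbc lam).integrable (h.bc.const_mul _).integrable]
  refine integral_mono ((((h.posl hε).jbc lam).add (h.g2.ind hm)).integrable)
    (((h.jbc lam).add (h.bc.const_mul _)).integrable) fun x => ?_
  beta_reduce
  rw [grad_pos (f := fun y => f y - ε) (h.cont.sub continuous_const)]
  have hg : gradient (fun y => f y - ε) x = gradient f x := by
    simp only [gradient]; rw [fderiv_sub_const]
  rw [hg]
  have := h0 x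
  by_cases hx : f x < ε
  · rw [indicator_of_mem (by exact hx), if_neg (by linarith), max_eq_right (by linarith)]
    simp only [norm_zero]
    nlinarith [mul_nonneg hl (mul_nonneg this (sub_nonneg.2 hx.le)), mul_nonneg hl (mul_nonneg this hε)]
  · rw [indicator_of_notMem (by exact hx), max_eq_left (by linarith)]
    have h5 : ‖(if 0 < f x - ε then gradient f x else 0)‖ ^ 2 ≤ ‖gradient f x‖ ^ 2 := by
      split_ifs <;> simp
    nlinarith [mul_nonneg hl (sq_nonneg ε)]
end

section
def omg (d : ℕ) : ℝ := mvol (ball (0 : Euc d) 1)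

theorem omg_pos : 0 < omg d :=
  ENNReal.toReal_pos (measure_ball_pos volume _ one_pos).ne' measure_ball_lt_top.ne

theorem mvol_ball (hd : 0 < d) (x : Euc d) {r : ℝ} (hr : 0 ≤ r) : mvol (ball x r) = r ^ d * omg d := by
  have : Nonempty (Fin d) := ⟨⟨0, hd⟩⟩
  rw [mvol, Measure.addHaar_ball _ _ hr, ENNReal.toReal_mul, ENNReal.toReal_ofReal (by positivity)]
  simp [omg, mvol]

theorem mvol_closedBall (x : Euc d) {r : ℝ} (hr : 0 ≤ r) :
    mvol (closedBall x r) = r ^ d * omg d := by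
  rw [mvol, Measure.addHaar_closedBall _ _ hr, ENNReal.toReal_mul,
    ENNReal.toReal_ofReal (by positivity)]
  simp [omg, mvol]

theorem mvol_mono {s t : Set (Euc d)} (h : s ⊆ t) (ht : volume t ≠ ⊤) : mvol s ≤ mvol t :=
  ENNReal.toReal_mono ht (measure_mono h)

theorem mvol_nonneg (s : Set (Euc d)) : 0 ≤ mvol s := ENNReal.toReal_nonneg

theorem ivt_vol (hd : 0 < d) {S G : Set (Euc d)} (hSf : volume S ≠ ⊤) (x : Euc d)
    {R a : ℝ} (hR : 0 ≤ R)
    (h1 : mvol S ≤ a) (h2 : a ≤ mvol (S ∪ (G ∩ ball x R))) :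
    ∃ r ∈ Icc 0 R, mvol (S ∪ (G ∩ ball x r)) = a := by
  have hf : ∀ r, volume (S ∪ (G ∩ ball x r)) ≠ ⊤ := fun r =>
    ((measure_union_le _ _).trans_lt (ENNReal.add_lt_top.2 ⟨hSf.lt_top,
      (measure_mono inter_subset_right).trans_lt measure_ball_lt_top⟩)).ne
  have key : ∀ r r', 0 ≤ r → r ≤ r' →
      mvol (S ∪ (G ∩ ball x r')) - mvol (S ∪ (G ∩ ball x r)) ≤ r' ^ d * omg d - r ^ d * omg d := by
    intro r r' hr hrr
    rw [← mvol_ball hd x hr, ← mvol_ball hd x (hr.trans hrr)]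
    have e1 : mvol (ball x r') = mvol (ball x r) + mvol (ball x r' \ ball x r) := by
      have := measureReal_sdiff_add_inter (μ := volume) (s := ball x r') (measurableSet_ball (x := x) (ε := r))
        measure_ball_lt_top.ne
      rw [inter_eq_self_of_subset_right (ball_subset_ball hrr)] at this
      simp only [mvol]
      simp only [measureReal_def] at this
      linarith
    have e2 : mvol (S ∪ (G ∩ ball x r')) ≤ mvol (S ∪ (G ∩ ball x r)) + mvol (ball x r' \ ball x r) := by
      refine (mvol_mono (t := (S ∪ (G ∩ ball x r)) ∪ (ball x r' \ ball x r)) ?_ ?_).trans ?_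
      · intro y hy
        by_cases hyr : y ∈ ball x r
        · rcases hy with hy | hy
          · exact Or.inl (Or.inl hy)
          · exact Or.inl (Or.inr ⟨hy.1, hyr⟩)
        · rcases hy with hy | hy
          · exact Or.inl (Or.inl hy)
          · exact Or.inr ⟨hy.2, hyr⟩
      · exact ((measure_union_le _ _).trans_lt (ENNReal.add_lt_top.2 ⟨(hf r).lt_top,
          (measure_mono sdiff_subset).trans_lt measure_ball_lt_top⟩)).ne
      · exact measureReal_union_le _ _
    linarith
  have hc : ContinuousOn (fun r => mvol (S ∪ (G ∩ ball x r))) (Icc 0 R) := by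
    have hm : ∀ r r', r ≤ r' → mvol (S ∪ (G ∩ ball x r)) ≤ mvol (S ∪ (G ∩ ball x r')) :=
      fun r r' h => mvol_mono (union_subset_union_right _
        (inter_subset_inter_right _ (ball_subset_ball h))) (hf r')
    have hv : ContinuousOn (fun r : ℝ => r ^ d * omg d) (Icc 0 R) := by fun_prop
    rw [Metric.continuousOn_iff] at hv ⊢
    intro b hb ε hε
    obtain ⟨δ, hδ, h⟩ := hv b hb ε hε
    refine ⟨δ, hδ, fun r hr hrd => lt_of_le_of_lt ?_ (h r hr hrd)⟩
    simp only [Real.dist_eq]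
    rcases le_total r b with hrb | hrb
    · rw [abs_sub_comm, abs_of_nonneg (sub_nonneg.2 (hm _ _ hrb)), abs_sub_comm]
      exact (key r b hr.1 hrb).trans (le_abs_self _)
    · rw [abs_of_nonneg (sub_nonneg.2 (hm _ _ hrb))]
      exact (key b r hb.1 hrb).trans (le_abs_self _)
  have := intermediate_value_Icc hR hc
  obtain ⟨r, hr, h⟩ := this (⟨by simpa using h1, h2⟩ : a ∈ Icc _ _)
  exact ⟨r, hr, h⟩

theorem test_LC {U : Set (Euc d)} {v : Euc d → ℝ} (h : TestFun U v) : LC v := smooth_LC h.1 h.2.1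

theorem test_mem {U : Set (Euc d)} {v : Euc d → ℝ} (h : TestFun U v) : MemH10 U v := by
  refine ⟨(test_LC h).bc.memLp 2, (test_LC h).gbc.memLp 2, fun _ => v, fun _ => h, ?_⟩
  simp

theorem test_cmul {U : Set (Euc d)} {v : Euc d → ℝ} (h : TestFun U v) (c : ℝ) :
    TestFun U (fun x => c * v x) := by
  refine ⟨contDiff_const.mul h.1, h.2.1.mul_left, ?_⟩
  refine Subset.trans (closure_mono ?_) h.2.2
  intro x hx hc
  exact hx (by simp [hc])

theorem lam1_bdd (U : Set (Euc d)) : BddBelow {t : ℝ | ∃ v : Euc d → ℝ, MemH10 U v ∧ (∫ x, (v x) ^ 2) = 1 ∧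
    t = ∫ x, ‖gradient v x‖ ^ 2} := by
  refine ⟨0, ?_⟩
  rintro t ⟨v, _, _, rfl⟩
  exact integral_nonneg fun x => by positivity

theorem lam1_nonneg (U : Set (Euc d)) : 0 ≤ lam1 U := by
  refine Real.sInf_nonneg ?_
  rintro t ⟨v, _, _, rfl⟩
  exact integral_nonneg fun x => by positivity

theorem Jf_mono_lam {f : Euc d → ℝ} (h : LC f) {l l' : ℝ} (hl : l ≤ l') : Jf l' f ≤ Jf l f := by
  rw [Jf_eq h, Jf_eq h]
  have : 0 ≤ ∫ x, f x ^ 2 := integral_nonneg fun x => by positivity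
  nlinarith

theorem test_J {U : Set (Euc d)} {v : Euc d → ℝ} (h : TestFun U v) : 0 ≤ Jf (lam1 U) v := by
  have hL := test_LC h
  have hp : 0 ≤ ∫ x, v x ^ 2 := integral_nonneg fun x => by positivity
  rcases hp.eq_or_lt with h0 | h0
  · rw [Jf_eq hL, ← h0, mul_zero, sub_zero]
    exact integral_nonneg fun x => by positivity
  · set m := ∫ x, v x ^ 2 with hm
    have hs : (1 / √m) ^ 2 = 1 / m := by rw [div_pow, Real.sq_sqrt hp, one_pow]
    have hj := Jf_cmul hL (lam1 U) (1 / √m)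
    have : 0 ≤ Jf (lam1 U) (fun x => 1 / √m * v x) := by
      have hn : ∫ x, (1 / √m * v x) ^ 2 = 1 := by
        simp_rw [mul_pow, hs]
        rw [integral_const_mul, ← hm]
        field_simp
      rw [Jf_eq (hL.cmul _), hn, mul_one, sub_nonneg]
      exact csInf_le (lam1_bdd U) ⟨_, test_mem (test_cmul h _), hn, rfl⟩
    rw [hj, hs] at this
    by_contra hc
    push Not at hc
    have : 1 / m * Jf (lam1 U) v < 0 := mul_neg_of_pos_of_neg (by positivity) hc
    linarith

def MinJ (D : Set (Euc d)) (a lam : ℝ) : Prop :=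
  ∀ w : Euc d → ℝ, LC w → (∀ x ∉ D, w x = 0) → mvol {x | w x ≠ 0} ≤ a → 0 ≤ Jf lam w

theorem minJ (hd : 0 < d) {D Ω : Set (Euc d)} {a : ℝ} (hD : IsOpen D) (hDb : Bornology.IsBounded D)
    (ha' : a < mvol D) (hopt : IsOptimalShape D a Ω) : MinJ D a (lam1 Ω) := by
  intro w hw hwD hwa
  have hU : IsOpen {x | w x ≠ 0} := isOpen_ne_fun hw.cont continuous_const
  have hUD : {x | w x ≠ 0} ⊆ D := fun x hx => by
    by_contra hc; exact hx (hwD x hc)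
  obtain ⟨R, hR0, hR⟩ := hDb.subset_ball_lt 0 (0 : Euc d)
  have hDf : volume D ≠ ⊤ := ((measure_mono hR).trans_lt measure_ball_lt_top).ne
  have hUf : volume {x | w x ≠ 0} ≠ ⊤ := ((measure_mono hUD).trans_lt hDf.lt_top).ne
  obtain ⟨r, -, hr⟩ := ivt_vol hd hUf (G := D) 0 hR0.le hwa (by
    rw [inter_eq_self_of_subset_left hR, union_eq_self_of_subset_left hUD]; exact ha'.le)
  set Ω' := {x | w x ≠ 0} ∪ (D ∩ ball 0 r) with hΩ'
  have hΩ'o : IsOpen Ω' := hU.union (hD.inter isOpen_ball)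
  have hle := hopt.minim Ω' hΩ'o (union_subset hUD inter_subset_left) hr
  have hl := lam1_nonneg Ω
  set lam := lam1 Ω
  have key : ∀ ε > 0, 0 ≤ Jf lam w + ε * (2 * lam * ∫ x, |w x|) := by
    intro ε hε
    have hT1 := hw.posl hε.le
    have hT2 := hw.neg.posl hε.le
    have hT := hT1.sub hT2
    have h1 : 0 ≤ Jf lam (fun x => max (w x - ε) 0 - max (- w x - ε) 0) := by
      refine J_nonneg_of_test hΩ'o hT ?_ fun v hv => (test_J hv).trans (Jf_mono_lam (test_LC hv) hle)
      have hcl : IsClosed {x | ε ≤ |w x|} := isClosed_le continuous_const hw.cont.abs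
      refine (closure_minimal ?_ hcl).trans ?_
      · intro x hx
        by_contra hc
        simp only [mem_ofPred_eq, not_le, abs_lt] at hc
        exact hx (by simp only []; rw [max_eq_right (by linarith), max_eq_right (by linarith)]; simp)
      · intro x hx
        refine Or.inl fun h0 => ?_
        simp only [mem_ofPred_eq, h0, abs_zero] at hx
        linarith
    refine h1.trans ?_
    rw [← mul_assoc, Jf, Jf, ← integral_const_mul,
      ← integral_add (hw.jbc lam).integrable (hw.bc.abs.const_mul _).integrable]
    refine integral_mono_ae (hT.jbc lam).integrable
      ((hw.jbc lam).add (hw.bc.abs.const_mul _)).integrable ?_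
    filter_upwards [hT1.diff, hT2.diff] with x h1 h2
    rw [grad_sub h1 h2, grad_pos (f := fun y => w y - ε) (hw.cont.sub continuous_const),
      grad_pos (f := fun y => - w y - ε) (hw.cont.neg.sub continuous_const)]
    have hg1 : gradient (fun y => w y - ε) x = gradient w x := by
      simp only [gradient]; rw [fderiv_sub_const]
    have hg2 : gradient (fun y => - w y - ε) x = - gradient w x := by
      simp only [gradient]; rw [fderiv_sub_const, fderiv_fun_neg, map_neg]
    rw [hg1, hg2]
    have hn : 0 ≤ ‖gradient w x‖ ^ 2 := by positivity
    rcases lt_or_ge ε (w x) with h | h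
    · rw [if_pos (by linarith), if_neg (by linarith), max_eq_left (by linarith),
        max_eq_right (by linarith), abs_of_pos (by linarith), sub_zero, sub_zero]
      nlinarith [mul_nonneg hl (sq_nonneg ε)]
    · rcases lt_or_ge ε (- w x) with h' | h'
      · rw [if_neg (by linarith), if_pos (by linarith), max_eq_right (by linarith),
          max_eq_left (by linarith), abs_of_neg (by linarith), zero_sub, neg_neg]
        nlinarith [mul_nonneg hl (sq_nonneg ε)]
      · rw [if_neg (by linarith), if_neg (by linarith), max_eq_right (by linarith),
          max_eq_right (by linarith), sub_zero, norm_zero]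
        have : |w x| ≤ ε := abs_le.2 ⟨by linarith, h⟩
        have h9 := sq_abs (w x)
        have : 0 ≤ lam * (2 * ε * |w x| - |w x| ^ 2) := by
          refine mul_nonneg hl ?_
          nlinarith [abs_nonneg (w x)]
        nlinarith
  have ht : Tendsto (fun ε : ℝ => Jf lam w + ε * (2 * lam * ∫ x, |w x|)) (𝓝[>] 0)
      (𝓝 (Jf lam w + 0 * (2 * lam * ∫ x, |w x|))) := by
    refine Tendsto.mono_left (Continuous.tendsto (by fun_prop) 0) nhdsWithin_le_nhds
  rw [zero_mul, add_zero] at ht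
  exact ge_of_tendsto ht (eventually_mem_nhdsWithin.mono fun ε hε => key ε hε)

theorem exists_test {U : Set (Euc d)} (hU : IsOpen U) (hne : U.Nonempty) :
    ∃ v, TestFun U v ∧ 0 < ∫ x, v x ^ 2 := by
  obtain ⟨x, hx⟩ := hne
  obtain ⟨r, hr, hrU⟩ := Metric.isOpen_iff.1 hU x hx
  let b : ContDiffBump x := ⟨r / 4, r / 2, by positivity, by linarith⟩
  have hT : TestFun U b := by
    refine ⟨b.contDiff, b.hasCompactSupport, ?_⟩
    rw [b.tsupport_eq]
    exact (closedBall_subset_ball (by simp [b]; linarith)).trans hrU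
  refine ⟨b, hT, ?_⟩
  rw [integral_pos_iff_support_of_nonneg (fun x => by positivity) (test_LC hT).bc.pow2.integrable]
  have : Function.support (fun x => b x ^ 2) = ball x b.rOut := by
    rw [← b.support_eq]; ext y; simp
  rw [this]
  exact measure_ball_pos volume _ b.rOut_pos

theorem exists_min {Ω : Set (Euc d)} (hΩ : IsOpen Ω) (hne : Ω.Nonempty) {ε : ℝ} (hε : 0 < ε) :
    ∃ φ, LC φ ∧ (∀ x, 0 ≤ φ x) ∧ tsupport φ ⊆ Ω ∧ ∫ x, φ x ^ 2 = 1 ∧ Jf (lam1 Ω) φ ≤ ε := by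
  have h1 : ∃ v, TestFun Ω v ∧ Jf (lam1 Ω + ε) v < 0 := by
    by_contra hcon
    push Not at hcon
    have hS : {t : ℝ | ∃ v : Euc d → ℝ, MemH10 Ω v ∧ (∫ x, (v x) ^ 2) = 1 ∧
        t = ∫ x, ‖gradient v x‖ ^ 2}.Nonempty := by
      obtain ⟨v, hv, hv0⟩ := exists_test hΩ hne
      refine ⟨_, _, test_mem (test_cmul hv (1 / √(∫ x, v x ^ 2))), ?_, rfl⟩
      simp_rw [mul_pow, div_pow, Real.sq_sqrt hv0.le]
      rw [integral_const_mul]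
      field_simp
    have : lam1 Ω + ε ≤ lam1 Ω := by
      refine le_csInf hS ?_
      rintro t ⟨v, ⟨hv1, hv2, φ, hφ, hlim⟩, hvn, rfl⟩
      have hv1i : Integrable (fun x => v x ^ 2) := hv1.integrable_sq
      have hv2i : Integrable (fun x => ‖gradient v x‖ ^ 2) := hv2.integrable_norm_pow (by norm_num)
      have hl := lam1_nonneg Ω
      set l := lam1 Ω + ε with hldef
      have hl0 : 0 < l := by linarith
      have hint : ∀ n, Integrable (fun x => (v x - φ n x) ^ 2 + ‖gradient v x - gradient (φ n) x‖ ^ 2) :=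
        fun n => ((hv1.sub ((test_LC (hφ n)).bc.memLp 2)).integrable_sq).add
          ((hv2.sub ((test_LC (hφ n)).gbc.memLp 2)).integrable_norm_pow (by norm_num))
      have key : ∀ t > 0, ∀ n, (1 - t) * l ≤ (1 + t) * (∫ x, ‖gradient v x‖ ^ 2) +
          (1 + 1 / t) * (1 + l) * ∫ x, ((v x - φ n x) ^ 2 + ‖gradient v x - gradient (φ n) x‖ ^ 2) := by
        intro t ht n
        have h2 := hcon (φ n) (hφ n)
        have hL := test_LC (hφ n)
        have h3 : Jf l (φ n) ≤ ∫ x, ((1 + t) * ‖gradient v x‖ ^ 2 +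
          (1 + 1 / t) * (1 + l) * ((v x - φ n x) ^ 2 + ‖gradient v x - gradient (φ n) x‖ ^ 2)
          - (1 - t) * l * v x ^ 2) := by
          refine integral_mono (hL.jbc l).integrable
            (((hv2i.const_mul _).add ((hint n).const_mul _)).sub (hv1i.const_mul _)) fun x => ?_
          beta_reduce
          have h4 : ‖gradient (φ n) x‖ ≤ ‖gradient v x‖ + ‖gradient v x - gradient (φ n) x‖ := by
            have := norm_sub_le (gradient v x) (gradient v x - gradient (φ n) x)
            simpa using this
          set A := ‖gradient v x‖
          set Bb := ‖gradient v x - gradient (φ n) x‖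
          have hA : 0 ≤ A := norm_nonneg _
          have hB : 0 ≤ Bb := norm_nonneg _
          have h5 : ‖gradient (φ n) x‖ ^ 2 ≤ (1 + t) * A ^ 2 + (1 + 1 / t) * Bb ^ 2 := by
            have e : (1 + t) * A ^ 2 + (1 + 1 / t) * Bb ^ 2 = (A + Bb) ^ 2 + (t * A - Bb) ^ 2 / t := by
              field_simp; ring
            rw [e]
            have : 0 ≤ (t * A - Bb) ^ 2 / t := by positivity
            nlinarith [norm_nonneg (gradient (φ n) x)]
          have h6 : (1 - t) * v x ^ 2 ≤ φ n x ^ 2 + (1 + 1 / t) * (v x - φ n x) ^ 2 := by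
            have e : φ n x ^ 2 + (1 + 1 / t) * (v x - φ n x) ^ 2 - (1 - t) * v x ^ 2
              = (t * v x - (v x - φ n x)) ^ 2 / t + 2 * (v x - φ n x) ^ 2 := by
              field_simp; ring
            have : 0 ≤ (t * v x - (v x - φ n x)) ^ 2 / t := by positivity
            nlinarith [sq_nonneg (v x - φ n x)]
          have h7 := mul_le_mul_of_nonneg_left h6 hl0.le
          have h8 : 0 ≤ (1 + 1 / t) * (v x - φ n x) ^ 2 := by positivity
          have h9 : 0 ≤ (1 + 1 / t) * l * Bb ^ 2 := by positivity
          nlinarith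
        rw [integral_sub (by exact (hv2i.const_mul _).add ((hint n).const_mul _)) (hv1i.const_mul _),
          integral_add (hv2i.const_mul _) ((hint n).const_mul _), integral_const_mul,
          integral_const_mul, integral_const_mul, hvn, mul_one] at h3
        linarith
      have key2 : ∀ t > 0, (1 - t) * l ≤ (1 + t) * (∫ x, ‖gradient v x‖ ^ 2) := by
        intro t ht
        have := (hlim.const_mul ((1 + 1 / t) * (1 + l))).const_add ((1 + t) * (∫ x, ‖gradient v x‖ ^ 2))
        rw [mul_zero, add_zero] at this
        exact ge_of_tendsto this (Eventually.of_forall (key t ht))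
      have ht : Tendsto (fun t : ℝ => (1 + t) * (∫ x, ‖gradient v x‖ ^ 2) - (1 - t) * l) (𝓝[>] 0)
          (𝓝 ((1 + 0) * (∫ x, ‖gradient v x‖ ^ 2) - (1 - 0) * l)) :=
        Tendsto.mono_left (Continuous.tendsto (by fun_prop) 0) nhdsWithin_le_nhds
      have := ge_of_tendsto (b := 0) ht (eventually_mem_nhdsWithin.mono fun t h => sub_nonneg.2 (key2 t h))
      linarith
    linarith
  obtain ⟨v, hv, hvJ⟩ := h1
  have hL := test_LC hv
  set m := ∫ x, v x ^ 2 with hm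
  have hm0 : 0 < m := by
    have h0 : 0 ≤ m := integral_nonneg fun x => by positivity
    rcases h0.eq_or_lt with h | h
    · rw [Jf_eq hL, ← hm, ← h, mul_zero, sub_zero] at hvJ
      exact absurd hvJ (not_lt.2 (integral_nonneg fun x => by positivity))
    · exact h
  have habs : LC (fun x => |v x|) := by
    refine hL.of_lip_le ?_ fun x hx => by simp [hx]
    obtain ⟨⟨K, hK⟩, _⟩ := hL
    exact ⟨1 * K, lipschitzWith_one_norm.comp hK⟩
  have hJ : Jf (lam1 Ω) (fun x => |v x|) ≤ Jf (lam1 Ω) v := by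
    refine integral_mono_ae (habs.jbc _).integrable (hL.jbc _).integrable ?_
    filter_upwards [habs.diff, hL.max0.diff, hL.neg.max0.diff] with x h0 h1 h2
    have e : (fun x => |v x|) = fun x => max (v x) 0 + max (- v x) 0 := by
      ext y; rcases le_total (v y) 0 with h | h <;> simp [h, abs_of_nonneg, abs_of_nonpos]
    have hg : gradient (fun x => |v x|) x = (if 0 < v x then gradient v x else 0) +
        (if 0 < - v x then - gradient v x else 0) := by
      rw [e, grad_add h1 h2, grad_pos hL.cont, grad_pos (f := fun y => - v y) hL.neg.cont, grad_neg]
    rw [hg, sq_abs]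
    have : ‖(if 0 < v x then gradient v x else 0) + (if 0 < - v x then - gradient v x else 0)‖ ≤ ‖gradient v x‖ := by
      split_ifs with h1 h2
      · linarith
      · simp
      · simp
      · simp
    gcongr
  have hs : (1 / √m) ^ 2 = 1 / m := by rw [div_pow, Real.sq_sqrt hm0.le, one_pow]
  refine ⟨fun x => 1 / √m * |v x|, habs.cmul _, fun x => by positivity, ?_, ?_, ?_⟩
  · refine Subset.trans (closure_mono ?_) hv.2.2
    intro x hx hc
    exact hx (by simp [hc])
  · simp_rw [mul_pow, hs, sq_abs]
    rw [integral_const_mul, ← hm]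
    field_simp
  · rw [Jf_cmul habs, hs]
    have h2 : Jf (lam1 Ω + ε) v = Jf (lam1 Ω) v - ε * m := by
      rw [Jf_eq hL, Jf_eq hL]; ring
    rw [one_div_mul_eq_div, div_le_iff₀ hm0]
    linarith
end

section
theorem int_cs {α : Type*} [MeasurableSpace α] {μ : Measure α} {f g : α → ℝ}
    (hf : Integrable (fun x => f x ^ 2) μ) (hg : Integrable (fun x => g x ^ 2) μ)
    (hfg : Integrable (fun x => f x * g x) μ) :
    (∫ x, f x * g x ∂μ) ^ 2 ≤ (∫ x, f x ^ 2 ∂μ) * ∫ x, g x ^ 2 ∂μ := by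
  have h : ∀ t : ℝ, 0 ≤ (∫ x, f x ^ 2 ∂μ) * (t * t) + (2 * ∫ x, f x * g x ∂μ) * t
      + ∫ x, g x ^ 2 ∂μ := by
    intro t
    have h1 : 0 ≤ ∫ x, (t * f x + g x) ^ 2 ∂μ := integral_nonneg fun x => sq_nonneg _
    have h2 : ∫ x, (t * f x + g x) ^ 2 ∂μ = ∫ x, ((t * t) * f x ^ 2 + (2 * t) * (f x * g x) + g x ^ 2) ∂μ := by
      congr 1; ext x; ring
    rw [h2, integral_add ((hf.const_mul (t * t)).fun_add (hfg.const_mul (2 * t))) hg,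
      integral_add (hf.const_mul _) (hfg.const_mul _), integral_const_mul, integral_const_mul] at h1
    linarith
  have := discrim_le_zero h
  rw [discrim] at this
  nlinarith

theorem int_trans (F : Euc d → ℝ) (z : Euc d) : ∫ x, F (x + z) = ∫ x, F x :=
  integral_add_right_eq_self F z

theorem transl {f : Euc d → ℝ} (hf : LC f) (z : Euc d) :
    ∫ y, (f (y + z) - f y) ^ 2 ≤ ‖z‖ ^ 2 * ∫ y, ‖gradient f y‖ ^ 2 := by
  set g : Euc d → ℝ := fun y => f (y + z) - f y with hgd
  have hg : LC g := (hf.trans z).sub hf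
  obtain ⟨s, -, hs⟩ := exists_hasDerivAt_eq_slope (fun s : ℝ => ∫ w, g w * f (w + s • z))
    (fun s => ∫ w, g w * ⟪gradient f (w + s • z), z⟫) (zero_lt_one' ℝ)
    (fun s _ => (lemD hg.bc.integrable hf z s).continuousAt.continuousWithinAt)
    (fun s _ => lemD hg.bc.integrable hf z s)
  have h1 : ∫ y, g y ^ 2 = ∫ w, g w * ⟪gradient f (w + s • z), z⟫ := by
    rw [hs]
    simp only [one_smul, zero_smul, add_zero, sub_zero, div_one]
    rw [← integral_sub (hg.bc.mul (hf.trans z).bc).integrable (hg.bc.mul hf.bc).integrable]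
    congr 1; ext y; rw [hgd]; ring
  have hb : BC (fun w => ⟪gradient f (w + s • z), z⟫) := (hf.gbc.trans (s • z)).innerc z
  have h2 := int_cs hg.bc.pow2.integrable hb.pow2.integrable (hg.bc.mul hb).integrable
  rw [← h1] at h2
  have h3 : ∫ w, ⟪gradient f (w + s • z), z⟫ ^ 2 ≤ ‖z‖ ^ 2 * ∫ y, ‖gradient f y‖ ^ 2 := by
    rw [← int_trans (fun y => ‖gradient f y‖ ^ 2) (s • z), ← integral_const_mul]
    refine integral_mono hb.pow2.integrable ((hf.g2.trans (s • z)).const_mul _).integrable fun w => ?_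
    have := abs_real_inner_le_norm (gradient f (w + s • z)) z
    beta_reduce
    rw [← sq_abs, ← mul_pow, mul_comm ‖z‖]
    gcongr
  have h0 : 0 ≤ ∫ y, g y ^ 2 := integral_nonneg fun _ => sq_nonneg _
  rcases h0.eq_or_lt with h | h
  · rw [← h]; exact mul_nonneg (sq_nonneg _) (integral_nonneg fun _ => sq_nonneg _)
  · refine le_trans ?_ h3
    rw [sq] at h2
    exact le_of_mul_le_mul_left h2 h

/-- ball integral -/
def Mb (s : ℝ) (f : Euc d → ℝ) (y : Euc d) : ℝ := ∫ z in ball (0 : Euc d) s, f (y + z)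

theorem Mb_eq (s : ℝ) (f : Euc d → ℝ) (y : Euc d) : Mb s f y = ∫ z in ball y s, f z := by
  rw [Mb, ← integral_indicator measurableSet_ball, ← integral_indicator measurableSet_ball,
    ← integral_add_right_eq_self ((ball y s).indicator f) y]
  congr 1; ext z
  by_cases h : z ∈ ball (0 : Euc d) s
  · rw [indicator_of_mem h, indicator_of_mem (by simpa using h), add_comm]
  · rw [indicator_of_notMem h, indicator_of_notMem (by simpa using h)]

theorem prod_cs {f : Euc d → ℝ} (hf : LC f) :
    HasCompactSupport (fun p : Euc d × Euc d => f p.1 * f (p.1 + p.2)) := by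
  obtain ⟨R, hR⟩ := hf.bc.cs
  refine HasCompactSupport.of_support_subset_isCompact
    ((isCompact_closedBall (0 : Euc d) R).prod (isCompact_closedBall (0 : Euc d) (R + R))) ?_
  rintro ⟨y, z⟩ h
  simp only [Function.mem_support, ne_eq, mul_eq_zero, not_or] at h
  have h1 : ‖y‖ ≤ R := by by_contra hc; exact h.1 (hR _ (not_le.mp hc))
  have h2 : ‖y + z‖ ≤ R := by by_contra hc; exact h.2 (hR _ (not_le.mp hc))
  refine ⟨by simpa using h1, ?_⟩
  have := norm_sub_le (y + z) y
  simp only [add_sub_cancel_left] at this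
  simp; linarith

theorem prod_swap {f : Euc d → ℝ} (hf : LC f) (s : ℝ) :
    ∫ z in ball (0 : Euc d) s, ∫ y, f y * f (y + z) = ∫ y, f y * Mb s f y := by
  have := MeasureTheory.integral_integral_swap_of_hasCompactSupport
    (f := fun y z : Euc d => f y * f (y + z)) (μ := volume) (ν := volume.restrict (ball (0 : Euc d) s))
    (by have := hf.cont; fun_prop) (prod_cs hf)
  rw [← this]
  simp only [Mb, integral_const_mul]

theorem avg_int {f : Euc d → ℝ} (hf : LC f) (s : ℝ) :
    IntegrableOn (fun z => ∫ y, f y * f (y + z)) (ball (0 : Euc d) s) := by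
  have hc : Continuous (fun z => ∫ y, f y * f (y + z)) := by
    have := hf.cont
    obtain ⟨C, hC⟩ := hf.bc.bd
    refine continuous_of_dominated (bound := fun y => C * ‖f y‖)
      (fun z => Continuous.aestronglyMeasurable (by fun_prop)) (fun z => .of_forall fun y => ?_)
      (hf.bc.norm.integrable.const_mul _) (.of_forall fun y => by fun_prop)
    rw [norm_mul, mul_comm]
    gcongr; exact hC _
  exact (hc.continuousOn.integrableOn_compact (isCompact_closedBall 0 s)).mono_set ball_subset_closedBall

theorem avg_le {f : Euc d → ℝ} (hf : LC f) (s : ℝ) :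
    2 * mvol (ball (0 : Euc d) s) * ∫ y, f y ^ 2 ≤
      s ^ 2 * mvol (ball (0 : Euc d) s) * (∫ y, ‖gradient f y‖ ^ 2) + 2 * ∫ y, f y * Mb s f y := by
  have h1 : ∀ z ∈ ball (0 : Euc d) s, 2 * ∫ y, f y ^ 2 ≤
      s ^ 2 * (∫ y, ‖gradient f y‖ ^ 2) + 2 * ∫ y, f y * f (y + z) := by
    intro z hz
    have h2 := transl hf z
    have h3 : ∫ y, (f (y + z) - f y) ^ 2 = 2 * (∫ y, f y ^ 2) - 2 * ∫ y, f y * f (y + z) := by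
      have : ∫ y, (f (y + z) - f y) ^ 2 = ∫ y, ((f (y + z) ^ 2 + f y ^ 2) - 2 * (f y * f (y + z))) := by
        congr 1; ext y; ring
      have hb := hf.bc
      rw [this, integral_sub ((hb.trans z).pow2.add hb.pow2).integrable
        ((hb.mul (hb.trans z)).const_mul 2).integrable,
        integral_add (hb.trans z).pow2.integrable hb.pow2.integrable, integral_const_mul,
        int_trans (fun y => f y ^ 2) z]
      ring
    have h4 : ‖z‖ ^ 2 ≤ s ^ 2 := by
      have : ‖z‖ < s := by simpa using hz
      gcongr
    have h5 : 0 ≤ ∫ y, ‖gradient f y‖ ^ 2 := integral_nonneg fun _ => sq_nonneg _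
    nlinarith
  have h2 := setIntegral_mono_on (μ := volume) (s := ball (0 : Euc d) s) (integrableOn_const measure_ball_lt_top.ne)
    (g := fun z => s ^ 2 * (∫ y, ‖gradient f y‖ ^ 2) + 2 * ∫ y, f y * f (y + z))
    ((integrableOn_const measure_ball_lt_top.ne).add ((avg_int hf s).const_mul 2)) measurableSet_ball h1
  have hI : IntegrableOn (fun _ : Euc d => s ^ 2 * ∫ y, ‖gradient f y‖ ^ 2) (ball (0 : Euc d) s) :=
    integrableOn_const measure_ball_lt_top.ne
  rw [integral_add hI ((avg_int hf s).const_mul 2),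
    integral_const_mul (2 : ℝ) (fun z => ∫ y, f y * f (y + z)), prod_swap hf, setIntegral_const,
    setIntegral_const] at h2
  simp only [smul_eq_mul] at h2
  change mvol (ball (0 : Euc d) s) * _ ≤ mvol (ball (0 : Euc d) s) * _ + _ at h2
  linarith

theorem L1_le {f : Euc d → ℝ} (hf : BC f) (hm : MeasurableSet {x | f x ≠ 0}) :
    (∫ x, |f x|) ^ 2 ≤ mvol {x | f x ≠ 0} * ∫ x, f x ^ 2 := by
  have hfin : volume {x | f x ≠ 0} ≠ ⊤ := by
    obtain ⟨R, hR⟩ := hf.cs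
    refine measure_ne_top_of_subset (s := closedBall (0 : Euc d) R) (fun x hx => ?_) measure_closedBall_lt_top.ne
    by_contra hc
    exact hx (hR x (by simpa using hc))
  have hi : Integrable ({x | f x ≠ 0}.indicator (fun _ => (1:ℝ))) :=
    (integrable_indicator_iff hm).mpr (integrableOn_const hfin)
  have e1 : (fun x => ({x | f x ≠ 0}.indicator (fun _ => (1:ℝ)) x) ^ 2) =
      {x | f x ≠ 0}.indicator (fun _ => (1:ℝ)) := by
    ext x; by_cases h : x ∈ {x | f x ≠ 0} <;> simp [h]
  have e2 : (fun x => {x | f x ≠ 0}.indicator (fun _ => (1:ℝ)) x * |f x|) = fun x => |f x| := by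
    ext x; by_cases h : f x = 0 <;> simp [h]
  have := int_cs (f := {x | f x ≠ 0}.indicator (fun _ => (1:ℝ))) (g := fun x => |f x|)
    (μ := volume) (by rw [e1]; exact hi) (by simpa using hf.pow2.integrable) (by rw [e2]; exact hf.abs.integrable)
  rw [e1, e2, integral_indicator hm, setIntegral_const] at this
  simpa [mvol, Measure.real] using this

theorem LC.meas_ne {f : Euc d → ℝ} (hf : LC f) : MeasurableSet {x | f x ≠ 0} :=
  (isOpen_ne_fun hf.cont continuous_const).measurableSet

theorem LC.fin_ne {f : Euc d → ℝ} (hf : LC f) : volume {x | f x ≠ 0} ≠ ⊤ :=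
  measure_ne_top_of_subset (subset_tsupport f) hf.2.measure_lt_top.ne

theorem Mb_abs_le {f : Euc d → ℝ} (hf : LC f) (s : ℝ) (y : Euc d) : |Mb s f y| ≤ ∫ x, |f x| := by
  rw [Mb_eq]
  refine (abs_integral_le_integral_abs).trans ?_
  exact setIntegral_le_integral hf.bc.abs.integrable (.of_forall fun x => abs_nonneg _)

theorem Mb_meas {f : Euc d → ℝ} (hf : LC f) (s : ℝ) : Continuous (Mb s f) := by
  have := hf.cont
  obtain ⟨C, hC⟩ := hf.bc.bd
  refine continuous_of_dominated (bound := fun y => C)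
      (fun z => Continuous.aestronglyMeasurable (by fun_prop)) (fun z => .of_forall fun y => hC _)
      (integrableOn_const measure_ball_lt_top.ne) (.of_forall fun y => by fun_prop)

theorem FK {f : Euc d → ℝ} (hf : LC f) {s : ℝ} (hs : 0 < s)
    (hv : 2 * mvol {x | f x ≠ 0} ≤ mvol (ball (0 : Euc d) s)) :
    ∫ y, f y ^ 2 ≤ s ^ 2 * ∫ y, ‖gradient f y‖ ^ 2 := by
  have h1 := avg_le hf s
  have h2 : ∫ y, f y * Mb s f y ≤ (∫ y, |f y|) ^ 2 := by
    rw [sq, ← integral_mul_const]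
    refine integral_mono (hf.bc.mulB (Mb_meas hf s).aestronglyMeasurable
      ⟨_, Mb_abs_le hf s⟩).integrable (hf.bc.abs.integrable.mul_const _) fun y => ?_
    refine (le_abs_self _).trans ?_
    rw [abs_mul]
    gcongr
    exact Mb_abs_le hf s y
  have h3 := L1_le hf.bc hf.meas_ne
  have h4 : 0 ≤ ∫ y, f y ^ 2 := integral_nonneg fun _ => sq_nonneg _
  have h5 : 0 < mvol (ball (0 : Euc d) s) :=
    ENNReal.toReal_pos (measure_ball_pos _ _ hs).ne' measure_ball_lt_top.ne
  have h6 : 2 * (mvol {x | f x ≠ 0} * ∫ y, f y ^ 2) ≤ mvol (ball (0 : Euc d) s) * ∫ y, f y ^ 2 := by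
    rw [← mul_assoc]; gcongr
  refine le_of_mul_le_mul_left ?_ h5
  linarith
end

section
section l2
variable {E : Type*} [NormedAddCommGroup E] [InnerProductSpace ℝ E]
  {α : Type*} [MeasurableSpace α] {μ : Measure α}

theorem norm_toLp_sq {f : α → E} (hf : MemLp f 2 μ) : ‖hf.toLp f‖ ^ 2 = ∫ x, ‖f x‖ ^ 2 ∂μ := by
  rw [← real_inner_self_eq_norm_sq, L2.inner_def]
  refine integral_congr_ae ?_
  filter_upwards [hf.coeFn_toLp] with x hx
  rw [hx, real_inner_self_eq_norm_sq]

theorem L2_complete [CompleteSpace E] {f : ℕ → α → E} (hf : ∀ n, MemLp (f n) 2 μ)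
    (hc : ∀ ε > 0, ∃ N, ∀ n ≥ N, ∀ m ≥ N, ∫ x, ‖f n x - f m x‖ ^ 2 ∂μ ≤ ε) :
    ∃ u, MemLp u 2 μ ∧ Tendsto (fun n => ∫ x, ‖f n x - u x‖ ^ 2 ∂μ) atTop (𝓝 0) := by
  have hC : CauchySeq (fun n => (hf n).toLp (f n)) := by
    rw [Metric.cauchySeq_iff]
    intro ε hε
    obtain ⟨N, hN⟩ := hc ((ε / 2) ^ 2) (by positivity)
    refine ⟨N, fun m hm n hn => ?_⟩
    have := hN m hm n hn
    rw [dist_eq_norm, ← MemLp.toLp_sub]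
    have h2 := norm_toLp_sq ((hf m).sub (hf n))
    simp only [Pi.sub_apply] at h2
    rw [← h2] at this
    have := abs_le_of_sq_le_sq' this (by positivity)
    linarith [this.2]
  obtain ⟨U, hU⟩ := cauchySeq_tendsto_of_complete hC
  refine ⟨U, Lp.memLp U, ?_⟩
  have h1 : Tendsto (fun n => ‖(hf n).toLp (f n) - U‖ ^ 2) atTop (𝓝 0) := by
    have := (tendsto_iff_norm_sub_tendsto_zero.mp hU).pow 2
    simpa using this
  refine h1.congr fun n => ?_
  have h2 := norm_toLp_sq ((hf n).sub (Lp.memLp U))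
  rw [MemLp.toLp_sub (hf n) (Lp.memLp U), Lp.toLp_coeFn U (Lp.memLp U)] at h2
  simpa using h2
end l2

theorem sub_g2_le {f g : Euc d → ℝ} (hf : LC f) (hg : LC g) :
    ∫ x, ‖gradient (fun y => f y - g y) x‖ ^ 2 ≤
      2 * (∫ x, ‖gradient f x‖ ^ 2) + 2 * ∫ x, ‖gradient g x‖ ^ 2 := by
  rw [← integral_const_mul, ← integral_const_mul,
    ← integral_add (hf.g2.integrable.const_mul 2) (hg.g2.integrable.const_mul 2)]
  refine integral_mono_ae (hf.sub hg).g2.integrable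
    ((hf.g2.const_mul 2).add (hg.g2.const_mul 2)).integrable ?_
  filter_upwards [hf.diff, hg.diff] with x h1 h2
  beta_reduce
  rw [grad_sub h1 h2]
  have := norm_sub_le (gradient f x) (gradient g x)
  have h3 := norm_nonneg (gradient f x - gradient g x)
  nlinarith [sq_nonneg (‖gradient f x‖ - ‖gradient g x‖)]

set_option maxHeartbeats 1000000 in
/-- Rellich compactness. -/
theorem rellich {φ : ℕ → Euc d → ℝ} (hφ : ∀ n, LC (φ n)) {R C : ℝ}
    (hR : ∀ n x, R < ‖x‖ → φ n x = 0) (h1 : ∀ n, ∫ x, φ n x ^ 2 = 1)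
    (hC : ∀ n, ∫ x, ‖gradient (φ n) x‖ ^ 2 ≤ C) :
    ∃ τ : ℕ → ℕ, StrictMono τ ∧ ∀ ε > 0, ∃ N, ∀ n ≥ N, ∀ m ≥ N,
      ∫ x, (φ (τ n) x - φ (τ m) x) ^ 2 ≤ ε := by
  have hm : ∀ n, MemLp (φ n) 2 := fun n => (hφ n).bc.memLp 2
  set Φ : ℕ → WeakDual ℝ (Lp ℝ 2 (volume : Measure (Euc d))) := fun n =>
    StrongDual.toWeakDual (InnerProductSpace.toDual ℝ _ ((hm n).toLp (φ n))) with hΦ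
  have hb : ∀ n, Φ n ∈ (WeakDual.toStrongDual ⁻¹' closedBall
      (0 : StrongDual ℝ (Lp ℝ 2 (volume : Measure (Euc d)))) 1) := by
    intro n
    simp only [mem_preimage, mem_closedBall, dist_zero_right]
    have : ‖(hm n).toLp (φ n)‖ ^ 2 = 1 := by
      rw [norm_toLp_sq (hm n)]; simpa using h1 n
    have h2 : ‖(hm n).toLp (φ n)‖ ≤ 1 := by nlinarith [norm_nonneg ((hm n).toLp (φ n))]
    refine le_trans (le_of_eq ?_) h2
    exact LinearIsometryEquiv.norm_map (InnerProductSpace.toDual ℝ _) _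
  have : Fact ((2 : ℝ≥0∞) ≠ ⊤) := ⟨by simp⟩
  obtain ⟨L, -, τ, hτ, hL⟩ := WeakDual.isSeqCompact_closedBall ℝ _ (0 : StrongDual ℝ (Lp ℝ 2 (volume : Measure (Euc d)))) 1 hb
  refine ⟨τ, hτ, ?_⟩
  have hpt : ∀ s y, ∃ l, Tendsto (fun n => Mb s (φ (τ n)) y) atTop (𝓝 l) := by
    intro s y
    have hfin : volume (ball y s) ≠ ⊤ := measure_ball_lt_top.ne
    set I := indicatorConstLp (2 : ℝ≥0∞) (measurableSet_ball (x := y) (ε := s)) hfin (1:ℝ) with hI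
    refine ⟨L I, ?_⟩
    have h2 : Tendsto (fun n => (Φ (τ n)) I) atTop (𝓝 (L I)) :=
      ((WeakDual.eval_continuous I).tendsto L).comp hL
    refine h2.congr fun n => ?_
    change ⟪(hm (τ n)).toLp (φ (τ n)), I⟫ = _
    rw [real_inner_comm, hI, L2.inner_indicatorConstLp_one, Mb_eq]
    exact setIntegral_congr_ae measurableSet_ball ((hm (τ n)).coeFn_toLp.mono fun x hx _ => hx)
  choose l hl using hpt
  set V := mvol (closedBall (0 : Euc d) R)
  have hMb : ∀ s n y, |Mb s (φ n) y| ≤ V + 1 := by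
    intro s n y
    refine (Mb_abs_le (hφ n) s y).trans ?_
    have h2 := L1_le (hφ n).bc (hφ n).meas_ne
    rw [h1, mul_one] at h2
    have h3 : mvol {x | φ n x ≠ 0} ≤ V := by
      refine mvol_mono (fun x hx => ?_) measure_closedBall_lt_top.ne
      by_contra hc
      exact hx (hR n x (by simpa using hc))
    have h4 : 0 ≤ ∫ x, |φ n x| := integral_nonneg fun _ => abs_nonneg _
    nlinarith
  have hlm : ∀ s, AEStronglyMeasurable (l s) (volume.restrict (closedBall (0 : Euc d) R)) := fun s =>
    aestronglyMeasurable_of_tendsto_ae atTop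
      (fun n => (Mb_meas (hφ (τ n)) s).aestronglyMeasurable) (.of_forall fun y => hl s y)
  have hlb : ∀ s y, |l s y| ≤ V + 1 := fun s y =>
    le_of_tendsto (hl s y).abs (.of_forall fun n => hMb s (τ n) y)
  have hMbl : ∀ s n y, |Mb s (φ n) y - l s y| ≤ 2 * (V + 1) := fun s n y => by
    have := abs_sub (Mb s (φ n) y) (l s y)
    linarith [hMb s n y, hlb s y]
  have hmm : ∀ s n, AEStronglyMeasurable (fun y => (Mb s (φ n) y - l s y) ^ 2)
      (volume.restrict (closedBall (0 : Euc d) R)) := fun s n =>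
    ((Mb_meas (hφ n) s).aestronglyMeasurable.sub (hlm s)).pow 2
  have hbb : ∀ s n y, ‖(Mb s (φ n) y - l s y) ^ 2‖ ≤ (2 * (V + 1)) ^ 2 := fun s n y => by
    rw [norm_pow, Real.norm_eq_abs]
    exact pow_le_pow_left₀ (abs_nonneg _) (hMbl s n y) 2
  have hint : ∀ s n, IntegrableOn (fun y => (Mb s (φ n) y - l s y) ^ 2) (closedBall (0 : Euc d) R) := fun s n =>
    Integrable.mono' (integrableOn_const measure_closedBall_lt_top.ne) (hmm s n)
      (.of_forall fun y => hbb s n y)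
  have hdct : ∀ s, Tendsto (fun n => ∫ y in closedBall (0 : Euc d) R, (Mb s (φ (τ n)) y - l s y) ^ 2)
      atTop (𝓝 0) := by
    intro s
    have := tendsto_integral_of_dominated_convergence (μ := volume.restrict (closedBall (0 : Euc d) R))
      (F := fun n y => (Mb s (φ (τ n)) y - l s y) ^ 2) (f := fun _ => 0)
      (fun _ => (2 * (V + 1)) ^ 2) (fun n => hmm s _) (integrableOn_const measure_closedBall_lt_top.ne)
      (fun n => .of_forall fun y => hbb s _ y)
      (.of_forall fun y => by
        have := ((hl s y).sub_const (l s y)).pow 2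
        simpa using this)
    simpa using this
  have hC0 : 0 ≤ C := (integral_nonneg fun _ => sq_nonneg _).trans (hC 0)
  intro ε hε
  obtain ⟨s, hs, hsε⟩ : ∃ s : ℝ, 0 < s ∧ 4 * C * s ^ 2 ≤ ε / 2 := by
    refine ⟨√(ε / (2 * (4 * C + 1))), by positivity, ?_⟩
    rw [Real.sq_sqrt (by positivity), mul_div_assoc', div_le_iff₀ (by positivity)]
    nlinarith
  set b := mvol (ball (0 : Euc d) s)
  have hbp : 0 < b :=
    ENNReal.toReal_pos (measure_ball_pos _ _ hs).ne' measure_ball_lt_top.ne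
  obtain ⟨N, hN⟩ := ((hdct s).eventually_le_const (u := b ^ 2 * ε / 8) (by positivity)).exists_forall_of_atTop
  refine ⟨N, fun n hn m hm' => ?_⟩
  set g : Euc d → ℝ := fun y => φ (τ n) y - φ (τ m) y with hg
  have hgl : LC g := (hφ _).sub (hφ _)
  have hav := avg_le hgl s
  have hgr := sub_g2_le (hφ (τ n)) (hφ (τ m))
  have hMg : ∀ y, Mb s g y = Mb s (φ (τ n)) y - Mb s (φ (τ m)) y := fun y => by
    simp only [Mb_eq]
    exact integral_sub (hφ _).bc.integrable.integrableOn (hφ _).bc.integrable.integrableOn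
  have key : 2 * ∫ y, g y * Mb s g y ≤ b * (∫ y, g y ^ 2) + b⁻¹ *
      ∫ y in closedBall (0 : Euc d) R, (2 * (Mb s (φ (τ n)) y - l s y) ^ 2 + 2 * (Mb s (φ (τ m)) y - l s y) ^ 2) := by
    rw [← integral_const_mul, ← integral_const_mul, ← integral_const_mul, ← integral_indicator measurableSet_closedBall,
      ← integral_add (hgl.bc.pow2.const_mul b).integrable]
    · refine integral_mono (((hgl.bc.mulB (Mb_meas hgl s).aestronglyMeasurable
        ⟨_, Mb_abs_le hgl s⟩)).const_mul 2).integrable ?_ fun y => ?_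
      · refine (hgl.bc.pow2.const_mul b).integrable.fun_add ?_
        exact (integrable_indicator_iff measurableSet_closedBall).mpr
          ((((hint s _).const_mul 2).fun_add ((hint s _).const_mul 2)).const_mul _)
      · beta_reduce
        by_cases hy : y ∈ closedBall (0 : Euc d) R
        · rw [indicator_of_mem hy, hMg]
          set A := Mb s (φ (τ n)) y
          set B := Mb s (φ (τ m)) y
          have e : b * g y ^ 2 + b⁻¹ * (2 * (A - l s y) ^ 2 + 2 * (B - l s y) ^ 2) - 2 * (g y * (A - B))
            = b⁻¹ * ((b * g y - (A - B)) ^ 2 + (A + B - 2 * l s y) ^ 2) := by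
            field_simp; ring
          have : 0 ≤ b⁻¹ * ((b * g y - (A - B)) ^ 2 + (A + B - 2 * l s y) ^ 2) := by positivity
          linarith
        · rw [indicator_of_notMem hy]
          have : g y = 0 := by
            rw [hg]; beta_reduce
            rw [hR _ y (by simpa using hy), hR _ y (by simpa using hy), sub_zero]
          rw [this]; simp
    · exact (integrable_indicator_iff measurableSet_closedBall).mpr
          ((((hint s _).const_mul 2).fun_add ((hint s _).const_mul 2)).const_mul _)
  rw [integral_add ((hint s _).const_mul 2) ((hint s _).const_mul 2), integral_const_mul, integral_const_mul] at key
  have hn' := hN n hn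
  have hm'' := hN m hm'
  have k2 : b⁻¹ * (2 * (∫ y in closedBall (0 : Euc d) R, (Mb s (φ (τ n)) y - l s y) ^ 2)
      + 2 * ∫ y in closedBall (0 : Euc d) R, (Mb s (φ (τ m)) y - l s y) ^ 2) ≤ b * (ε / 2) := by
    have : b * (ε / 2) = b⁻¹ * (2 * (b ^ 2 * ε / 8) + 2 * (b ^ 2 * ε / 8)) := by field_simp; ring
    rw [this]
    gcongr
  have k3 : s ^ 2 * b * (∫ y, ‖gradient g y‖ ^ 2) ≤ b * (ε / 2) := by
    have : (∫ y, ‖gradient g y‖ ^ 2) ≤ 4 * C := by linarith [hC (τ n), hC (τ m)]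
    calc s ^ 2 * b * (∫ y, ‖gradient g y‖ ^ 2) ≤ s ^ 2 * b * (4 * C) := by gcongr
      _ = b * (4 * C * s ^ 2) := by ring
      _ ≤ _ := by gcongr
  refine le_of_mul_le_mul_left ?_ hbp
  linarith
end

section
structure Sol (D Ω : Set (Euc d)) (a lam : ℝ) (φ : ℕ → Euc d → ℝ) (u : Euc d → ℝ)
    (G : Euc d → Euc d) : Prop where
  hd : 0 < d
  hD : IsOpen D
  hDb : Bornology.IsBounded D
  hDc : IsConnected D
  ha : 0 < a
  haD : a < mvol D
  hO : IsOpen Ω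
  hOD : Ω ⊆ D
  vol : mvol Ω = a
  lam0 : 0 ≤ lam
  minJ : MinJ D a lam
  lc : ∀ n, LC (φ n)
  nn : ∀ n x, 0 ≤ φ n x
  sup : ∀ n, tsupport (φ n) ⊆ Ω
  one : ∀ n, ∫ x, φ n x ^ 2 = 1
  J0 : Tendsto (fun n => Jf lam (φ n)) atTop (𝓝 0)
  unn : ∀ x, 0 ≤ u x
  uoff : ∀ x, x ∉ Ω → u x = 0
  umem : MemLp u 2
  conv : Tendsto (fun n => ∫ x, (φ n x - u x) ^ 2) atTop (𝓝 0)
  Gmem : MemLp G 2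
  Gconv : Tendsto (fun n => ∫ x, ‖gradient (φ n) x - G x‖ ^ 2) atTop (𝓝 0)

theorem fin_of_bdd {S : Set (Euc d)} (h : Bornology.IsBounded S) : volume S ≠ ⊤ :=
  h.measure_lt_top.ne

theorem minJ_on {D Ω : Set (Euc d)} {a lam : ℝ} (hDb : Bornology.IsBounded D)
    (hOD : Ω ⊆ D) (vol : mvol Ω = a) (h : MinJ D a lam) {w : Euc d → ℝ} (hw : LC w)
    (h0 : ∀ x, x ∉ Ω → w x = 0) : 0 ≤ Jf lam w := by
  refine h w hw (fun x hx => h0 x fun hc => hx (hOD hc)) ?_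
  rw [← vol]
  refine mvol_mono (fun x hx => ?_) (fin_of_bdd (hDb.subset hOD))
  by_contra hc; exact hx (h0 x hc)

theorem exists_sol (hd : 0 < d) {D Ω : Set (Euc d)} {a : ℝ} (hD : IsOpen D)
    (hDb : Bornology.IsBounded D) (hDc : IsConnected D) (ha : 0 < a)
    (haD : a < mvol D) (hopt : IsOptimalShape D a Ω) : ∃ φ u G, Sol D Ω a (lam1 Ω) φ u G := by
  have hJ := minJ hd hD hDb haD hopt
  set lam := lam1 Ω
  have hl0 : 0 ≤ lam := lam1_nonneg Ω
  have hne : Ω.Nonempty := by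
    by_contra hc
    rw [not_nonempty_iff_eq_empty] at hc
    have := hopt.meas
    rw [hc] at this
    simp [mvol] at this
    linarith
  have hex : ∀ n : ℕ, ∃ φ, LC φ ∧ (∀ x, 0 ≤ φ x) ∧ tsupport φ ⊆ Ω ∧ ∫ x, φ x ^ 2 = 1 ∧
      Jf lam φ ≤ 1 / ((n : ℝ) + 1) := fun n => exists_min hopt.isOpen hne (by positivity)
  choose ψ h1 h2 h3 h4 h5 using hex
  have hoff : ∀ n x, x ∉ Ω → ψ n x = 0 := fun n x hx =>
    image_eq_zero_of_notMem_tsupport fun hc => hx (h3 n hc)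
  have hJn : ∀ w, LC w → (∀ x, x ∉ Ω → w x = 0) → 0 ≤ Jf lam w := fun w hw h0 =>
    minJ_on hDb hopt.subset hopt.meas hJ hw h0
  obtain ⟨R, hR⟩ := hDb.subset_closedBall 0
  obtain ⟨τ, hτ, hC⟩ := rellich (C := lam + 1) h1 (R := R)
    (fun n x hx => hoff n x fun hc => by
      have := hR (hopt.subset hc)
      simp at this; linarith) h4 (fun n => by
      have := Jf_eq (h1 n) lam
      have h6 := h5 n
      have : 1 / ((n : ℝ) + 1) ≤ 1 := by
        rw [div_le_one (by positivity)]; linarith [Nat.cast_nonneg (α := ℝ) n]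
      rw [h4 n] at *
      linarith)
  set φ : ℕ → Euc d → ℝ := fun n => ψ (τ n) with hφ
  have hJ0 : Tendsto (fun n => Jf lam (φ n)) atTop (𝓝 0) := by
    have h6 := (tendsto_one_div_add_atTop_nhds_zero_nat (𝕜 := ℝ)).comp hτ.tendsto_atTop
    exact squeeze_zero (fun n => hJn _ (h1 _) (hoff _)) (fun n => h5 (τ n)) h6
  obtain ⟨v, hv, hvt⟩ := L2_complete (f := φ) (μ := volume) (fun n => (h1 (τ n)).bc.memLp 2)
    (by simpa using hC)
  have hg : ∀ n m, ∫ x, ‖gradient (φ n) x - gradient (φ m) x‖ ^ 2 ≤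
      2 * Jf lam (φ n) + 2 * Jf lam (φ m) + lam * ∫ x, (φ n x - φ m x) ^ 2 := by
    intro n m
    have e1 := Jf_add (h1 (τ n)) (h1 (τ m)) lam 1
    have e2 := Jf_add (h1 (τ n)) (h1 (τ m)) lam (-1)
    have e3 : 0 ≤ Jf lam (fun x => ψ (τ n) x + 1 * ψ (τ m) x) :=
      hJn _ ((h1 _).add ((h1 _).cmul 1)) (fun x hx => by rw [hoff _ x hx, hoff _ x hx]; simp)
    have e4 := Jf_eq ((h1 (τ n)).sub (h1 (τ m))) lam
    have e5 : (fun x => ψ (τ n) x + (-1) * ψ (τ m) x) = fun x => ψ (τ n) x - ψ (τ m) x := by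
      ext x; ring
    rw [e5] at e2
    have e6 : ∫ x, ‖gradient (fun y => ψ (τ n) y - ψ (τ m) y) x‖ ^ 2 =
        ∫ x, ‖gradient (φ n) x - gradient (φ m) x‖ ^ 2 := by
      refine integral_congr_ae ?_
      filter_upwards [(h1 (τ n)).diff, (h1 (τ m)).diff] with x a1 a2
      beta_reduce
      rw [grad_sub a1 a2]
    rw [← e6]
    simp only [hφ]
    linarith
  obtain ⟨G, hG, hGt⟩ := L2_complete (f := fun n => gradient (φ n)) (μ := volume)
    (fun n => (h1 (τ n)).gbc.memLp 2) (by
      intro ε hε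
      obtain ⟨N1, hN1⟩ := hC (ε / (2 * (lam + 1))) (by positivity)
      obtain ⟨N2, hN2⟩ := (hJ0.eventually_le_const (u := ε / 8) (by positivity)).exists_forall_of_atTop
      refine ⟨max N1 N2, fun n hn m hm => (hg n m).trans ?_⟩
      have a1 := hN1 n (le_of_max_le_left hn) m (le_of_max_le_left hm)
      have a2 := hN2 n (le_of_max_le_right hn)
      have a3 := hN2 m (le_of_max_le_right hm)
      have a4 : lam * ∫ x, (φ n x - φ m x) ^ 2 ≤ ε / 2 := by
        calc lam * ∫ x, (φ n x - φ m x) ^ 2 ≤ lam * (ε / (2 * (lam + 1))) := by gcongr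
          _ ≤ ε / 2 := by
            rw [mul_div_assoc', div_le_div_iff₀ (by positivity) (by positivity)]
            nlinarith
      linarith)
  have hOm := hopt.isOpen.measurableSet
  refine ⟨φ, Ω.indicator fun x => max (v x) 0, G, hd, hD, hDb, hDc, ha, haD, hopt.isOpen, hopt.subset,
    hopt.meas, hl0, hJ, fun n => h1 _, fun n => h2 _, fun n => h3 _, fun n => h4 _, hJ0,
    fun x => indicator_nonneg (fun x _ => le_max_right _ _) x,
    fun x hx => indicator_of_notMem hx _, ?_, ?_, hG, hGt⟩
  · refine MemLp.mono hv ((hv.1.sup aestronglyMeasurable_const).indicator hOm) (.of_forall fun x => ?_)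
    refine (norm_indicator_le_norm_self _ _).trans ?_
    rw [Real.norm_eq_abs, Real.norm_eq_abs, abs_of_nonneg (le_max_right _ _)]
    exact max_le (le_abs_self _) (abs_nonneg _)
  · refine squeeze_zero (fun n => integral_nonneg fun _ => sq_nonneg _) (fun n => ?_) hvt
    refine integral_mono_of_nonneg (.of_forall fun _ => sq_nonneg _) ?_ (.of_forall fun x => ?_)
    · exact (((h1 (τ n)).bc.memLp 2).sub hv).integrable_norm_pow (by norm_num)
    · beta_reduce
      rw [Real.norm_eq_abs, sq_abs]
      by_cases hx : x ∈ Ω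
      · rw [indicator_of_mem hx]
        rcases le_total (v x) 0 with h | h
        · rw [max_eq_right h]
          have := h2 (τ n) x
          simp only [hφ]
          nlinarith
        · rw [max_eq_left h]
      · rw [indicator_of_notMem hx]
        have : φ n x = 0 := hoff _ x hx
        rw [this]; nlinarith [sq_nonneg (v x)]

section sol
variable {D Ω : Set (Euc d)} {a lam : ℝ} {φ : ℕ → Euc d → ℝ} {u : Euc d → ℝ} {G : Euc d → Euc d}

theorem Sol.off (S : Sol D Ω a lam φ u G) (n : ℕ) (x : Euc d) (hx : x ∉ Ω) : φ n x = 0 :=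
  image_eq_zero_of_notMem_tsupport fun hc => hx (S.sup n hc)

theorem Sol.jnn (S : Sol D Ω a lam φ u G) {w : Euc d → ℝ} (hw : LC w)
    (h0 : ∀ x, x ∉ Ω → w x = 0) : 0 ≤ Jf lam w := minJ_on S.hDb S.hOD S.vol S.minJ hw h0

theorem Sol.finD (S : Sol D Ω a lam φ u G) : volume D ≠ ⊤ := fin_of_bdd S.hDb
theorem Sol.finO (S : Sol D Ω a lam φ u G) : volume Ω ≠ ⊤ := fin_of_bdd (S.hDb.subset S.hOD)

theorem Sol.uint (S : Sol D Ω a lam φ u G) : Integrable u := by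
  have h1 : u = Ω.indicator u := by
    ext x
    by_cases hx : x ∈ Ω
    · rw [indicator_of_mem hx]
    · rw [indicator_of_notMem hx, S.uoff x hx]
  have : IsFiniteMeasure (volume.restrict Ω) := ⟨by simpa using S.finO.lt_top⟩
  rw [h1]
  exact (integrable_indicator_iff S.hO.measurableSet).mpr
    ((S.umem.restrict Ω).integrable (by norm_num))

theorem Sol.l1le (S : Sol D Ω a lam φ u G) (n : ℕ) :
    (∫ x, |φ n x - u x|) ^ 2 ≤ a * ∫ x, (φ n x - u x) ^ 2 := by
  have hm : MemLp (fun x => φ n x - u x) 2 := ((S.lc n).bc.memLp 2).sub S.umem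
  have e1 : ∀ x, Ω.indicator (fun _ => (1:ℝ)) x * |φ n x - u x| = |φ n x - u x| := fun x => by
    by_cases hx : x ∈ Ω
    · rw [indicator_of_mem hx, one_mul]
    · rw [S.off n x hx, S.uoff x hx]; simp
  have e2 : ∀ x, (Ω.indicator (fun _ => (1:ℝ)) x) ^ 2 = Ω.indicator (fun _ => (1:ℝ)) x := fun x => by
    by_cases hx : x ∈ Ω <;> simp [hx]
  have hI : Integrable (Ω.indicator (fun _ => (1:ℝ))) :=
    (integrable_indicator_iff S.hO.measurableSet).mpr (integrableOn_const S.finO)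
  have h2 := int_cs (μ := volume) (f := Ω.indicator (fun _ => (1:ℝ))) (g := fun x => |φ n x - u x|)
    (by simp only [e2]; exact hI) (by simpa using hm.integrable_sq)
    (by simp only [e1]; exact ((S.lc n).bc.integrable.sub S.uint).abs)
  simp only [e1, e2, sq_abs] at h2
  rw [integral_indicator S.hO.measurableSet, setIntegral_const] at h2
  have : volume.real Ω = a := S.vol
  rw [this] at h2
  simpa using h2

theorem Sol.l1 (S : Sol D Ω a lam φ u G) : Tendsto (fun n => ∫ x, |φ n x - u x|) atTop (𝓝 0) := by
  have h1 := (S.conv.const_mul a).sqrt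
  simp only [mul_zero, Real.sqrt_zero] at h1
  exact squeeze_zero (fun n => integral_nonneg fun _ => abs_nonneg _)
    (fun n => Real.le_sqrt_of_sq_le (S.l1le n)) h1

theorem Sol.intphi (S : Sol D Ω a lam φ u G) (n : ℕ) : ∫ x, φ n x ≤ a + 1 := by
  have h := L1_le (S.lc n).bc (S.lc n).meas_ne
  rw [S.one n, mul_one] at h
  have h2 : mvol {x | φ n x ≠ 0} ≤ a := by
    rw [← S.vol]
    refine mvol_mono (fun x hx => ?_) S.finO
    by_contra hc; exact hx (S.off n x hc)
  have h3 : ∫ x, |φ n x| = ∫ x, φ n x := by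
    congr 1; ext x; exact abs_of_nonneg (S.nn n x)
  rw [h3] at h
  nlinarith [S.ha]

/-- passage to the limit against bounded functions -/
theorem Sol.lim (S : Sol D Ω a lam φ u G) {g : Euc d → ℝ} (hg : AEStronglyMeasurable g volume)
    (hb : ∃ C, ∀ x, |g x| ≤ C) :
    Tendsto (fun n => ∫ x, φ n x * g x) atTop (𝓝 (∫ x, u x * g x)) := by
  obtain ⟨C, hC⟩ := hb
  rw [tendsto_iff_norm_sub_tendsto_zero]
  have h1 := S.l1.mul_const C
  rw [zero_mul] at h1
  refine squeeze_zero (fun n => norm_nonneg _) (fun n => ?_) h1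
  have i1 : Integrable (fun x => φ n x * g x) := ((S.lc n).bc.mulB hg ⟨C, hC⟩).integrable
  have i2 : Integrable (fun x => u x * g x) := S.uint.mul_bdd hg (.of_forall hC)
  rw [← integral_sub i1 i2, ← integral_mul_const]
  refine norm_integral_le_of_norm_le (((S.lc n).bc.integrable.sub S.uint).abs.mul_const C) (.of_forall fun x => ?_)
  rw [← sub_mul, norm_mul, Real.norm_eq_abs, Real.norm_eq_abs]
  exact mul_le_mul_of_nonneg_left (hC x) (abs_nonneg _)
end sol
end

section
theorem hasDerivAt_mp (k : ℕ) (t : ℝ) :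
    HasDerivAt (fun t : ℝ => (max t 0) ^ (k + 2)) (((k : ℝ) + 2) * (max t 0) ^ (k + 1)) t := by
  rcases lt_trichotomy t 0 with h | h | h
  · have e : (fun t : ℝ => (max t 0) ^ (k + 2)) =ᶠ[𝓝 t] fun _ => 0 := by
      filter_upwards [gt_mem_nhds h] with s hs
      rw [max_eq_right hs.le]; simp
    rw [max_eq_right h.le]
    simpa using (hasDerivAt_const t (0:ℝ)).congr_of_eventuallyEq e
  · subst h
    rw [max_self, zero_pow (by omega), mul_zero, hasDerivAt_iff_isLittleO_nhds_zero]
    simp only [zero_add, max_self, smul_zero, sub_zero]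
    rw [zero_pow (by omega)]
    simp only [sub_zero]
    refine Asymptotics.IsBigO.trans_isLittleO (g := fun h : ℝ => h ^ (k + 2)) ?_
      (Asymptotics.isLittleO_pow_id (by omega))
    refine Asymptotics.IsBigO.of_bound 1 (.of_forall fun h => ?_)
    rw [norm_pow, norm_pow, one_mul]
    refine pow_le_pow_left₀ (norm_nonneg _) ?_ _
    rw [Real.norm_eq_abs, Real.norm_eq_abs, abs_of_nonneg (le_max_right _ _)]
    exact max_le (le_abs_self _) (abs_nonneg _)
  · have e : (fun t : ℝ => (max t 0) ^ (k + 2)) =ᶠ[𝓝 t] fun t => t ^ (k + 2) := by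
      filter_upwards [lt_mem_nhds h] with s hs
      rw [max_eq_left hs.le]
    rw [max_eq_left h.le]
    simpa using (hasDerivAt_pow (k + 2) t).congr_of_eventuallyEq e

def hk (k : ℕ) (r : ℝ) (x y : Euc d) : ℝ := (max (r ^ 2 - ‖y - x‖ ^ 2) 0) ^ k
def Ik (k : ℕ) (f : Euc d → ℝ) (x : Euc d) (r : ℝ) : ℝ := ∫ y, f y * hk k r x y
def Ak (f : Euc d → ℝ) (x : Euc d) (r : ℝ) : ℝ := Ik 2 f x r / r ^ (d + 4)
def mu (lam : ℝ) (f : Euc d → ℝ) (x : Euc d) (r : ℝ) : ℝ :=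
  lam * Ik 3 f x r + 24 * r ^ 2 * Ik 1 f x r - 6 * (4 + d) * Ik 2 f x r

theorem hk_nonneg (k : ℕ) (r : ℝ) (x y : Euc d) : 0 ≤ hk k r x y := pow_nonneg (le_max_right _ _) _

theorem hk_le (k : ℕ) (r : ℝ) (x y : Euc d) : hk k r x y ≤ (r ^ 2) ^ k := by
  refine pow_le_pow_left₀ (le_max_right _ _) (max_le ?_ (sq_nonneg _)) _
  nlinarith [sq_nonneg ‖y - x‖]

theorem hk_zero {k : ℕ} (hk0 : k ≠ 0) {r : ℝ} (hr : 0 ≤ r) {x y : Euc d} (h : r ≤ ‖y - x‖) :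
    hk k r x y = 0 := by
  rw [hk, max_eq_right (by nlinarith), zero_pow hk0]

theorem hk_cont (k : ℕ) (r : ℝ) (x : Euc d) : Continuous (hk k r x) := by
  unfold hk; fun_prop

theorem hk_lc {k : ℕ} (hk0 : k ≠ 0) {r : ℝ} (hr : 0 ≤ r) (x : Euc d) : LC (hk k r x) := by
  have hp : LC (fun y : Euc d => max (r - ‖y - x‖) 0) := by
    refine ⟨⟨1, LipschitzWith.max_const (LipschitzWith.of_dist_le_mul fun y z => ?_) 0⟩,
      HasCompactSupport.of_support_subset_isCompact (isCompact_closedBall x r) fun y hy => ?_⟩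
    · rw [Real.dist_eq, dist_eq_norm, NNReal.coe_one, one_mul]
      have := abs_norm_sub_norm_le (z - x) (y - x)
      have e : z - x - (y - x) = -(y - z) := by abel
      rw [e, norm_neg] at this
      rw [show r - ‖y - x‖ - (r - ‖z - x‖) = ‖z - x‖ - ‖y - x‖ by ring]
      exact this
    · by_contra hc
      rw [mem_closedBall, dist_eq_norm, not_le] at hc
      exact hy (max_eq_right (by linarith))
  have h1 : LC (hk 1 r x) := by
    have := (hp.cmul (2 * r)).sub (hp.mul hp)
    convert this using 2 with y
    rw [hk, pow_one]
    rcases le_total r ‖y - x‖ with h | h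
    · rw [max_eq_right (by nlinarith [norm_nonneg (y - x)]), max_eq_right (by linarith)]; ring
    · rw [max_eq_left (by nlinarith [norm_nonneg (y - x)]), max_eq_left (by linarith)]; ring
  obtain ⟨j, rfl⟩ := Nat.exists_eq_succ_of_ne_zero hk0
  induction j with
  | zero => exact h1
  | succ j ih =>
    have := (ih (by omega)).mul h1
    convert this using 2 with y
    simp only [hk, Nat.succ_eq_add_one]; ring

theorem Ik_int {f : Euc d → ℝ} (hf : Integrable f) (k : ℕ) (x : Euc d) (r : ℝ) :
    Integrable (fun y => f y * hk k r x y) :=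
  hf.mul_bdd (c := (r ^ 2) ^ k) (hk_cont k r x).aestronglyMeasurable (.of_forall fun y => by
    rw [Real.norm_eq_abs, abs_of_nonneg (hk_nonneg _ _ _ _)]; exact hk_le _ _ _ _)

theorem Ik_nonneg {f : Euc d → ℝ} (hf : ∀ y, 0 ≤ f y) (k : ℕ) (x : Euc d) (r : ℝ) : 0 ≤ Ik k f x r :=
  integral_nonneg fun y => mul_nonneg (hf y) (hk_nonneg _ _ _ _)

theorem Ak_nonneg {f : Euc d → ℝ} (hf : ∀ y, 0 ≤ f y) (x : Euc d) {r : ℝ} (hr : 0 ≤ r) : 0 ≤ Ak f x r :=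
  div_nonneg (Ik_nonneg hf _ _ _) (by positivity)

theorem Ik3_le {f : Euc d → ℝ} (hi : Integrable f) (hf : ∀ y, 0 ≤ f y) (x : Euc d) (r : ℝ) :
    Ik 3 f x r ≤ r ^ 2 * Ik 2 f x r := by
  unfold Ik
  rw [← integral_const_mul]
  refine integral_mono (Ik_int hi 3 x r) ((Ik_int hi 2 x r).const_mul _) fun y => ?_
  have h1 : hk 3 r x y = hk 1 r x y * hk 2 r x y := by simp only [hk]; ring
  have h2 := hk_le 1 r x y
  rw [pow_one] at h2
  beta_reduce
  rw [h1]
  have := mul_nonneg (hf y) (hk_nonneg 2 r x y)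
  nlinarith

theorem Ik_deriv {f : Euc d → ℝ} (hf : Integrable f) (x : Euc d) (r : ℝ) :
    HasDerivAt (fun r => Ik 2 f x r) (4 * r * Ik 1 f x r) r := by
  have hT : HasDerivAt (fun T : ℝ => ∫ y, f y * (max (T - ‖y - x‖ ^ 2) 0) ^ 2)
      (∫ y, f y * (2 * max (r ^ 2 - ‖y - x‖ ^ 2) 0)) (r ^ 2) := by
    refine (hasDerivAt_integral_of_dominated_loc_of_deriv_le (s := ball (r ^ 2) 1)
      (F := fun T y => f y * (max (T - ‖y - x‖ ^ 2) 0) ^ 2)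
      (F' := fun T y => f y * (2 * max (T - ‖y - x‖ ^ 2) 0))
      (bound := fun y => ‖f y‖ * (2 * (r ^ 2 + 1))) (ball_mem_nhds _ one_pos)
      (.of_forall fun T => hf.1.mul (Continuous.aestronglyMeasurable (by fun_prop))) (Ik_int hf 2 x r)
      (hf.1.mul (Continuous.aestronglyMeasurable (by fun_prop))) (.of_forall fun y T hT => ?_)
      (hf.norm.mul_const _) (.of_forall fun y T hT => ?_)).2
    · rw [norm_mul]
      refine mul_le_mul_of_nonneg_left ?_ (norm_nonneg _)
      rw [Real.norm_eq_abs, abs_of_nonneg (by positivity)]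
      have : T < r ^ 2 + 1 := by
        rw [mem_ball, Real.dist_eq] at hT; linarith [(abs_lt.mp hT).2]
      have h2 : max (T - ‖y - x‖ ^ 2) 0 ≤ r ^ 2 + 1 :=
        max_le (by nlinarith [sq_nonneg ‖y - x‖]) (by positivity)
      linarith
    · have h1 := hasDerivAt_mp 0 (T - ‖y - x‖ ^ 2)
      have h2 := h1.comp T ((hasDerivAt_id T).sub_const (‖y - x‖ ^ 2))
      have h3 := h2.const_mul (f y)
      simpa using h3
  have h2 := HasDerivAt.comp (h₂ := fun T : ℝ => ∫ y, f y * (max (T - ‖y - x‖ ^ 2) 0) ^ 2) (h := fun r : ℝ => r ^ 2) r hT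
    (hasDerivAt_pow 2 r)
  refine HasDerivAt.congr_deriv (f := fun r => Ik 2 f x r) h2 ?_
  unfold Ik hk
  rw [← integral_const_mul, ← integral_mul_const]
  congr 1; ext y; push_cast; ring

theorem Ak_deriv {f : Euc d → ℝ} (hf : Integrable f) (lam : ℝ) (x : Euc d) {r : ℝ} (hr : 0 < r) :
    HasDerivAt (fun r => Ak f x r) ((mu lam f x r - lam * Ik 3 f x r) / (6 * r ^ (d + 5))) r := by
  have := (Ik_deriv hf x r).div (hasDerivAt_pow (d + 4) r) (by positivity)
  refine HasDerivAt.congr_deriv (f := fun r => Ak f x r) this ?_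
  unfold mu
  have : (d + 4 - 1) = d + 3 := by omega
  rw [this]
  push_cast
  field_simp
  ring

theorem hk_fderiv (k : ℕ) (r : ℝ) (x y : Euc d) : ∃ L : Euc d →L[ℝ] ℝ, HasFDerivAt (hk (k + 2) r x) L y ∧
    ∀ v, L v = -2 * (k + 2) * hk (k + 1) r x y * ⟪y - x, v⟫ := by
  have h1 : HasFDerivAt (fun y : Euc d => r ^ 2 - ‖y - x‖ ^ 2) (-(2 • innerSL ℝ (y - x))) y := by
    have h := (((hasStrictFDerivAt_norm_sq (y - x)).hasFDerivAt).comp y ((hasFDerivAt_id y).sub_const x)).const_sub (r ^ 2)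
    simpa using h
  refine ⟨_, HasDerivAt.comp_hasFDerivAt (h₂ := fun t : ℝ => (max t 0) ^ (k + 2)) y (hasDerivAt_mp k (r ^ 2 - ‖y - x‖ ^ 2)) h1, fun v => ?_⟩
  simp [hk, inner_sub_left]
  ring

theorem hk_inner (k : ℕ) (r : ℝ) (x y v : Euc d) :
    ⟪gradient (hk (k + 2) r x) y, v⟫ = -2 * (k + 2) * hk (k + 1) r x y * ⟪y - x, v⟫ := by
  obtain ⟨L, h1, h2⟩ := hk_fderiv k r x y
  rw [inner_grad, h1.fderiv, h2]

theorem LC.mulLip {f g : Euc d → ℝ} (hf : LC f) {K : ℝ≥0} (hg : LipschitzWith K g) :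
    LC (fun x => f x * g x) := by
  obtain ⟨C, hC⟩ := hf.bc.bd
  obtain ⟨R, hR⟩ := hf.bc.cs
  obtain ⟨⟨L, hL⟩, hc⟩ := hf
  have hC0 : 0 ≤ C := (norm_nonneg _).trans (hC 0)
  have hgb : ∀ x : Euc d, ‖x‖ ≤ |R| → |g x| ≤ |g 0| + K * |R| := fun x hx => by
    have h1 := hg.dist_le_mul x 0
    rw [Real.dist_eq, dist_zero_right] at h1
    have h2 := abs_sub_abs_le_abs_sub (g x) (g 0)
    nlinarith [K.2, mul_le_mul_of_nonneg_left hx K.2]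
  have hM0 : 0 ≤ |g 0| + K * |R| := by positivity
  set M := |g 0| + K * |R|
  have hd1 : ∀ x y, |f x - f y| ≤ L * ‖x - y‖ := fun x y => by
    have := hL.dist_le_mul x y; rwa [Real.dist_eq, dist_eq_norm] at this
  have hd2 : ∀ x y, |g x - g y| ≤ K * ‖x - y‖ := fun x y => by
    have := hg.dist_le_mul x y; rwa [Real.dist_eq, dist_eq_norm] at this
  refine ⟨⟨Real.toNNReal (C * K + M * L), LipschitzWith.of_dist_le_mul fun x y => ?_⟩, hc.mul_right⟩
  rw [Real.coe_toNNReal _ (by positivity), Real.dist_eq, dist_eq_norm]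
  have hz : ∀ x : Euc d, ¬ ‖x‖ ≤ |R| → f x = 0 := fun x hx =>
    hR x (lt_of_le_of_lt (le_abs_self _) (not_le.mp hx))
  have key : ∀ x y : Euc d, ‖y‖ ≤ |R| → |f x * g x - f y * g y| ≤ (C * K + M * L) * ‖x - y‖ := by
    intro x y hy
    have e : f x * g x - f y * g y = f x * (g x - g y) + (f x - f y) * g y := by ring
    rw [e]
    refine (abs_add_le _ _).trans ?_
    rw [abs_mul, abs_mul]
    have a1 : |f x| * |g x - g y| ≤ C * (K * ‖x - y‖) :=
      mul_le_mul (hC x) (hd2 x y) (abs_nonneg _) hC0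
    have a2 : |f x - f y| * |g y| ≤ (L * ‖x - y‖) * M :=
      mul_le_mul (hd1 x y) (hgb y hy) (abs_nonneg _) (by positivity)
    nlinarith
  by_cases hy : ‖y‖ ≤ |R|
  · exact key x y hy
  · by_cases hx : ‖x‖ ≤ |R|
    · rw [abs_sub_comm, norm_sub_rev]; exact key y x hx
    · rw [hz x hx, hz y hy]; simp; positivity

theorem int_hk {f : Euc d → ℝ} (hf : LC f) (k : ℕ) (x : Euc d) {r : ℝ} (hr : 0 ≤ r) :
    ∫ y, ⟪gradient f y, gradient (hk (k + 3) r x) y⟫ =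
      2 * (k + 3) * ∫ y, f y * (d * hk (k + 2) r x y - 2 * (k + 2) * (hk (k + 1) r x y * ‖y - x‖ ^ 2)) := by
  have e1 : ∀ y, ⟪gradient f y, gradient (hk (k + 3) r x) y⟫ =
      -2 * (k + 3) * ∑ i, ⟪gradient f y, EuclideanSpace.single i (1:ℝ)⟫ * (hk (k + 2) r x y * (y i - x i)) := fun y => by
    rw [real_inner_comm, hk_inner (k + 1), PiLp.inner_apply]
    simp only [EuclideanSpace.inner_single_right]
    rw [Finset.mul_sum, Finset.mul_sum]
    refine Finset.sum_congr rfl fun i _ => ?_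
    simp
    ring
  have hlip : ∀ i : Fin d, LipschitzWith 1 (fun y : Euc d => y i - x i) := fun i =>
    LipschitzWith.of_dist_le_mul fun y z => by
      rw [Real.dist_eq, dist_eq_norm, NNReal.coe_one, one_mul]
      have := PiLp.norm_apply_le (y - z) i
      simpa using this
  have hl : ∀ i : Fin d, LC (fun y => hk (k + 2) r x y * (y i - x i)) := fun i =>
    (hk_lc (by omega) hr x).mulLip (hlip i)
  have e2 : ∀ (i : Fin d) (y : Euc d), ⟪gradient (fun y => hk (k + 2) r x y * (y i - x i)) y, EuclideanSpace.single i (1:ℝ)⟫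
      = hk (k + 2) r x y - 2 * (k + 2) * hk (k + 1) r x y * (y i - x i) ^ 2 := fun i y => by
    obtain ⟨L, h1, h2⟩ := hk_fderiv k r x y
    have h3 : HasFDerivAt (fun y : Euc d => y i - x i) (EuclideanSpace.proj i : Euc d →L[ℝ] ℝ) y :=
      (EuclideanSpace.proj i : Euc d →L[ℝ] ℝ).hasFDerivAt.sub_const (x i)
    rw [inner_grad, HasFDerivAt.fderiv (f := fun y => hk (k + 2) r x y * (y i - x i)) (h1.mul h3)]
    simp [h2, EuclideanSpace.inner_single_right]
    ring
  obtain ⟨⟨K, hK⟩, -⟩ := id hf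
  have e3 : ∀ i : Fin d, ∫ y, ⟪gradient f y, EuclideanSpace.single i (1:ℝ)⟫ * (hk (k + 2) r x y * (y i - x i))
      = - ∫ y, f y * (hk (k + 2) r x y - 2 * (k + 2) * hk (k + 1) r x y * (y i - x i) ^ 2) := fun i => by
    rw [ibp hK (hl i)]
    simp only [e2]
  have hb : ∀ i : Fin d, BC (fun y => f y * (hk (k + 2) r x y - 2 * (k + 2) * hk (k + 1) r x y * (y i - x i) ^ 2)) := fun i => by
    have := hf.bc.mul ((hl i).gbc.innerc (EuclideanSpace.single i (1:ℝ)))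
    simpa only [e2] using this
  simp only [e1]
  rw [integral_const_mul, integral_finsetSum _ fun i _ => ((hf.gbc.innerc _).mul (hl i).bc).integrable]
  simp only [e3, Finset.sum_neg_distrib]
  rw [← integral_finsetSum _ fun i _ => (hb i).integrable, neg_mul, neg_mul, mul_neg, neg_neg]
  congr 2; ext y
  rw [← Finset.mul_sum, Finset.sum_sub_distrib, ← Finset.mul_sum]
  have : ∑ i, (y i - x i) ^ 2 = ‖y - x‖ ^ 2 := by
    rw [EuclideanSpace.real_norm_sq_eq]; simp
  rw [this]
  simp only [Finset.sum_const, Finset.card_univ, Fintype.card_fin, nsmul_eq_mul]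
  ring

theorem Bf_hk {f : Euc d → ℝ} (hf : LC f) (lam : ℝ) (x : Euc d) {r : ℝ} (hr : 0 ≤ r) :
    Bf lam f (hk 3 r x) = - mu lam f x r := by
  have hi := hf.bc.integrable
  have e5 : ∫ y, ⟪gradient f y, gradient (hk 3 r x) y⟫
      = 6 * ((d + 4) * Ik 2 f x r - 4 * r ^ 2 * Ik 1 f x r) := by
    have h := int_hk hf 0 x hr
    simp only [zero_add, CharP.cast_eq_zero] at h
    rw [h]
    unfold Ik
    rw [← integral_const_mul (d + 4 : ℝ), ← integral_const_mul (4 * r ^ 2), ← integral_sub ((Ik_int hi 2 x r).const_mul _)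
      ((Ik_int hi 1 x r).const_mul _), ← integral_const_mul, ← integral_const_mul]
    congr 1; ext y
    have h6 : hk 1 r x y * ‖y - x‖ ^ 2 = r ^ 2 * hk 1 r x y - hk 2 r x y := by
      simp only [hk, pow_one]
      rcases le_total (r ^ 2 - ‖y - x‖ ^ 2) 0 with h | h
      · rw [max_eq_right h]; ring
      · rw [max_eq_left h]; ring
    rw [h6]
    ring
  have e6 : Bf lam f (hk 3 r x) = (∫ y, ⟪gradient f y, gradient (hk 3 r x) y⟫) - lam * Ik 3 f x r := by
    unfold Bf Ik
    rw [integral_sub (hf.gbc.inner (hk_lc three_ne_zero hr x).gbc).integrable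
      ((Ik_int hi 3 x r).const_mul _), integral_const_mul]
  rw [e6, e5]; unfold mu
  ring
end

section
theorem Bf_add {f g h : Euc d → ℝ} (hf : LC f) (hg : LC g) (hh : LC h) (lam t : ℝ) :
    Bf lam f (fun x => g x + t * h x) = Bf lam f g + t * Bf lam f h := by
  unfold Bf
  rw [← integral_const_mul, ← integral_add (hf.bbc hg lam).integrable ((hf.bbc hh lam).integrable.const_mul t)]
  refine integral_congr_ae ?_
  filter_upwards [hg.diff, hh.diff] with x h1 h2
  rw [grad_add h1 (h2.const_mul t), grad_cmul t h2, inner_add_right, inner_smul_right]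
  ring

theorem Q_eq {f : Euc d → ℝ} (hf : LC f) : Jf 0 f = ∫ x, ‖gradient f x‖ ^ 2 := by
  rw [Jf_eq hf]; ring

theorem Q_nonneg {f : Euc d → ℝ} (hf : LC f) : 0 ≤ Jf 0 f := by
  rw [Q_eq hf]; exact integral_nonneg fun x => sq_nonneg _

theorem Q_le {f g : Euc d → ℝ} (hf : LC f) (hg : LC g) (t : ℝ) :
    Jf 0 (fun x => f x + t * g x) ≤ 2 * Jf 0 f + 2 * t ^ 2 * Jf 0 g := by
  have h1 := Jf_add hf hg 0 t
  have h2 := Jf_add hf hg 0 (-t)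
  have h3 := Q_nonneg (hf.add (hg.cmul (-t)))
  nlinarith

theorem Q_pos {f : Euc d → ℝ} (hf : LC f) : Jf 0 (fun x => max (f x) 0) ≤ Jf 0 f := by
  rw [Q_eq hf, Q_eq hf.max0]
  refine integral_mono hf.max0.g2.integrable hf.g2.integrable fun x => ?_
  beta_reduce
  rw [grad_pos hf.cont]
  split_ifs
  · exact le_rfl
  · simp

variable {D Ω : Set (Euc d)} {a lam : ℝ} {φ : ℕ → Euc d → ℝ} {u : Euc d → ℝ} {G : Euc d → Euc d}

theorem Sol.Q_ev (S : Sol D Ω a lam φ u G) : ∀ᶠ n in atTop, Jf 0 (φ n) ≤ lam + 1 := by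
  filter_upwards [S.J0.eventually (gt_mem_nhds one_pos)] with n hn
  have h1 := Jf_eq (S.lc n) lam
  rw [S.one] at h1
  rw [Q_eq (S.lc n)]
  linarith

theorem Sol.B0 (S : Sol D Ω a lam φ u G) {m : ℕ → Euc d → ℝ} {C δ : ℝ} (hm : ∀ n, LC (m n))
    (h0 : ∀ n x, x ∉ Ω → m n x = 0) (hC : ∀ᶠ n in atTop, Jf 0 (m n) ≤ C) (hδ : 0 < δ) :
    ∀ᶠ n in atTop, |Bf lam (φ n) (m n)| ≤ δ := by
  have hC0 : 0 ≤ |C| := abs_nonneg _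
  filter_upwards [hC, S.J0.eventually (gt_mem_nhds (show 0 < δ ^ 2 / (|C| + 1) by positivity))] with n h1 h2
  have h3 := Bf_sq_le (S.lc n) (hm n) lam fun t => S.jnn ((S.lc n).add ((hm n).cmul t)) fun x hx => by
    rw [S.off n x hx, h0 n x hx]; ring
  have h4 : Jf lam (m n) ≤ |C| := (Jf_mono_lam (hm n) S.lam0).trans (h1.trans (le_abs_self C))
  have h5 := S.jnn (S.lc n) (S.off n)
  have h6 := S.jnn (hm n) (h0 n)
  have h7 : δ ^ 2 / (|C| + 1) * (|C| + 1) = δ ^ 2 := by field_simp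
  refine abs_le_of_sq_le_sq ?_ hδ.le
  nlinarith [mul_le_mul h2.le h4 h6 (by positivity)]

theorem Sol.sub (S : Sol D Ω a lam φ u G) {ζ : Euc d → ℝ} (hζ : LC ζ) (h0 : ∀ x, 0 ≤ ζ x) {δ : ℝ}
    (hδ : 0 < δ) : ∀ᶠ n in atTop, Bf lam (φ n) ζ ≤ δ := by
  have hQ := Q_nonneg hζ
  obtain ⟨s, hs, hsδ⟩ : ∃ s : ℝ, 0 < s ∧ s * Jf 0 ζ ≤ δ := by
    refine ⟨δ / (Jf 0 ζ + 1), by positivity, ?_⟩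
    rw [div_mul_eq_mul_div, div_le_iff₀ (by positivity)]; nlinarith
  have hg : ∀ n, LC (fun x => s * ζ x + (-1) * φ n x) := fun n => (hζ.cmul s).add ((S.lc n).cmul (-1))
  set f : ℕ → Euc d → ℝ := fun n x => max (s * ζ x + (-1) * φ n x) 0 with hf
  have hfl : ∀ n, LC (f n) := fun n => (hg n).max0
  set m : ℕ → Euc d → ℝ := fun n x => ζ x + (-1 / s) * f n x with hm
  have hml : ∀ n, LC (m n) := fun n => hζ.add ((hfl n).cmul _)
  have hm0 : ∀ n x, x ∉ Ω → m n x = 0 := fun n x hx => by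
    simp only [hm, hf]
    rw [S.off n x hx, max_eq_left (by nlinarith [h0 x])]
    field_simp; ring
  have hQm : ∀ᶠ n in atTop, Jf 0 (m n) ≤ 2 * Jf 0 ζ + 2 * (-1 / s) ^ 2 * (2 * (s ^ 2 * Jf 0 ζ) + 2 * (-1) ^ 2 * (lam + 1)) := by
    filter_upwards [S.Q_ev] with n hn
    refine (Q_le hζ (hfl n) _).trans ?_
    have h1 := (Q_pos (hg n)).trans (Q_le (hζ.cmul s) (S.lc n) (-1))
    rw [Jf_cmul hζ] at h1
    gcongr
    refine h1.trans ?_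
    gcongr
  filter_upwards [S.B0 hml hm0 hQm (show 0 < δ / 2 by positivity)] with n hn
  have hB : Bf lam (φ n) (m n) = Bf lam (φ n) ζ + (-1 / s) * Bf lam (φ n) (f n) := Bf_add (S.lc n) hζ (hfl n) lam _
  have hBf : Bf lam (φ n) (f n) ≤ s ^ 2 / 4 * Jf 0 ζ := by
    rw [Q_eq hζ, Bf, ← integral_const_mul]
    refine integral_mono_ae ((S.lc n).bbc (hfl n) lam).integrable (hζ.g2.integrable.const_mul _) ?_
    filter_upwards [hζ.diff, (S.lc n).diff] with x h1 h2
    have h3 : 0 ≤ lam * (φ n x * f n x) := mul_nonneg S.lam0 (mul_nonneg (S.nn n x) (le_max_right _ _))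
    have h4 : ⟪gradient (φ n) x, gradient (f n) x⟫ ≤ s ^ 2 / 4 * ‖gradient ζ x‖ ^ 2 := by
      simp only [hf]
      rw [grad_pos (hg n).cont]
      split_ifs
      · rw [grad_add (h1.const_mul s) (h2.const_mul (-1)), grad_cmul s h1, grad_cmul (-1) h2, inner_add_right,
          inner_smul_right, inner_smul_right, real_inner_self_eq_norm_sq]
        have := real_inner_le_norm (gradient (φ n) x) (gradient ζ x)
        nlinarith [sq_nonneg (s / 2 * ‖gradient ζ x‖ - ‖gradient (φ n) x‖)]
      · rw [inner_zero_right]; positivity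
    linarith
  have h5 : (1 / s) * Bf lam (φ n) (f n) ≤ (1 / s) * (s ^ 2 / 4 * Jf 0 ζ) :=
    mul_le_mul_of_nonneg_left hBf (by positivity)
  have h6 : (1 / s) * (s ^ 2 / 4 * Jf 0 ζ) = s * Jf 0 ζ / 4 := by field_simp
  have h7 : (-1 / s) * Bf lam (φ n) (f n) = - ((1 / s) * Bf lam (φ n) (f n)) := by ring
  have := (abs_le.mp hn).2
  linarith

theorem Sol.Iklim (S : Sol D Ω a lam φ u G) (k : ℕ) (x : Euc d) (r : ℝ) :
    Tendsto (fun n => Ik k (φ n) x r) atTop (𝓝 (Ik k u x r)) :=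
  S.lim (hk_cont k r x).aestronglyMeasurable ⟨(r ^ 2) ^ k, fun y => by
    rw [abs_of_nonneg (hk_nonneg _ _ _ _)]; exact hk_le _ _ _ _⟩

theorem Sol.mulim (S : Sol D Ω a lam φ u G) (x : Euc d) (r : ℝ) :
    Tendsto (fun n => mu lam (φ n) x r) atTop (𝓝 (mu lam u x r)) :=
  (((S.Iklim 3 x r).const_mul lam).add ((S.Iklim 1 x r).const_mul _)).sub ((S.Iklim 2 x r).const_mul _)

theorem Sol.mu_nonneg (S : Sol D Ω a lam φ u G) (x : Euc d) {r : ℝ} (hr : 0 ≤ r) : 0 ≤ mu lam u x r := by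
  refine le_of_forall_pos_le_add fun δ hδ => ?_
  have := ge_of_tendsto (b := -δ) (S.mulim x r) (by
    filter_upwards [S.sub (hk_lc three_ne_zero hr x) (hk_nonneg 3 r x) hδ] with n hn
    rw [Bf_hk (S.lc n) lam x hr] at hn
    linarith)
  linarith

theorem Sol.mu_zero (S : Sol D Ω a lam φ u G) {x : Euc d} {r : ℝ} (hr : 0 ≤ r) (hb : ball x r ⊆ Ω) : mu lam u x r = 0 := by
  refine le_antisymm ?_ (S.mu_nonneg x hr)
  refine le_of_forall_pos_le_add fun δ hδ => ?_
  rw [zero_add]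
  refine le_of_tendsto (S.mulim x r) ?_
  filter_upwards [S.B0 (m := fun _ => hk 3 r x) (fun _ => hk_lc three_ne_zero hr x) (fun _ y hy => hk_zero three_ne_zero hr (by
    by_contra h; exact hy (hb (by rw [mem_ball, dist_eq_norm]; exact not_le.mp h)))) (.of_forall fun _ => le_rfl) hδ] with n hn
  rw [Bf_hk (S.lc n) lam x hr] at hn
  linarith [(abs_le.mp hn).1]
end

section
theorem mono_of {g g' : ℝ → ℝ} {s r : ℝ} (hsr : s ≤ r) (h : ∀ t ∈ Icc s r, HasDerivAt g (g' t) t)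
    (h0 : ∀ t ∈ Icc s r, 0 ≤ g' t) : g s ≤ g r :=
  monotoneOn_of_deriv_nonneg (convex_Icc s r) (fun t ht => (h t ht).continuousAt.continuousWithinAt)
    (fun t ht => (h t (interior_subset ht)).differentiableAt.differentiableWithinAt)
    (fun t ht => by rw [(h t (interior_subset ht)).deriv]; exact h0 t (interior_subset ht))
    (left_mem_Icc.mpr hsr) (right_mem_Icc.mpr hsr) hsr

/-- mass of the kernel -/
def cd (d : ℕ) : ℝ := ∫ y : Euc d, hk 2 1 0 y

theorem cd_pos : 0 < cd d := by
  have h : LC (hk 2 1 (0 : Euc d)) := hk_lc two_ne_zero zero_le_one 0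
  unfold cd
  refine h.cont.integral_pos_of_hasCompactSupport_nonneg_nonzero h.2 (hk_nonneg 2 1 0) (x := 0) ?_
  simp [hk]

theorem hk_mass (x : Euc d) {r : ℝ} (hr : 0 < r) : ∫ y, hk 2 r x y = r ^ (d + 4) * cd d := by
  have h1 : ∫ y, hk 2 r x y = ∫ y, hk 2 r x (y + x) := (int_trans _ x).symm
  have h2 : ∀ y : Euc d, hk 2 r x (y + x) = r ^ 4 * hk 2 1 0 (r⁻¹ • y) := fun y => by
    simp only [hk, add_sub_cancel_right, sub_zero, norm_smul, norm_inv, Real.norm_eq_abs, abs_of_pos hr]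
    have : r ^ 2 - ‖y‖ ^ 2 = r ^ 2 * (1 ^ 2 - (r⁻¹ * ‖y‖) ^ 2) := by field_simp
    rw [this, ← mul_zero (r ^ 2), ← mul_max_of_nonneg _ _ (by positivity), mul_zero]; ring
  rw [h1]
  simp only [h2]
  rw [integral_const_mul, Measure.integral_comp_smul, finrank_euclideanSpace_fin, smul_eq_mul, inv_pow, inv_inv,
    abs_of_pos (by positivity), cd]
  ring

theorem Ak_lim {f : Euc d → ℝ} (hf : Integrable f) :
    ∀ᵐ x, Tendsto (fun r => Ak f x r) (𝓝[>] 0) (𝓝 (cd d * f x)) := by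
  filter_upwards [IsUnifLocDoublingMeasure.ae_tendsto_average_norm_sub volume hf.locallyIntegrable 1] with x hx
  have h1 := (hx (l := 𝓝[>] (0:ℝ)) (fun _ => x) (fun r => r) tendsto_id (by
    filter_upwards [self_mem_nhdsWithin] with r hr
    rw [one_mul]; exact mem_closedBall_self (le_of_lt hr))).const_mul (omg d)
  rw [mul_zero] at h1
  rw [tendsto_iff_norm_sub_tendsto_zero]
  refine squeeze_zero' (.of_forall fun _ => norm_nonneg _) ?_ h1
  filter_upwards [self_mem_nhdsWithin] with r hr
  have hr : 0 < r := hr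
  have hv : (volume : Measure (Euc d)).real (closedBall x r) = r ^ d * omg d := mvol_closedBall x hr.le
  have hI := ((hk_lc two_ne_zero hr.le x).bc.integrable)
  rw [setAverage_eq, hv, smul_eq_mul]
  have e1 : Ak f x r - cd d * f x = (∫ y, (f y - f x) * hk 2 r x y) / r ^ (d + 4) := by
    have : ∫ y, (f y - f x) * hk 2 r x y = Ik 2 f x r - f x * (r ^ (d + 4) * cd d) := by
      rw [← hk_mass x hr, ← integral_const_mul, Ik, ← integral_sub (Ik_int hf 2 x r) (hI.const_mul _)]
      simp only [sub_mul]
    rw [this, Ak]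
    field_simp
  have e2 : ‖∫ y, (f y - f x) * hk 2 r x y‖ ≤ r ^ 4 * ∫ y in closedBall x r, ‖f y - f x‖ := by
    rw [← integral_const_mul, ← integral_indicator measurableSet_closedBall]
    refine norm_integral_le_of_norm_le ?_ (.of_forall fun y => ?_)
    · rw [integrable_indicator_iff measurableSet_closedBall]
      exact ((hf.integrableOn.sub (integrableOn_const (measure_closedBall_lt_top.ne))).norm).const_mul _
    · by_cases hy : y ∈ closedBall x r
      · rw [indicator_of_mem hy, norm_mul, mul_comm]
        refine mul_le_mul_of_nonneg_right ?_ (norm_nonneg _)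
        rw [Real.norm_eq_abs, abs_of_nonneg (hk_nonneg _ _ _ _)]
        exact (hk_le 2 r x y).trans (le_of_eq (by ring))
      · rw [indicator_of_notMem hy, hk_zero two_ne_zero hr.le]
        · simp
        · rw [mem_closedBall, dist_eq_norm] at hy; linarith
  rw [e1, norm_div, Real.norm_eq_abs (r ^ (d + 4)), abs_of_pos (by positivity), div_le_iff₀ (by positivity)]
  refine e2.trans (le_of_eq ?_)
  have := omg_pos (d := d)
  field_simp
  ring

variable {D Ω : Set (Euc d)} {a lam : ℝ} {φ : ℕ → Euc d → ℝ} {u : Euc d → ℝ} {G : Euc d → Euc d}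

theorem Sol.Amono (S : Sol D Ω a lam φ u G) (x : Euc d) {s r : ℝ} (hs : 0 < s) (hsr : s ≤ r) :
    Ak u x s ≤ Real.exp (lam * r ^ 2 / 12) * Ak u x r := by
  have key : Real.exp (lam * s ^ 2 / 12) * Ak u x s ≤ Real.exp (lam * r ^ 2 / 12) * Ak u x r := by
    refine mono_of (g := fun t => Real.exp (lam * t ^ 2 / 12) * Ak u x t)
      (g' := fun t => Real.exp (lam * t ^ 2 / 12) * (lam * (2 * t) / 12) * Ak u x t + Real.exp (lam * t ^ 2 / 12) *
        ((mu lam u x t - lam * Ik 3 u x t) / (6 * t ^ (d + 5)))) hsr (fun t ht => ?_) fun t ht => ?_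
    · have h1 : HasDerivAt (fun t : ℝ => lam * t ^ 2 / 12) (lam * (2 * t) / 12) t := by
        simpa using ((hasDerivAt_pow 2 t).const_mul lam).div_const 12
      exact h1.exp.mul (Ak_deriv S.uint lam x (hs.trans_le ht.1))
    · have ht0 : 0 < t := hs.trans_le ht.1
      have h1 := S.mu_nonneg x ht0.le
      have h2 := Ik3_le S.uint S.unn x t
      have h3 : lam * (2 * t) / 12 * Ak u x t + (mu lam u x t - lam * Ik 3 u x t) / (6 * t ^ (d + 5))
          = (mu lam u x t + lam * (t ^ 2 * Ik 2 u x t - Ik 3 u x t)) / (6 * t ^ (d + 5)) := by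
        rw [Ak]; field_simp; ring
      have h4 : 0 ≤ (mu lam u x t + lam * (t ^ 2 * Ik 2 u x t - Ik 3 u x t)) / (6 * t ^ (d + 5)) :=
        div_nonneg (add_nonneg h1 (mul_nonneg S.lam0 (by linarith))) (by positivity)
      rw [← h3] at h4
      have := mul_nonneg (Real.exp_pos (lam * t ^ 2 / 12)).le h4
      linarith
  refine le_trans ?_ key
  have := S.lam0
  exact le_mul_of_one_le_left (Ak_nonneg S.unn x hs.le) (Real.one_le_exp (by positivity))

theorem Sol.ubd (S : Sol D Ω a lam φ u G) : ∀ᵐ y, ∀ x r, 0 < r → ‖y - x‖ < r →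
    cd d * u y ≤ Real.exp (lam * r ^ 2 / 12) * (3 ^ (d + 4) * Ak u x (3 * r)) := by
  filter_upwards [Ak_lim S.uint] with y hy x r hr hyx
  refine (le_of_tendsto hy (b := Real.exp (lam * r ^ 2 / 12) * Ak u y r) ?_).trans ?_
  · filter_upwards [Ioc_mem_nhdsGT hr] with s hs
    exact S.Amono y hs.1 hs.2
  · refine mul_le_mul_of_nonneg_left ?_ (Real.exp_pos _).le
    have h1 : Ik 2 u y r ≤ Ik 2 u x (3 * r) := by
      refine integral_mono (Ik_int S.uint 2 y r) (Ik_int S.uint 2 x (3 * r)) fun w => ?_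
      refine mul_le_mul_of_nonneg_left ?_ (S.unn w)
      by_cases hw : r ≤ ‖w - y‖
      · rw [hk_zero two_ne_zero hr.le hw]; exact hk_nonneg _ _ _ _
      · refine (hk_le 2 r y w).trans (pow_le_pow_left₀ (sq_nonneg _) (le_max_of_le_left ?_) 2)
        have : ‖w - x‖ ≤ ‖w - y‖ + ‖y - x‖ := by
          rw [show w - x = (w - y) + (y - x) by abel]; exact norm_add_le _ _
        push Not at hw
        nlinarith [norm_nonneg (w - x)]
    rw [Ak, Ak, mul_pow]
    rw [div_le_iff₀ (by positivity)]
    refine h1.trans (le_of_eq ?_)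
    field_simp

theorem Sol.Aanti (S : Sol D Ω a lam φ u G) {x : Euc d} {s r : ℝ} (hs : 0 < s) (hsr : s ≤ r) (hb : ball x r ⊆ Ω) :
    Ak u x r ≤ Ak u x s := by
  have := mono_of (g := fun t => - Ak u x t) (g' := fun t => - ((mu lam u x t - lam * Ik 3 u x t) / (6 * t ^ (d + 5)))) hsr
    (fun t ht => (Ak_deriv S.uint lam x (hs.trans_le ht.1)).neg) (fun t ht => by
      have ht0 : 0 < t := hs.trans_le ht.1
      rw [S.mu_zero ht0.le ((ball_subset_ball ht.2).trans hb), zero_sub, neg_div, neg_neg]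
      have := mul_nonneg S.lam0 (Ik_nonneg S.unn 3 x t)
      positivity)
  linarith

theorem Ik_cont {f : Euc d → ℝ} (hf : Integrable f) (k : ℕ) (r : ℝ) : Continuous (fun x => Ik k f x r) := by
  unfold Ik
  refine continuous_of_dominated (bound := fun y => ‖f y‖ * (r ^ 2) ^ k) (fun x => (Ik_int hf k x r).1)
    (fun x => .of_forall fun y => ?_) (hf.norm.mul_const _) (.of_forall fun y => by unfold hk; fun_prop)
  rw [norm_mul, Real.norm_eq_abs (hk k r x y), abs_of_nonneg (hk_nonneg _ _ _ _)]
  exact mul_le_mul_of_nonneg_left (hk_le _ _ _ _) (norm_nonneg _)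

theorem Sol.u2 (S : Sol D Ω a lam φ u G) : ¬ (u =ᵐ[volume] 0) := fun h => by
  have h1 : ∀ n, ∫ x, (φ n x - u x) ^ 2 = 1 := fun n => by
    rw [← S.one n]
    refine integral_congr_ae ?_
    filter_upwards [h] with x hx
    rw [hx]; simp
  have := S.conv
  simp only [h1] at this
  exact one_ne_zero (tendsto_nhds_unique tendsto_const_nhds this)

def PosAt (u : Euc d → ℝ) (x : Euc d) : Prop := ∃ s > 0, ∃ δ > 0, ∀ᵐ y, y ∈ ball x s → δ ≤ u y

theorem Sol.start (S : Sol D Ω a lam φ u G) : ∃ x ∈ Ω, PosAt u x := by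
  have hl := Ak_lim S.uint
  obtain ⟨x, hx0, hx⟩ : ∃ x, u x ≠ 0 ∧ Tendsto (fun r => Ak u x r) (𝓝[>] 0) (𝓝 (cd d * u x)) := by
    by_contra hc
    push Not at hc
    refine S.u2 ?_
    filter_upwards [hl] with x hx
    by_contra h0
    exact hc x h0 hx
  have hxO : x ∈ Ω := by
    by_contra h; exact hx0 (S.uoff x h)
  have hux : 0 < u x := lt_of_le_of_ne (S.unn x) (Ne.symm hx0)
  obtain ⟨ρ, hρ, hb⟩ := Metric.isOpen_iff.mp S.hO x hxO
  obtain ⟨r, hr, hr0, hrρ⟩ := ((hx.eventually (lt_mem_nhds (mul_pos cd_pos hux))).and (Ioo_mem_nhdsGT (half_pos hρ))).exists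
  have hI : 0 < Ik 2 u x r := by
    have := mul_pos hr (show 0 < r ^ (d + 4) by positivity)
    rwa [Ak, div_mul_cancel₀ _ (by positivity)] at this
  obtain ⟨s, hs, hsb⟩ := Metric.eventually_nhds_iff_ball.mp
    ((Ik_cont S.uint 2 r).continuousAt.eventually (lt_mem_nhds (half_lt_self hI)))
  refine ⟨x, hxO, min s (ρ / 2), by positivity, Ik 2 u x r / 2 / r ^ (d + 4) / cd d, ?_, ?_⟩
  · have := cd_pos (d := d); positivity
  filter_upwards [hl] with y hy hyb
  have hyb' : dist y x < min s (ρ / 2) := hyb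
  have h1 := hsb y (mem_ball.mpr (hyb'.trans_le (min_le_left _ _)))
  have hbb : ball y r ⊆ Ω := by
    refine (ball_subset_ball' ?_).trans hb
    have := hyb'.trans_le (min_le_right s (ρ / 2))
    linarith
  rw [div_le_iff₀ cd_pos, mul_comm (u y)]
  refine le_trans ?_ (ge_of_tendsto hy (b := Ak u y r) ?_)
  · rw [Ak]; gcongr
  · filter_upwards [Ioc_mem_nhdsGT hr0] with t ht
    exact S.Aanti ht.1 ht.2 hbb
end

section
def gF (κ : ℝ) (k : ℕ) (R r : ℝ) (x : Euc d) (w : Euc d → ℝ) (y : Euc d) : ℝ :=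
  max (κ * hk (k + 3) R x y - w y - κ * (R ^ 2 - r ^ 2) ^ (k + 3)) 0

structure Gain (x : Euc d) (s r2 δ κ : ℝ) (k : ℕ) (c C : ℝ) : Prop where
  κ0 : 0 < κ
  c0 : 0 < c
  C0 : 0 ≤ C
  main : ∀ r ∈ Icc 0 r2, ∀ w, LC w → (∀ y, 0 ≤ w y) → LC (gF κ k (2 * r2) r x w) ∧
    (∀ y, r ≤ ‖y - x‖ → gF κ k (2 * r2) r x w y = 0) ∧ (∀ y, gF κ k (2 * r2) r x w y ≤ max (δ - w y) 0) ∧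
    (∀ lam, 0 ≤ lam → Jf lam (fun y => w y + 1 * gF κ k (2 * r2) r x w y) + Jf 0 (gF κ k (2 * r2) r x w)
      ≤ Jf lam w + C * ∫ y in ball x s, max (δ - w y) 0) ∧
    c * mvol ({y | w y = 0} ∩ (ball x r \ ball x s)) ≤ Jf 0 (gF κ k (2 * r2) r x w)

theorem gain (x : Euc d) {s r2 δ : ℝ} (hs : 0 < s) (hsr : s < r2) (hδ : 0 < δ) :
    ∃ κ k c C, Gain x s r2 δ κ k c C := by
  have hr2 : 0 < r2 := hs.trans hsr
  obtain ⟨k, hk2⟩ := exists_nat_ge (d * (2 * r2) ^ 2 / s ^ 2)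
  have hks : d * (2 * r2) ^ 2 ≤ 2 * (k + 2) * s ^ 2 := by
    rw [div_le_iff₀ (by positivity)] at hk2
    nlinarith [sq_nonneg s]
  set R := 2 * r2 with hR
  have hR0 : 0 < R := by positivity
  set κ := δ / (R ^ 2) ^ (k + 3) with hκ
  have hκ0 : 0 < κ := by positivity
  have hRr : 0 < R ^ 2 - r2 ^ 2 := by rw [hR]; nlinarith
  refine ⟨κ, k, (κ * (2 * (k + 3) * (R ^ 2 - r2 ^ 2) ^ (k + 2) * s)) ^ 2, 2 * κ * (2 * (k + 3) * (d * (R ^ 2) ^ (k + 2))),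
    hκ0, by positivity, by positivity, fun r hr w hw w0 => ?_⟩
  have hrr : r ^ 2 ≤ r2 ^ 2 := pow_le_pow_left₀ hr.1 hr.2 2
  have hq : 0 ≤ κ * (R ^ 2 - r ^ 2) ^ (k + 3) := mul_nonneg hκ0.le (pow_nonneg (by linarith) _)
  have hh : LC (hk (k + 3) R x) := hk_lc (by omega) hR0.le x
  have hg : LC (fun y => κ * hk (k + 3) R x y - w y) := (hh.cmul κ).sub hw
  set f := gF κ k R r x w with hf
  have hfl : LC f := hg.posl hq
  have f0 : ∀ y, 0 ≤ f y := fun y => le_max_right _ _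
  have hle : ∀ y, f y ≤ max (δ - w y) 0 := fun y => by
    refine max_le_max ?_ le_rfl
    have := mul_le_mul_of_nonneg_left (hk_le (k + 3) R x y) hκ0.le
    rw [hκ, div_mul_cancel₀ _ (by positivity), ← hκ] at this
    linarith
  have hz : ∀ y, r ≤ ‖y - x‖ → f y = 0 := fun y hy => by
    refine max_eq_right ?_
    have : hk (k + 3) R x y ≤ (R ^ 2 - r ^ 2) ^ (k + 3) :=
      pow_le_pow_left₀ (le_max_right _ _) (max_le (by nlinarith [hr.1]) (by linarith)) _
    nlinarith [w0 y, mul_le_mul_of_nonneg_left this hκ0.le]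
  have hgr : ∀ᵐ y, gradient f y = if 0 < κ * hk (k + 3) R x y - w y - κ * (R ^ 2 - r ^ 2) ^ (k + 3) then
      κ • gradient (hk (k + 3) R x) y - gradient w y else 0 := by
    filter_upwards [hh.diff, hw.diff] with y h1 h2
    have : f = fun y => max (κ * hk (k + 3) R x y - w y - κ * (R ^ 2 - r ^ 2) ^ (k + 3)) 0 := rfl
    rw [this, grad_pos (f := fun y => κ * hk (k + 3) R x y - w y - κ * (R ^ 2 - r ^ 2) ^ (k + 3)) (hg.cont.sub continuous_const), grad_sub (f := fun y => κ * hk (k + 3) R x y - w y) ((h1.const_mul κ).sub h2) (differentiableAt_const _),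
      grad_sub (h1.const_mul κ) h2, grad_cmul κ h1]
    simp [gradient]
  refine ⟨hfl, hz, hle, fun lam hl => ?_, ?_⟩
  · have h1 := Jf_add hw hfl lam 1
    have h2 := Jf_mono_lam hfl hl
    have h3 : Bf lam w f ≤ ∫ y, ⟪gradient w y, gradient f y⟫ :=
      integral_mono (hw.bbc hfl lam).integrable (hw.gbc.inner hfl.gbc).integrable fun y => by
        have := mul_nonneg hl (mul_nonneg (w0 y) (f0 y))
        beta_reduce; linarith
    have h4 : (∫ y, ⟪gradient w y, gradient f y⟫) + Jf 0 f = κ * ∫ y, ⟪gradient f y, gradient (hk (k + 3) R x) y⟫ := by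
      rw [Q_eq hfl, ← integral_add (hw.gbc.inner hfl.gbc).integrable hfl.g2.integrable, ← integral_const_mul]
      refine integral_congr_ae ?_
      filter_upwards [hgr] with y hy
      rw [← real_inner_self_eq_norm_sq, ← inner_add_left, ← inner_smul_right]
      rw [hy]
      split_ifs
      · rw [add_sub_cancel, real_inner_comm]
      · simp
    have h5 : ∫ y, ⟪gradient f y, gradient (hk (k + 3) R x) y⟫ ≤ 2 * (k + 3) * (d * (R ^ 2) ^ (k + 2)) * ∫ y in ball x s, max (δ - w y) 0 := by
      rw [int_hk hfl k x hR0.le, mul_assoc (2 * (k + 3 : ℝ)) (d * _)]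
      refine mul_le_mul_of_nonneg_left ?_ (by positivity)
      rw [← integral_const_mul, ← integral_indicator measurableSet_ball]
      have hcw : Continuous (fun y => max (δ - w y) 0) := (continuous_const.sub hw.cont).max continuous_const
      refine integral_mono (Continuous.integrable_of_hasCompactSupport (hfl.cont.mul (by unfold hk; fun_prop)) hfl.2.mul_right)
        ((integrable_indicator_iff measurableSet_ball).mpr (((hcw.continuousOn.integrableOn_compact
          (isCompact_closedBall x s)).mono_set ball_subset_closedBall).const_mul _)) fun y => ?_
      have e : hk (k + 2) R x y = max (R ^ 2 - ‖y - x‖ ^ 2) 0 * hk (k + 1) R x y := by simp only [hk]; ring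
      have h7 : max (R ^ 2 - ‖y - x‖ ^ 2) 0 ≤ R ^ 2 := max_le (by nlinarith [sq_nonneg ‖y - x‖]) (sq_nonneg _)
      have h8 := hk_nonneg (k + 1) R x y
      have hd0 : (0:ℝ) ≤ d := Nat.cast_nonneg d
      by_cases hy : y ∈ ball x s
      · rw [indicator_of_mem hy, mul_comm]
        have h9 : (d * hk (k + 2) R x y - 2 * (k + 2) * (hk (k + 1) R x y * ‖y - x‖ ^ 2)) ≤ d * (R ^ 2) ^ (k + 2) := by
          have := mul_le_mul_of_nonneg_left (hk_le (k + 2) R x y) hd0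
          have : 0 ≤ 2 * (k + 2) * (hk (k + 1) R x y * ‖y - x‖ ^ 2) := by positivity
          linarith
        exact (mul_le_mul_of_nonneg_right h9 (f0 y)).trans (mul_le_mul_of_nonneg_left (hle y) (by positivity))
      · rw [indicator_of_notMem hy]
        rw [mem_ball, dist_eq_norm, not_lt] at hy
        refine mul_nonpos_of_nonneg_of_nonpos (f0 y) ?_
        have h9 : d * max (R ^ 2 - ‖y - x‖ ^ 2) 0 ≤ 2 * (k + 2) * ‖y - x‖ ^ 2 :=
          (mul_le_mul_of_nonneg_left h7 hd0).trans (hks.trans (mul_le_mul_of_nonneg_left (pow_le_pow_left₀ hs.le hy 2) (by positivity)))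
        rw [e]
        nlinarith [mul_le_mul_of_nonneg_right h9 h8]
    have h6 := mul_le_mul_of_nonneg_left h5 (show 0 ≤ 2 * κ by positivity)
    nlinarith
  · rw [Q_eq hfl]
    have hm : MeasurableSet ({y | w y = 0} ∩ (ball x r \ ball x s)) :=
      (hw.cont.measurable (measurableSet_singleton 0)).inter (measurableSet_ball.diff measurableSet_ball)
    have hfin : volume ({y | w y = 0} ∩ (ball x r \ ball x s)) ≠ ⊤ :=
      measure_ne_top_of_subset (inter_subset_right.trans sdiff_subset) measure_ball_lt_top.ne
    set c := (κ * (2 * (k + 3) * (R ^ 2 - r2 ^ 2) ^ (k + 2) * s)) ^ 2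
    have : c * mvol ({y | w y = 0} ∩ (ball x r \ ball x s)) = ∫ y in {y | w y = 0} ∩ (ball x r \ ball x s), c := by
      rw [setIntegral_const, smul_eq_mul, mul_comm]; rfl
    rw [this]
    obtain ⟨⟨K, hK⟩, -⟩ := id hw
    refine (setIntegral_mono_on_ae (integrableOn_const hfin) hfl.g2.integrable.integrableOn hm ?_).trans
      (setIntegral_le_integral hfl.g2.integrable (.of_forall fun y => sq_nonneg _))
    filter_upwards [hgr, grad_zero_ae hK 0] with y hy h0 ⟨hyw, hyr, hys⟩
    have hyw : w y = 0 := hyw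
    rw [mem_ball, dist_eq_norm] at hyr hys
    push Not at hys
    have hlt : ‖y - x‖ ^ 2 < r ^ 2 := pow_lt_pow_left₀ hyr (norm_nonneg _) two_ne_zero
    have hmx : max (R ^ 2 - ‖y - x‖ ^ 2) 0 = R ^ 2 - ‖y - x‖ ^ 2 := max_eq_left (by linarith)
    have h1 : (R ^ 2 - r ^ 2) ^ (k + 3) < hk (k + 3) R x y := by
      rw [hk, hmx]; exact pow_lt_pow_left₀ (by linarith) (by linarith) (by omega)
    rw [hy, hyw, h0 hyw, if_pos (by nlinarith [mul_lt_mul_of_pos_left h1 hκ0]), sub_zero, norm_smul, Real.norm_eq_abs, abs_of_pos hκ0]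
    refine pow_le_pow_left₀ (by positivity) (mul_le_mul_of_nonneg_left ?_ hκ0.le) 2
    have h2 := hk_inner (k + 1) R x y (y - x)
    rw [real_inner_self_eq_norm_sq] at h2
    have h3 : (R ^ 2 - r2 ^ 2) ^ (k + 2) ≤ hk (k + 2) R x y := by
      rw [hk, hmx]; exact pow_le_pow_left₀ hRr.le (by linarith) _
    have h4 := abs_real_inner_le_norm (gradient (hk (k + 1 + 2) R x) y) (y - x)
    rw [h2] at h4
    have h5 : 0 < ‖y - x‖ := hs.trans_le hys
    have h6 := hk_nonneg (k + 1 + 1) R x y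
    push_cast at h4
    rw [abs_mul, abs_mul, abs_mul, abs_of_nonneg h6, abs_of_nonneg (sq_nonneg ‖y - x‖),
      abs_of_nonneg (show (0:ℝ) ≤ k + 1 + 2 by positivity)] at h4
    have h7 : 2 * (k + 3) * hk (k + 2) R x y * ‖y - x‖ ≤ ‖gradient (hk (k + 3) R x) y‖ := by
      refine le_of_mul_le_mul_right (le_trans (le_of_eq ?_) h4) h5
      norm_num; ring
    refine le_trans ?_ h7
    gcongr
end

section
variable {D Ω : Set (Euc d)} {a lam : ℝ} {φ : ℕ → Euc d → ℝ} {u : Euc d → ℝ} {G : Euc d → Euc d}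

theorem Sol.l1_ball (S : Sol D Ω a lam φ u G) {x : Euc d} {s δ δ' ε : ℝ} (h : ∀ᵐ y, y ∈ ball x s → δ ≤ u y)
    (hδ : δ' + ε ≤ δ) (n : ℕ) {w : Euc d → ℝ} (hw : LC w) (hwφ : ∀ y, φ n y - ε ≤ w y) :
    ∫ y in ball x s, max (δ' - w y) 0 ≤ ∫ y, |φ n y - u y| := by
  have hi : Integrable (fun y => |φ n y - u y|) := ((S.lc n).bc.integrable.sub S.uint).abs
  have hcw : Continuous (fun y => max (δ' - w y) 0) := (continuous_const.sub hw.cont).max continuous_const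
  refine (setIntegral_mono_on_ae ((hcw.continuousOn.integrableOn_compact
    (isCompact_closedBall x s)).mono_set ball_subset_closedBall) hi.integrableOn measurableSet_ball ?_).trans
    (setIntegral_le_integral hi (.of_forall fun y => abs_nonneg _))
  filter_upwards [h] with y hy hyb
  refine max_le ?_ (abs_nonneg _)
  have := hy hyb
  have := hwφ y
  have := neg_abs_le (φ n y - u y)
  linarith

theorem PosAt.mono {x y : Euc d} {s δ t : ℝ} (h : ∀ᵐ z, z ∈ ball x s → δ ≤ u z) (ht : t + dist y x ≤ s) :
    ∀ᵐ z, z ∈ ball y t → δ ≤ u z := by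
  filter_upwards [h] with z hz hzt
  exact hz (ball_subset_ball' ht hzt)

theorem Sol.spread (S : Sol D Ω a lam φ u G) {x y : Euc d} {r2 : ℝ} (hb : ball x r2 ⊆ D) (hP : PosAt u x)
    (h0 : volume (ball x r2 \ Ω) = 0) (hy : ‖y - x‖ < r2) : PosAt u y := by
  obtain ⟨s', hs', δ, hδ, hu⟩ := hP
  have hr2 : 0 < r2 := (norm_nonneg _).trans_lt hy
  set s := min s' (r2 / 2)
  have hs : 0 < s := by positivity
  have hu := PosAt.mono (y := x) (t := s) hu (by rw [dist_self, add_zero]; exact min_le_left _ _)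
  obtain ⟨κ, k, c, C, g⟩ := gain x hs ((min_le_right s' (r2 / 2)).trans_lt (half_lt_self hr2)) hδ
  have hm := fun n => g.main r2 ⟨hr2.le, le_rfl⟩ (φ n) (S.lc n) (S.nn n)
  set f : ℕ → Euc d → ℝ := fun n => gF κ k (2 * r2) r2 x (φ n) with hf
  set v : Euc d → ℝ := gF κ k (2 * r2) r2 x u with hv
  have hfz : ∀ n z, z ∉ ball x r2 → f n z = 0 := fun n z hz => (hm n).2.1 z (by
    rw [mem_ball, dist_eq_norm] at hz; linarith)
  have h1 : ∀ n, Jf 0 (f n) ≤ Jf lam (φ n) + C * ∫ z, |φ n z - u z| := fun n => by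
    have hj : 0 ≤ Jf lam (fun z => φ n z + 1 * f n z) := by
      refine S.minJ _ ((S.lc n).add ((hm n).1.cmul 1)) (fun z hz => ?_) ?_
      · rw [S.off n z fun h => hz (S.hOD h), hfz n z fun h => hz (hb h)]; ring
      · have hsub : {z | φ n z + 1 * f n z ≠ 0} ⊆ Ω ∪ (ball x r2 \ Ω) := fun z hz => by
          by_contra hc
          rw [union_sdiff_self, mem_union, not_or] at hc
          exact hz (by rw [S.off n z hc.1, hfz n z hc.2]; ring)
        have hvol : volume (Ω ∪ (ball x r2 \ Ω)) = volume Ω :=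
          le_antisymm ((measure_union_le _ _).trans (by rw [h0, add_zero])) (measure_mono subset_union_left)
        refine (mvol_mono hsub (by rw [hvol]; exact S.finO)).trans (le_of_eq ?_)
        rw [mvol, hvol]; exact S.vol
    have h2 := (hm n).2.2.2.1 lam S.lam0
    have h3 := S.l1_ball hu (δ' := δ) (ε := 0) (by linarith) n (S.lc n) (fun z => by linarith)
    have h4 := mul_le_mul_of_nonneg_left h3 g.C0
    have h5 : Jf lam (fun z => φ n z + 1 * f n z) + Jf 0 (f n) ≤ _ := h2
    linarith
  have h2 : ∀ n, ∫ z, f n z ^ 2 ≤ (2 * r2) ^ 2 * Jf 0 (f n) := fun n => by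
    rw [Q_eq (hm n).1]
    refine FK (hm n).1 (by positivity) ?_
    have hsub : {z | f n z ≠ 0} ⊆ ball x r2 := fun z hz => by
      by_contra hc; exact hz (hfz n z hc)
    have := mvol_mono hsub measure_ball_lt_top.ne
    rw [mvol_ball S.hd _ hr2.le] at this
    rw [mvol_ball S.hd _ (by positivity), mul_pow]
    have h2d : (2:ℝ) ^ 1 ≤ 2 ^ d := pow_le_pow_right₀ (by norm_num) S.hd
    have := mul_le_mul_of_nonneg_right h2d (show 0 ≤ r2 ^ d * omg d by have := omg_pos (d := d); positivity)
    linarith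
  have hcc : Continuous (fun z => κ * hk (k + 3) (2 * r2) x z) := continuous_const.mul (hk_cont _ _ _)
  have hvm : AEStronglyMeasurable v volume :=
    (((hcc.aestronglyMeasurable.sub S.uint.1).sub aestronglyMeasurable_const)).sup aestronglyMeasurable_const
  have hvb : BC v := ((hk_lc (k := k + 3) (by omega) (by positivity : 0 ≤ 2 * r2) x).bc.of_le hvm κ fun z => by
    rw [Real.norm_eq_abs, Real.norm_eq_abs, abs_of_nonneg (le_max_right _ _), abs_of_nonneg (hk_nonneg _ _ _ _)]
    refine max_le ?_ (mul_nonneg g.κ0.le (hk_nonneg _ _ _ _))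
    have : 0 ≤ κ * ((2 * r2) ^ 2 - r2 ^ 2) ^ (k + 3) := mul_nonneg g.κ0.le (pow_nonneg (by nlinarith) _)
    linarith [S.unn z])
  have hd2 : ∀ n, Integrable (fun z => (φ n z - u z) ^ 2) := fun n => (((S.lc n).bc.memLp 2).sub S.umem).integrable_sq
  have h3 : ∀ n, ∫ z, v z ^ 2 ≤ 2 * ((2 * r2) ^ 2 * (Jf lam (φ n) + C * ∫ z, |φ n z - u z|)) + 2 * ∫ z, (φ n z - u z) ^ 2 := fun n => by
    have h4 := (h2 n).trans (mul_le_mul_of_nonneg_left (h1 n) (by positivity))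
    refine le_trans ?_ (add_le_add_left (mul_le_mul_of_nonneg_left h4 zero_le_two) _)
    rw [← integral_const_mul, ← integral_const_mul, ← integral_add ((hm n).1.bc.pow2.integrable.const_mul _) ((hd2 n).const_mul _)]
    refine integral_mono hvb.pow2.integrable (((hm n).1.bc.pow2.integrable.const_mul _).add ((hd2 n).const_mul _)) fun z => ?_
    have h5 : |v z - f n z| ≤ |φ n z - u z| := by
      simp only [hv, hf, gF]
      refine (abs_max_sub_max_le_abs _ _ _).trans (le_of_eq ?_)
      congr 1; ring
    have h6 := sq_le_sq.mpr h5
    beta_reduce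
    nlinarith [sq_nonneg (v z - f n z - f n z)]
  have h4 : ∫ z, v z ^ 2 ≤ 0 := by
    have hl : Tendsto (fun n => 2 * ((2 * r2) ^ 2 * (Jf lam (φ n) + C * ∫ z, |φ n z - u z|)) + 2 * ∫ z, (φ n z - u z) ^ 2) atTop
        (𝓝 (2 * ((2 * r2) ^ 2 * (0 + C * 0)) + 2 * 0)) :=
      (((S.J0.add (S.l1.const_mul C)).const_mul _).const_mul 2).add (S.conv.const_mul 2)
    have := ge_of_tendsto' hl h3
    simpa using this
  have h5 : (fun z => v z ^ 2) =ᵐ[volume] 0 := (integral_eq_zero_iff_of_nonneg (fun z => sq_nonneg _) hvb.pow2.integrable).mp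
    (le_antisymm h4 (integral_nonneg fun z => sq_nonneg _))
  set ρ := (r2 + ‖y - x‖) / 2 with hρ
  have hρ0 : 0 ≤ ρ := by positivity
  have hρ2 : ρ ^ 2 < r2 ^ 2 := pow_lt_pow_left₀ (by rw [hρ]; linarith) hρ0 two_ne_zero
  refine ⟨(r2 - ‖y - x‖) / 2, by linarith, κ * (((2 * r2) ^ 2 - ρ ^ 2) ^ (k + 3) - ((2 * r2) ^ 2 - r2 ^ 2) ^ (k + 3)),
    mul_pos g.κ0 (sub_pos.mpr (pow_lt_pow_left₀ (by linarith) (by nlinarith) (by omega))), ?_⟩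
  filter_upwards [h5] with z hz hzb
  have hz0 : v z = 0 := by simpa using hz
  have h6 := (le_max_left (κ * hk (k + 3) (2 * r2) x z - u z - κ * ((2 * r2) ^ 2 - r2 ^ 2) ^ (k + 3)) 0).trans_eq hz0
  have h7 : ‖z - x‖ ≤ ρ := by
    rw [mem_ball, dist_eq_norm] at hzb
    have : ‖z - x‖ ≤ ‖z - y‖ + ‖y - x‖ := by
      rw [show z - x = (z - y) + (y - x) by abel]; exact norm_add_le _ _
    rw [hρ]; linarith
  have h8 : ((2 * r2) ^ 2 - ρ ^ 2) ^ (k + 3) ≤ hk (k + 3) (2 * r2) x z :=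
    pow_le_pow_left₀ (by nlinarith) (le_max_of_le_left (by have := pow_le_pow_left₀ (norm_nonneg _) h7 2; linarith)) _
  have := mul_le_mul_of_nonneg_left h8 g.κ0.le
  linarith

theorem Sol.null (S : Sol D Ω a lam φ u G) {x : Euc d} {s δ : ℝ} (hδ : 0 < δ) (h : ∀ᵐ z, z ∈ ball x s → δ ≤ u z) :
    volume (ball x s \ Ω) = 0 := by
  refine measure_mono_null (t := {z | ¬ (z ∈ ball x s → δ ≤ u z)}) (fun z hz hc => ?_) (ae_iff.mp h)
  have := hc hz.1
  rw [S.uoff z hz.2] at this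
  linarith

theorem Sol.setup (S : Sol D Ω a lam φ u G) : ∃ x ∈ Ω, PosAt u x ∧ ∃ r > 0, ball x r ⊆ D ∧ 0 < mvol (ball x r \ Ω) := by
  set P := {x | x ∈ D ∧ PosAt u x} with hP
  have hPo : IsOpen P := by
    rw [Metric.isOpen_iff]
    rintro x ⟨hx, s, hs, δ, hδ, h⟩
    obtain ⟨ρ, hρ, hb⟩ := Metric.isOpen_iff.mp S.hD x hx
    refine ⟨min ρ (s / 2), by positivity, fun y hy => ⟨hb (ball_subset_ball (min_le_left _ _) hy), s / 2, by positivity, δ, hδ,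
      PosAt.mono h ?_⟩⟩
    have : dist y x < s / 2 := (mem_ball.mp hy).trans_le (min_le_right _ _)
    linarith
  obtain ⟨x1, hx1, hp1⟩ := S.start
  by_cases hcl : closure P ∩ D ⊆ P
  · exfalso
    have hsub := S.hDc.isPreconnected.subset_of_closure_inter_subset hPo (show (D ∩ P).Nonempty from ⟨x1, S.hOD hx1, S.hOD hx1, hp1⟩) hcl
    have hn : volume (D \ Ω) = 0 := by
      refine measure_null_of_locally_null _ fun x hx => ?_
      obtain ⟨s, hs, δ, hδ, h⟩ := (hsub hx.1).2
      refine ⟨ball x s ∩ (D \ Ω), inter_mem (mem_nhdsWithin_of_mem_nhds (ball_mem_nhds x hs)) self_mem_nhdsWithin, ?_⟩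
      exact measure_mono_null (show ball x s ∩ (D \ Ω) ⊆ ball x s \ Ω from fun z hz => ⟨hz.1, hz.2.2⟩) (S.null hδ h)
    have : volume D ≤ volume Ω := by
      rw [← union_sdiff_cancel S.hOD]
      exact (measure_union_le _ _).trans (by rw [hn, add_zero])
    have := ENNReal.toReal_mono S.finO this
    have h2 := S.haD
    rw [← S.vol] at h2
    exact absurd h2 (not_lt.mpr this)
  · obtain ⟨x0, ⟨hc, hx0D⟩, hx0⟩ := not_subset.mp hcl
    obtain ⟨ρ, hρ, hb⟩ := Metric.isOpen_iff.mp S.hD x0 hx0D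
    obtain ⟨x2, ⟨hx2D, s, hs, δ, hδ, hu⟩, hx2⟩ := Metric.mem_closure_iff.mp hc (ρ / 4) (by positivity)
    set t := min s (ρ / 4) with ht
    have ht0 : 0 < t := by positivity
    obtain ⟨x, hxb, hxO⟩ : ∃ x ∈ ball x2 t, x ∈ Ω := by
      by_contra hne
      push Not at hne
      have h1 := S.null hδ (PosAt.mono (y := x2) (t := t) hu (by rw [dist_self, add_zero]; exact min_le_left _ _))
      rw [sdiff_eq_left.mpr (disjoint_left.mpr hne)] at h1
      exact (measure_ball_pos volume x2 ht0).ne' h1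
    have hxx2 : dist x x2 < t := hxb
    have hd1 : dist x x0 < ρ / 2 := by
      have := dist_triangle x x2 x0
      rw [dist_comm x2 x0] at this
      have := min_le_right s (ρ / 4)
      linarith
    have hps : PosAt u x := ⟨s - dist x x2, by have := min_le_left s (ρ / 4); linarith, δ, hδ, PosAt.mono hu (by linarith)⟩
    have hbx : ball x (ρ / 2) ⊆ D := (ball_subset_ball' (by linarith)).trans hb
    refine ⟨x, hxO, hps, ρ / 2, by positivity, hbx, ?_⟩
    refine ENNReal.toReal_pos (fun h0 => hx0 ⟨hx0D, S.spread hbx hps h0 (by rwa [← dist_eq_norm, dist_comm])⟩)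
      (measure_ne_top_of_subset sdiff_subset measure_ball_lt_top.ne)
end

section
variable {D Ω : Set (Euc d)} {a lam : ℝ} {φ : ℕ → Euc d → ℝ} {u : Euc d → ℝ} {G : Euc d → Euc d}

theorem Sol.pen (S : Sol D Ω a lam φ u G) {x : Euc d} {r2 s δ : ℝ} (hb : ball x r2 ⊆ D)
    (h0 : 0 < mvol (ball x r2 \ Ω)) (hs : 0 < s) (hsr : s < r2) (hδ : 0 < δ) :
    ∃ c > 0, ∃ C ≥ 0, ∀ w, LC w → (∀ y, 0 ≤ w y) → (∀ y, y ∉ Ω → w y = 0) →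
      c * (a - mvol {y | w y ≠ 0}) ≤ Jf lam w + C * ∫ y in ball x s, max (δ - w y) 0 := by
  obtain ⟨κ, k, c0, C0, g⟩ := gain x hs hsr hδ
  have hr2 : 0 < r2 := hs.trans hsr
  have hc0 := g.c0
  have ha := S.ha
  refine ⟨c0 * min 1 (mvol (ball x r2 \ Ω) / a), by positivity, C0 + c0 / δ, by have := g.C0; positivity,
    fun w hw hnn hoff => ?_⟩
  set W := {y | w y ≠ 0} with hW
  set I := ∫ y in ball x s, max (δ - w y) 0 with hI
  have hWO : W ⊆ Ω := fun y hy => by by_contra hc; exact hy (hoff y hc)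
  have hWa : mvol W ≤ a := by rw [← S.vol]; exact mvol_mono hWO S.finO
  have hWf := hw.fin_ne
  have hfin : ∀ r, volume (W ∪ (univ ∩ ball x r)) ≠ ⊤ := fun r =>
    measure_union_ne_top hWf (measure_ne_top_of_subset inter_subset_right measure_ball_lt_top.ne)
  have hcw : Continuous (fun y => max (δ - w y) 0) := (continuous_const.sub hw.cont).max continuous_const
  have hIs : δ * mvol ({y | w y = 0} ∩ ball x s) ≤ I := by
    have hm : MeasurableSet ({y | w y = 0} ∩ ball x s) := (measurableSet_eq_fun hw.cont.measurable measurable_const).inter measurableSet_ball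
    have hint : IntegrableOn (fun y => max (δ - w y) 0) (ball x s) :=
      (hcw.continuousOn.integrableOn_compact (isCompact_closedBall x s)).mono_set ball_subset_closedBall
    have h1 : ∫ y in {y | w y = 0} ∩ ball x s, max (δ - w y) 0 = mvol ({y | w y = 0} ∩ ball x s) * δ := by
      rw [setIntegral_congr_fun (g := fun _ => δ) hm (fun y hy => by
        have : w y = 0 := hy.1
        simp [this, hδ.le]), setIntegral_const]; rfl
    rw [mul_comm, ← h1]
    exact setIntegral_mono_set hint (.of_forall fun y => le_max_right _ _) (.of_forall fun y hy => hy.2)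
  have key : ∀ r ∈ Icc 0 r2, mvol (W ∪ (univ ∩ ball x r)) ≤ a →
      c0 * (mvol (W ∪ (univ ∩ ball x r)) - mvol W) ≤ Jf lam w + (C0 + c0 / δ) * I := fun r hr hra => by
    obtain ⟨m1, m2, -, m4, m5⟩ := g.main r hr w hw hnn
    have m4 := m4 lam S.lam0
    have hj : 0 ≤ Jf lam (fun z => w z + 1 * gF κ k (2 * r2) r x w z) := by
      have hz : ∀ z, z ∉ W ∪ (univ ∩ ball x r) → w z + 1 * gF κ k (2 * r2) r x w z = 0 := fun z hz => by
        rw [univ_inter, mem_union, not_or, mem_ball, dist_eq_norm, not_lt] at hz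
        rw [m2 z hz.2, not_not.mp hz.1]; ring
      refine S.minJ _ (hw.add (m1.cmul 1)) (fun z hzD => hz z ?_) ((mvol_mono (fun z hzz => ?_) (hfin r)).trans hra)
      · rintro (h | h)
        · exact hzD (S.hOD (hWO h))
        · exact hzD (hb (ball_subset_ball hr.2 h.2))
      · by_contra hc; exact hzz (hz z hc)
    have hv : mvol (W ∪ (univ ∩ ball x r)) ≤ mvol W + (mvol ({y | w y = 0} ∩ (ball x r \ ball x s)) + mvol ({y | w y = 0} ∩ ball x s)) := by
      have hsub : W ∪ (univ ∩ ball x r) ⊆ W ∪ (({y | w y = 0} ∩ (ball x r \ ball x s)) ∪ ({y | w y = 0} ∩ ball x s)) := by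
        rintro z (hz | hz)
        · exact Or.inl hz
        · by_cases h1 : w z = 0
          · by_cases h2 : z ∈ ball x s
            · exact Or.inr (Or.inr ⟨h1, h2⟩)
            · exact Or.inr (Or.inl ⟨h1, hz.2, h2⟩)
          · exact Or.inl h1
      have f1 : volume ({y | w y = 0} ∩ (ball x r \ ball x s)) ≠ ⊤ :=
        measure_ne_top_of_subset (inter_subset_right.trans sdiff_subset) (measure_ball_lt_top (x := x) (r := r)).ne
      have f2 : volume ({y | w y = 0} ∩ ball x s) ≠ ⊤ := measure_ne_top_of_subset inter_subset_right measure_ball_lt_top.ne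
      have hle := (measure_mono (μ := volume) hsub).trans ((measure_union_le _ _).trans (add_le_add_right (measure_union_le _ _) _))
      have := ENNReal.toReal_mono (ENNReal.add_ne_top.mpr ⟨hWf, ENNReal.add_ne_top.mpr ⟨f1, f2⟩⟩) hle
      rwa [ENNReal.toReal_add hWf (ENNReal.add_ne_top.mpr ⟨f1, f2⟩), ENNReal.toReal_add f1 f2] at this
    have e1 : c0 * mvol ({y | w y = 0} ∩ ball x s) ≤ c0 / δ * I := by
      rw [div_mul_eq_mul_div, le_div_iff₀ hδ]
      nlinarith
    nlinarith [mul_le_mul_of_nonneg_left hv hc0.le]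
  have hmin := min_le_left 1 (mvol (ball x r2 \ Ω) / a)
  by_cases hc : a ≤ mvol (W ∪ (univ ∩ ball x r2))
  · obtain ⟨r, hr, hra⟩ := ivt_vol S.hd hWf x hr2.le hWa hc
    have := key r hr hra.le
    rw [hra] at this
    refine le_trans ?_ this
    rw [mul_assoc]
    refine mul_le_mul_of_nonneg_left ?_ hc0.le
    nlinarith
  · push Not at hc
    refine le_trans ?_ (key r2 ⟨hr2.le, le_rfl⟩ hc.le)
    rw [mul_assoc]
    refine mul_le_mul_of_nonneg_left ?_ hc0.le
    have h1 : mvol W + mvol (ball x r2 \ Ω) ≤ mvol (W ∪ (univ ∩ ball x r2)) := by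
      have hdis : Disjoint W (ball x r2 \ Ω) := disjoint_left.mpr fun z hz hz2 => hz2.2 (hWO hz)
      have f1 : volume (ball x r2 \ Ω) ≠ ⊤ := measure_ne_top_of_subset sdiff_subset measure_ball_lt_top.ne
      rw [mvol, mvol, ← ENNReal.toReal_add hWf f1, ← measure_union hdis (measurableSet_ball.diff S.hO.measurableSet)]
      exact mvol_mono (union_subset_union_right _ fun z hz => ⟨mem_univ _, hz.1⟩) (hfin r2)
    have h2 := min_le_right 1 (mvol (ball x r2 \ Ω) / a)
    have h3 : mvol (ball x r2 \ Ω) / a * (a - mvol W) ≤ mvol (ball x r2 \ Ω) := by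
      rw [div_mul_eq_mul_div, div_le_iff₀ ha]
      have := mvol_nonneg W
      nlinarith
    nlinarith

/-- penalization at a good point of `Ω`, on arbitrarily small balls. -/
theorem Sol.pen' (S : Sol D Ω a lam φ u G) : ∃ x ∈ Ω, ∃ s0 > 0, ∃ δ > 0, (∀ᵐ y, y ∈ ball x s0 → 2 * δ ≤ u y) ∧
    ∀ s, 0 < s → s ≤ s0 → ∃ c > 0, ∃ C ≥ 0, ∀ w, LC w → (∀ y, 0 ≤ w y) → (∀ y, y ∉ Ω → w y = 0) →
      c * (a - mvol {y | w y ≠ 0}) ≤ Jf lam w + C * ∫ y in ball x s, max (δ - w y) 0 := by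
  obtain ⟨x, hx, ⟨s, hs, δ, hδ, h⟩, r, hr, hb, h0⟩ := S.setup
  refine ⟨x, hx, min s (r / 2), by positivity, δ / 2, by positivity, ?_, fun t ht ht2 =>
    S.pen hb h0 ht (by have := min_le_right s (r / 2); linarith) (by positivity)⟩
  filter_upwards [h] with y hy hyb
  linarith [hy (ball_subset_ball (min_le_left _ _) hyb)]

theorem Sol.decay (S : Sol D Ω a lam φ u G) : ∃ c > 0, ∃ C ≥ 0, ∃ ε0 > 0, ∀ ε, 0 ≤ ε → ε ≤ ε0 → ∀ n,
    (∫ y in {y | φ n y < ε}, ‖gradient (φ n) y‖ ^ 2) + c * mvol (Ω ∩ {y | φ n y ≤ ε}) ≤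
      Jf lam (φ n) + 2 * lam * ε * (a + 1) + C * ∫ y, |φ n y - u y| := by
  obtain ⟨x, hx, s0, hs0, δ, hδ, hu, hp⟩ := S.pen'
  obtain ⟨c, hc, C, hC, hp⟩ := hp s0 hs0 le_rfl
  refine ⟨c, hc, C, hC, δ, hδ, fun ε hε hε2 n => ?_⟩
  have hw := (S.lc n).posl hε
  have h1 := hp _ hw (fun y => le_max_right _ _) (fun y hy => by rw [S.off n y hy]; exact max_eq_right (by linarith))
  have h2 := Jf_posl_le (S.lc n) S.lam0 hε (S.nn n)
  have h3 := mul_le_mul_of_nonneg_left (S.intphi n) (show 0 ≤ 2 * lam * ε by have := S.lam0; positivity)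
  have h4 := mul_le_mul_of_nonneg_left (S.l1_ball hu (δ' := δ) (ε := ε) (by linarith) n hw (fun y => le_max_left _ _)) hC
  have h5 : mvol (Ω ∩ {y | φ n y ≤ ε}) ≤ a - mvol {y | max (φ n y - ε) 0 ≠ 0} := by
    have hdis : Disjoint (Ω ∩ {y | φ n y ≤ ε}) {y | max (φ n y - ε) 0 ≠ 0} := disjoint_left.mpr fun z hz hz2 =>
      hz2 (max_eq_right (by have : φ n z ≤ ε := hz.2; linarith))
    have hsub : (Ω ∩ {y | φ n y ≤ ε}) ∪ {y | max (φ n y - ε) 0 ≠ 0} ⊆ Ω := union_subset inter_subset_left fun z hz => by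
      by_contra hcc; exact hz (by rw [S.off n z hcc]; exact max_eq_right (by linarith))
    have := mvol_mono hsub S.finO
    rw [S.vol, mvol, measure_union hdis hw.meas_ne, ENNReal.toReal_add (measure_ne_top_of_subset inter_subset_left S.finO) hw.fin_ne] at this
    change mvol _ + mvol _ ≤ a at this
    linarith
  nlinarith [mul_le_mul_of_nonneg_left h5 hc.le]
end

section
variable {D Ω : Set (Euc d)} {a lam : ℝ} {φ : ℕ → Euc d → ℝ} {u : Euc d → ℝ} {G : Euc d → Euc d}

theorem Sol.core (S : Sol D Ω a lam φ u G) {f : Euc d → ℝ} (hf : LC f) {L : ℝ} (hL : ∀ x, ‖gradient f x‖ ≤ L) (e : Euc d)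
    {ε : ℝ} (hε : 0 < ε) (n : ℕ) : |∫ y in Ω, ⟪gradient f y, e⟫| ≤
      ‖e‖ * (L * mvol (Ω ∩ {y | φ n y ≤ ε}) + (1 / ε) * ∫ y in {y | φ n y < ε}, |f y| * ‖gradient (φ n) y‖) := by
  have hp := S.lc n
  have hL0 : 0 ≤ L := (norm_nonneg _).trans (hL 0)
  set A := Ω ∩ {y | φ n y ≤ ε} with hA
  have hmA : MeasurableSet A := S.hO.measurableSet.inter (measurableSet_le hp.cont.measurable measurable_const)
  have hmB : MeasurableSet {y | φ n y < ε} := measurableSet_lt hp.cont.measurable measurable_const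
  have hAf : volume A ≠ ⊤ := measure_ne_top_of_subset inter_subset_left S.finO
  have hq := hp.posl hε.le
  set g : Euc d → ℝ := fun y => φ n y - max (φ n y - ε) 0 with hg
  have hgl : LC g := hp.sub hq
  have hgv : ∀ y, g y = min (φ n y) ε := fun y => by
    rcases le_total (φ n y) ε with h | h
    · simp only [hg]; rw [min_eq_left h, max_eq_right (by linarith), sub_zero]
    · simp only [hg]; rw [min_eq_right h, max_eq_left (by linarith)]; ring
  have hib := ibp hgl.1.choose_spec hf e
  have hgg : ∀ᵐ y, gradient g y = ({y | φ n y < ε}).indicator (gradient (φ n)) y := by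
    filter_upwards [hp.diff, hq.diff, grad_zero_ae hp.1.choose_spec ε] with y h1 h2 h3
    rw [hg, grad_sub h1 h2, grad_pos (f := fun y => φ n y - ε) (hp.cont.sub continuous_const)]
    by_cases h4 : φ n y < ε
    · rw [indicator_of_mem (show y ∈ {y | φ n y < ε} from h4), if_neg (by linarith), sub_zero]
    · rw [indicator_of_notMem (show y ∉ {y | φ n y < ε} from h4)]
      split_ifs with h5
      · rw [show gradient (fun y => φ n y - ε) y = gradient (φ n) y by
          unfold gradient; rw [fderiv_sub_const], sub_self]
      · rw [h3 (by linarith), sub_zero]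
  have hI1 : |∫ y, f y * ⟪gradient g y, e⟫| ≤ ‖e‖ * ∫ y in {y | φ n y < ε}, |f y| * ‖gradient (φ n) y‖ := by
    rw [← integral_indicator hmB, ← integral_const_mul]
    refine (abs_integral_le_integral_abs).trans (integral_mono_ae (hf.bc.mul (hgl.gbc.innerc e)).abs.integrable
      (((hf.bc.abs.mul hp.gbc.norm).ind hmB).const_mul _).integrable ?_)
    filter_upwards [hgg] with y hy
    rw [hy]
    by_cases h4 : y ∈ {y | φ n y < ε}
    · rw [indicator_of_mem h4, indicator_of_mem h4, abs_mul]
      have := abs_real_inner_le_norm (gradient (φ n) y) e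
      nlinarith [mul_le_mul_of_nonneg_left this (abs_nonneg (f y))]
    · rw [indicator_of_notMem h4, indicator_of_notMem h4]; simp
  have hI2 : |∫ y, (Ω.indicator (fun y => ε * ⟪gradient f y, e⟫) y - g y * ⟪gradient f y, e⟫)| ≤ ε * (‖e‖ * (L * mvol A)) := by
    have hb : ∀ y, |Ω.indicator (fun y => ε * ⟪gradient f y, e⟫) y - g y * ⟪gradient f y, e⟫| ≤ A.indicator (fun _ => ε * (‖e‖ * L)) y := fun y => by
      by_cases hy : y ∈ Ω
      · rw [indicator_of_mem hy, ← sub_mul, abs_mul, hgv]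
        by_cases hy2 : φ n y ≤ ε
        · rw [indicator_of_mem (show y ∈ A from ⟨hy, hy2⟩), min_eq_left hy2, abs_of_nonneg (by linarith)]
          have h1 := abs_real_inner_le_norm (gradient f y) e
          have h2 := mul_le_mul_of_nonneg_right (hL y) (norm_nonneg e)
          have h3 := S.nn n y
          exact mul_le_mul (by linarith) (by linarith) (abs_nonneg _) hε.le
        · rw [indicator_of_notMem (show y ∉ A from fun h => hy2 h.2), min_eq_right (by linarith)]; simp
      · rw [indicator_of_notMem hy, hgv, S.off n y hy, min_eq_left hε.le, indicator_of_notMem (show y ∉ A from fun h => hy h.1)]; simp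
    refine (abs_integral_le_integral_abs).trans ((integral_mono ((((hf.gbc.innerc e).const_mul ε).ind S.hO.measurableSet).sub
      (hgl.bc.mul (hf.gbc.innerc e))).abs.integrable ((integrable_indicator_iff hmA).mpr (integrableOn_const hAf)) hb).trans ?_)
    rw [integral_indicator hmA, setIntegral_const]
    refine le_of_eq ?_
    change mvol A * _ = _
    ring
  rw [integral_sub (((hf.gbc.innerc e).const_mul ε).ind S.hO.measurableSet).integrable (hgl.bc.mul (hf.gbc.innerc e)).integrable,
    integral_indicator S.hO.measurableSet, integral_const_mul, ← neg_eq_iff_eq_neg.mpr hib] at hI2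
  rw [show (∫ y, ⟪gradient g y, e⟫ * f y) = ∫ y, f y * ⟪gradient g y, e⟫ from integral_congr_ae (.of_forall fun y => mul_comm _ _)] at hI2
  set X := ∫ y in Ω, ⟪gradient f y, e⟫
  set Y := ∫ y, f y * ⟪gradient g y, e⟫
  set Z := ∫ y in {y | φ n y < ε}, |f y| * ‖gradient (φ n) y‖
  have h6 : ε * |X| ≤ ε * (‖e‖ * (L * mvol A)) + ‖e‖ * Z := by
    rw [← abs_of_pos hε, ← abs_mul, abs_of_pos hε]
    have := abs_sub_abs_le_abs_sub (ε * X) (-Y)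
    rw [abs_neg] at this
    linarith
  rw [show ‖e‖ * (L * mvol A + 1 / ε * Z) = (ε * (‖e‖ * (L * mvol A)) + ‖e‖ * Z) / ε by field_simp, le_div_iff₀ hε]
  linarith

theorem Sol.decay' (S : Sol D Ω a lam φ u G) : ∃ M > 0, ∃ ε0 > 0, ∀ ε, 0 < ε → ε ≤ ε0 → ∀ᶠ n in atTop,
    (∫ y in {y | φ n y < ε}, ‖gradient (φ n) y‖ ^ 2) ≤ M * ε ∧ mvol (Ω ∩ {y | φ n y ≤ ε}) ≤ M * ε := by
  obtain ⟨c, hc, C, hC, ε0, hε0, h⟩ := S.decay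
  have hl := S.lam0
  have ha := S.ha
  set K := 2 * lam * (a + 1) + 1 with hK
  have hK0 : 0 < K := by positivity
  refine ⟨K * (1 + 1 / c), by positivity, ε0, hε0, fun ε hε hε2 => ?_⟩
  have ht := S.J0.add (S.l1.const_mul C)
  rw [mul_zero, add_zero] at ht
  filter_upwards [ht.eventually (gt_mem_nhds hε)] with n hn
  have h1 := h ε hε.le hε2 n
  have h2 : 0 ≤ ∫ y in {y | φ n y < ε}, ‖gradient (φ n) y‖ ^ 2 := integral_nonneg fun _ => by positivity
  have h3 := mvol_nonneg (Ω ∩ {y | φ n y ≤ ε})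
  have h4 : 0 ≤ K * (1 / c) * ε := by positivity
  have h5 : 2 * lam * ε * (a + 1) + ε = K * ε := by rw [hK]; ring
  have h6 := mul_nonneg hc.le h3
  constructor
  · nlinarith
  · have h7 : mvol (Ω ∩ {y | φ n y ≤ ε}) ≤ K * ε / c := by rw [le_div_iff₀ hc]; nlinarith
    have h8 : K * (1 + 1 / c) * ε = K * ε + K * ε / c := by ring
    have : 0 < K * ε := by positivity
    linarith

/-- densities approximating the perimeter measure -/
theorem Sol.dens (S : Sol D Ω a lam φ u G) : ∃ M > 0, ∃ ρ : ℕ → Euc d → ℝ, (∀ k, BC (ρ k)) ∧ (∀ k y, 0 ≤ ρ k y) ∧ (∀ k, ∫ y, ρ k y ≤ M) ∧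
    ∀ f, LC f → ∀ e, ∃ E : ℕ → ℝ, Tendsto E atTop (𝓝 0) ∧ ∀ k, |∫ y in Ω, ⟪gradient f y, e⟫| ≤ E k + ‖e‖ * ∫ y, |f y| * ρ k y := by
  obtain ⟨M, hM, ε0, hε0, h⟩ := S.decay'
  have hε : ∀ k : ℕ, 0 < ε0 / (k + 1) := fun k => by positivity
  have hε' : ∀ k : ℕ, ε0 / (k + 1) ≤ ε0 := fun k => div_le_self hε0.le (by linarith [Nat.cast_nonneg (α := ℝ) k])
  choose N hN1 hN2 using fun k : ℕ => (h _ (hε k) (hε' k)).exists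
  set ε : ℕ → ℝ := fun k => ε0 / (k + 1) with hεd
  set B : ℕ → Set (Euc d) := fun k => Ω ∩ {y | φ (N k) y < ε k} with hB
  have hmB : ∀ k, MeasurableSet (B k) := fun k => S.hO.measurableSet.inter (measurableSet_lt (S.lc _).cont.measurable measurable_const)
  have hBf : ∀ k, volume (B k) ≠ ⊤ := fun k => measure_ne_top_of_subset inter_subset_left S.finO
  have hgz : ∀ k y, y ∉ Ω → gradient (φ (N k)) y = 0 := fun k y hy => grad_zero_of_notMem fun hc => hy (S.sup _ hc)
  have h1bc : ∀ k, BC ((B k).indicator fun _ => (1:ℝ)) := fun k => by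
    refine ⟨aestronglyMeasurable_const.indicator (hmB k), ⟨1, fun y => ?_⟩, ?_⟩
    · by_cases hy : y ∈ B k <;> simp [hy]
    · obtain ⟨R, hR⟩ := S.hDb.subset_closedBall 0
      exact ⟨R, fun y hy => indicator_of_notMem (fun hc => by
        have := hR (S.hOD hc.1); rw [mem_closedBall_zero_iff] at this; linarith) _⟩
  have hbc : ∀ k, BC (fun y => (1 / (2 * ε k)) * ((B k).indicator (fun y => ‖gradient (φ (N k)) y‖ ^ 2) y + (B k).indicator (fun _ => (1:ℝ)) y)) :=
    fun k => (((S.lc _).g2.ind (hmB k)).add (h1bc k)).const_mul _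
  refine ⟨M, hM, _, hbc, fun k y => ?_, fun k => ?_, fun f hf e => ?_⟩
  · have := hε k
    exact mul_nonneg (by positivity) (add_nonneg (indicator_nonneg (fun _ _ => by positivity) _) (indicator_nonneg (fun _ _ => by positivity) _))
  · have hk := hε k
    rw [integral_const_mul, integral_add ((S.lc _).g2.ind (hmB k)).integrable (h1bc k).integrable, integral_indicator (hmB k),
      integral_indicator (hmB k), setIntegral_const]
    have e1 : ∫ y in B k, ‖gradient (φ (N k)) y‖ ^ 2 ≤ M * ε k := (setIntegral_mono_set (S.lc _).g2.integrable.integrableOn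
      (.of_forall fun y => by positivity) (.of_forall fun y hy => hy.2)).trans (hN1 k)
    have e2 : mvol (B k) ≤ M * ε k := (mvol_mono (show B k ⊆ Ω ∩ {y | φ (N k) y ≤ ε k} from fun y hy => ⟨hy.1, (show φ (N k) y < ε k from hy.2).le⟩) (measure_ne_top_of_subset inter_subset_left S.finO)).trans (hN2 k)
    rw [smul_eq_mul, mul_one, div_mul_eq_mul_div, one_mul, div_le_iff₀ (by positivity)]
    change _ + mvol (B k) ≤ _
    linarith
  · obtain ⟨L, hL⟩ := hf.gbc.bd
    have hL0 : 0 ≤ L := (norm_nonneg _).trans (hL 0)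
    refine ⟨fun k => ‖e‖ * (L * (M * ε k)), ?_, fun k => ?_⟩
    · have : Tendsto ε atTop (𝓝 0) := by
        simpa [hεd, div_eq_mul_inv] using (tendsto_one_div_add_atTop_nhds_zero_nat (𝕜 := ℝ)).const_mul ε0
      simpa using ((this.const_mul M).const_mul L).const_mul ‖e‖
    · refine (S.core hf hL e (hε k) (N k)).trans ?_
      rw [← mul_add]
      refine mul_le_mul_of_nonneg_left (add_le_add (mul_le_mul_of_nonneg_left (hN2 k) hL0) ?_) (norm_nonneg _)
      have hm2 : MeasurableSet {y | φ (N k) y < ε k} := measurableSet_lt (S.lc _).cont.measurable measurable_const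
      rw [← integral_indicator hm2, ← integral_const_mul]
      refine integral_mono (((hf.bc.abs.mul (S.lc _).gbc.norm).ind hm2).const_mul _).integrable (hf.bc.abs.mul (hbc k)).integrable fun y => ?_
      beta_reduce
      have hk := hε k
      by_cases hy : y ∈ B k
      · rw [indicator_of_mem hy.2, indicator_of_mem hy, indicator_of_mem hy]
        change 1 / ε k * _ ≤ _
        rw [show |f y| * (1 / (2 * ε k) * (‖gradient (φ (N k)) y‖ ^ 2 + 1)) = 1 / ε k * (|f y| * ((‖gradient (φ (N k)) y‖ ^ 2 + 1) / 2)) by ring]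
        refine mul_le_mul_of_nonneg_left ?_ (by positivity)
        nlinarith [sq_nonneg (‖gradient (φ (N k)) y‖ - 1), abs_nonneg (f y)]
      · have : ({y | φ (N k) y < ε k}.indicator (fun y => |f y| * ‖gradient (φ (N k)) y‖) y) = 0 := by
          by_cases hy2 : y ∈ Ω
          · exact indicator_of_notMem (fun hc => hy ⟨hy2, hc⟩) _
          · rw [indicator_apply_eq_zero]; intro _; rw [hgz k y hy2]; simp
        rw [this, indicator_of_notMem hy, indicator_of_notMem hy]; simp
end

section
/-- cutoff function -/
def cut (x : Euc d) (ρ δ : ℝ) (y : Euc d) : ℝ := max (min ((ρ + δ - ‖y - x‖) / δ) 1) 0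

theorem cut_nonneg (x : Euc d) (ρ δ : ℝ) (y : Euc d) : 0 ≤ cut x ρ δ y := le_max_right _ _

theorem cut_le_one (x : Euc d) (ρ δ : ℝ) (y : Euc d) : cut x ρ δ y ≤ 1 := max_le (min_le_right _ _) zero_le_one

theorem cut_one {x : Euc d} {ρ δ : ℝ} (hδ : 0 < δ) {y : Euc d} (h : ‖y - x‖ ≤ ρ) : cut x ρ δ y = 1 := by
  rw [cut, min_eq_right (by rw [le_div_iff₀ hδ]; linarith), max_eq_left zero_le_one]

theorem cut_zero {x : Euc d} {ρ δ : ℝ} (hδ : 0 < δ) {y : Euc d} (h : ρ + δ ≤ ‖y - x‖) : cut x ρ δ y = 0 :=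
  max_eq_right ((min_le_left _ _).trans (div_nonpos_of_nonpos_of_nonneg (by linarith) hδ.le))

theorem cut_lip (x : Euc d) (ρ : ℝ) {δ : ℝ} (hδ : 0 < δ) : LipschitzWith (Real.toNNReal (1 / δ)) (cut x ρ δ) := by
  have h : LipschitzWith (Real.toNNReal (1 / δ)) (fun y => (ρ + δ - ‖y - x‖) / δ) := by
    refine LipschitzWith.of_dist_le_mul fun y z => ?_
    rw [Real.coe_toNNReal _ (by positivity), Real.dist_eq, ← sub_div, abs_div, abs_of_pos hδ, div_mul_eq_mul_div, one_mul]
    refine div_le_div_of_nonneg_right ?_ hδ.le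
    rw [show ρ + δ - ‖y - x‖ - (ρ + δ - ‖z - x‖) = ‖z - x‖ - ‖y - x‖ by ring, dist_comm, dist_eq_norm]
    refine (abs_norm_sub_norm_le _ _).trans (le_of_eq ?_)
    congr 1; abel
  exact (h.min_const 1).max_const 0

theorem cut_lc (x : Euc d) (ρ : ℝ) {δ : ℝ} (hδ : 0 < δ) : LC (cut x ρ δ) :=
  ⟨⟨_, cut_lip x ρ hδ⟩, HasCompactSupport.intro (isCompact_closedBall x (ρ + δ)) fun y hy => cut_zero hδ (by
    rw [mem_closedBall, dist_eq_norm, not_le] at hy; exact hy.le)⟩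

theorem cut_grad (x : Euc d) (ρ : ℝ) {δ : ℝ} (hδ : 0 < δ) (y : Euc d) : ‖gradient (cut x ρ δ) y‖ ≤ 1 / δ := by
  have := grad_bound (cut_lip x ρ hδ) y
  rwa [Real.coe_toNNReal _ (by positivity)] at this

open CompactlySupported in
theorem ultra_meas {M : ℝ} {ρ : ℕ → Euc d → ℝ} (hb : ∀ k, BC (ρ k)) (h0 : ∀ k y, 0 ≤ ρ k y) (h1 : ∀ k, ∫ y, ρ k y ≤ M) :
    ∃ σ : Measure (Euc d), IsFiniteMeasure σ ∧ ∀ f : Euc d → ℝ, Continuous f → HasCompactSupport f →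
      Tendsto (fun k => ∫ y, f y * ρ k y) (hyperfilter ℕ : Filter ℕ) (𝓝 (∫ y, f y ∂σ)) := by
  have hint : ∀ (f : C_c(Euc d, ℝ)) k, Integrable (fun y => f y * ρ k y) := fun f k => by
    obtain ⟨C, hC⟩ := f.hasCompactSupport.exists_bound_of_continuous f.continuous
    exact (hb k).integrable.bdd_mul f.continuous.aestronglyMeasurable (.of_forall hC)
  have hbd : ∀ (f : C_c(Euc d, ℝ)) C, (∀ y, ‖f y‖ ≤ C) → ∀ k, |∫ y, f y * ρ k y| ≤ C * M := fun f C hC k => by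
    have hC0 : 0 ≤ C := (norm_nonneg _).trans (hC 0)
    refine abs_integral_le_integral_abs.trans ((integral_mono (hint f k).abs ((hb k).integrable.const_mul C) fun y => ?_).trans
      (by rw [integral_const_mul]; exact mul_le_mul_of_nonneg_left (h1 k) hC0))
    beta_reduce
    rw [abs_mul, abs_of_nonneg (h0 k y)]
    exact mul_le_mul_of_nonneg_right (hC y) (h0 k y)
  have hex : ∀ f : C_c(Euc d, ℝ), ∃ l, Tendsto (fun k => ∫ y, f y * ρ k y) (hyperfilter ℕ : Filter ℕ) (𝓝 l) := fun f => by
    obtain ⟨C, hC⟩ := f.hasCompactSupport.exists_bound_of_continuous f.continuous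
    obtain ⟨l, -, hl⟩ := (isCompact_Icc (a := -(C * M)) (b := C * M)).ultrafilter_le_nhds ((hyperfilter ℕ).map fun k => ∫ y, f y * ρ k y)
      (le_principal_iff.mpr (Filter.mem_map.mpr (univ_mem' fun k => abs_le.mp (hbd f C hC k))))
    exact ⟨l, hl⟩
  choose Λ0 hΛ0 using hex
  let Λ1 : C_c(Euc d, ℝ) →ₗ[ℝ] ℝ :=
    { toFun := Λ0
      map_add' := fun f g => tendsto_nhds_unique (hΛ0 (f + g)) (by
        refine ((hΛ0 f).add (hΛ0 g)).congr fun k => ?_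
        rw [← integral_add (hint f k) (hint g k)]
        refine integral_congr_ae (.of_forall fun y => ?_)
        simp [add_mul])
      map_smul' := fun c f => tendsto_nhds_unique (hΛ0 (c • f)) (by
        refine ((hΛ0 f).const_mul c).congr fun k => ?_
        rw [← integral_const_mul]
        refine integral_congr_ae (.of_forall fun y => ?_)
        simp [mul_assoc]) }
  let Λ : C_c(Euc d, ℝ) →ₚ[ℝ] ℝ := PositiveLinearMap.mk₀ Λ1 fun f hf => ge_of_tendsto' (hΛ0 f) fun k =>
    integral_nonneg fun y => mul_nonneg (hf y) (h0 k y)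
  refine ⟨RealRMK.rieszMeasure Λ, ⟨?_⟩, fun f hf hfc => ?_⟩
  · refine lt_of_le_of_lt (b := ENNReal.ofReal M) ?_ ENNReal.ofReal_lt_top
    have hu : (univ : Set (Euc d)) = ⋃ n : ℕ, closedBall 0 n := (iUnion_closedBall_nat 0).symm
    have hmono : Monotone fun n : ℕ => closedBall (0 : Euc d) n := fun m n h => closedBall_subset_closedBall (by exact_mod_cast h)
    rw [hu, hmono.measure_iUnion]
    refine iSup_le fun n => ?_
    let g : C_c(Euc d, ℝ) := ⟨⟨cut 0 n 1, (cut_lc 0 n one_pos).cont⟩, (cut_lc 0 n one_pos).2⟩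
    refine (RealRMK.rieszMeasure_le_of_eq_one Λ (f := g) (fun y => cut_nonneg _ _ _ _) (isCompact_closedBall _ _) fun y hy =>
      cut_one one_pos (by rwa [mem_closedBall, dist_eq_norm] at hy)).trans (ENNReal.ofReal_le_ofReal ?_)
    refine le_of_tendsto' (hΛ0 g) fun k => (le_abs_self _).trans ((hbd g 1 (fun y => ?_) k).trans_eq (one_mul M))
    change ‖cut 0 n 1 y‖ ≤ 1
    rw [Real.norm_eq_abs, abs_of_nonneg (cut_nonneg _ _ _ _)]
    exact cut_le_one _ _ _ _
  · have := RealRMK.integral_rieszMeasure Λ ⟨⟨f, hf⟩, hfc⟩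
    have h2 := hΛ0 ⟨⟨f, hf⟩, hfc⟩
    change ∫ y, f y ∂(RealRMK.rieszMeasure Λ) = Λ0 _ at this
    rw [this]
    exact h2

structure Per (E : Set (Euc d)) (ν : Euc d → Euc d) (σ : Measure (Euc d)) : Prop where
  mE : MeasurableSet E
  fin : IsFiniteMeasure σ
  mν : Measurable ν
  νle : ∀ x, ‖ν x‖ ≤ 1
  ν1 : ∀ᵐ x ∂σ, ‖ν x‖ = 1
  eq : ∀ f, LC f → ∀ e, ∫ y in E, ⟪gradient f y, e⟫ = ∫ y, f y * ⟪ν y, e⟫ ∂σ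

theorem LC.memLps {f : Euc d → ℝ} (hf : LC f) (p : ℝ≥0∞) (σ : Measure (Euc d)) [IsFiniteMeasure σ] : MemLp f p σ := by
  obtain ⟨C, hC⟩ := hf.bc.bd
  exact MemLp.of_bound hf.cont.aestronglyMeasurable C (.of_forall hC)

theorem riesz_rep {E : Set (Euc d)} (σ : Measure (Euc d)) [IsFiniteMeasure σ] (e : Euc d)
    (h : ∀ f, LC f → |∫ y in E, ⟪gradient f y, e⟫| ≤ ‖e‖ * ∫ y, |f y| ∂σ) :
    ∃ n : Euc d → ℝ, Measurable n ∧ MemLp n 2 σ ∧ ∀ f, LC f → ∫ y in E, ⟪gradient f y, e⟫ = ∫ y, f y * n y ∂σ := by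
  let V : Submodule ℝ (Euc d → ℝ) :=
    { carrier := {f | LC f}
      add_mem' := fun {f g} hf hg => hf.add hg
      zero_mem' := ⟨⟨0, LipschitzWith.const 0⟩, HasCompactSupport.zero⟩
      smul_mem' := fun c f hf => hf.cmul c }
  let T : V →ₗ[ℝ] Lp ℝ 2 σ :=
    { toFun := fun f => (f.2.memLps 2 σ).toLp f.1
      map_add' := fun f g => rfl
      map_smul' := fun c f => rfl }
  have hgi : ∀ f : V, Integrable (fun y => ⟪gradient f.1 y, e⟫) (volume.restrict E) := fun f => (f.2.gbc.innerc e).integrable.integrableOn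
  let L : V →ₗ[ℝ] ℝ :=
    { toFun := fun f => ∫ y in E, ⟪gradient f.1 y, e⟫
      map_add' := fun f g => by
        rw [← integral_add (hgi f) (hgi g)]
        refine integral_congr_ae (ae_restrict_of_ae ?_)
        filter_upwards [f.2.diff, g.2.diff] with y h1 h2
        rw [← inner_add_left, ← grad_add h1 h2]; rfl
      map_smul' := fun c f => by
        rw [RingHom.id_apply, smul_eq_mul, ← integral_const_mul]
        refine integral_congr_ae (ae_restrict_of_ae ?_)
        filter_upwards [f.2.diff] with y h1
        rw [← real_inner_smul_left, ← grad_cmul c h1]; rfl }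
  set C := ‖e‖ * √(σ.real univ) with hC
  have hbd : ∀ f : V, |L f| ≤ C * ‖T f‖ := fun f => by
    refine (h f.1 f.2).trans ?_
    rw [hC, mul_assoc]
    refine mul_le_mul_of_nonneg_left ?_ (norm_nonneg _)
    have hm := f.2.memLps 2 σ
    have h1 := int_cs (μ := σ) (f := fun y => |f.1 y|) (g := fun _ => 1) (by simpa using hm.integrable_sq) (by simp)
      (by simpa using (hm.integrable (by norm_num)).abs)
    have h2 := norm_toLp_sq hm
    simp only [sq_abs, mul_one, one_pow, integral_const, smul_eq_mul] at h1
    simp only [Real.norm_eq_abs, sq_abs] at h2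
    refine abs_le_of_sq_le_sq' ?_ (by positivity) |>.2
    rw [mul_pow, Real.sq_sqrt (by positivity)]
    change _ ≤ _ * ‖hm.toLp f.1‖ ^ 2
    rw [h2, mul_comm]; exact h1
  have : Module.Free ℝ (LinearMap.range T) := Module.Free.of_divisionRing ℝ _
  have : Module.Projective ℝ (LinearMap.range T) := Module.Projective.of_free
  obtain ⟨g, hg⟩ := T.rangeRestrict.exists_rightInverse_of_surjective T.range_rangeRestrict
  have hg' : ∀ y, T (g y) = y := fun y => congrArg Subtype.val (LinearMap.congr_fun hg y)
  let L' : LinearMap.range T →L[ℝ] ℝ := (L.comp g).mkContinuous C fun y => by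
    have := hbd (g y); rw [hg' y] at this; exact this
  obtain ⟨ℓ, hℓ, -⟩ := exists_extension_norm_eq (LinearMap.range T) L'
  set n := (InnerProductSpace.toDual ℝ (Lp ℝ 2 σ)).symm ℓ with hn
  refine ⟨n, (Lp.stronglyMeasurable n).measurable, Lp.memLp n, fun f hf => ?_⟩
  have h1 := hℓ (T.rangeRestrict ⟨f, hf⟩)
  have h2 : L' (T.rangeRestrict ⟨f, hf⟩) = L ⟨f, hf⟩ := by
    change L (g (T.rangeRestrict ⟨f, hf⟩)) = _
    rw [← sub_eq_zero, ← map_sub, ← abs_eq_zero]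
    refine le_antisymm ((hbd _).trans (le_of_eq ?_)) (abs_nonneg _)
    rw [map_sub, hg']; simp
  rw [h2, ← InnerProductSpace.toDual_symm_apply (𝕜 := ℝ), L2.inner_def] at h1
  change _ = ∫ y in E, ⟪gradient f y, e⟫ at h1
  rw [← h1]
  refine integral_congr_ae ?_
  filter_upwards [(hf.memLps 2 σ).coeFn_toLp] with y hy
  change ⟪n y, (MemLp.toLp f (hf.memLps 2 σ) : Euc d → ℝ) y⟫ = _
  rw [hy]; rfl
end

section
variable {D Ω : Set (Euc d)} {a lam : ℝ} {φ : ℕ → Euc d → ℝ} {u : Euc d → ℝ} {G : Euc d → Euc d}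

theorem per_of_bound {E : Set (Euc d)} (hE : MeasurableSet E) (σ : Measure (Euc d)) [IsFiniteMeasure σ]
    (h : ∀ f, LC f → ∀ e, |∫ y in E, ⟪gradient f y, e⟫| ≤ ‖e‖ * ∫ y, |f y| ∂σ) : ∃ ν σ', Per E ν σ' := by
  choose n hn1 hn2 hn3 using fun i : Fin d => riesz_rep σ (EuclideanSpace.single i (1:ℝ)) fun f hf => h f hf _
  set N : Euc d → Euc d := fun x => WithLp.toLp 2 fun i => n i x with hN
  have hNm : Measurable N := (PiLp.continuous_toLp 2 _).measurable.comp (measurable_pi_lambda _ hn1)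
  have hNe : ∀ y e, ⟪N y, e⟫ = ∑ i, e i * n i y := fun y e => by
    rw [PiLp.inner_apply]; rfl
  have heq : ∀ f, LC f → ∀ e, ∫ y in E, ⟪gradient f y, e⟫ = ∫ y, f y * ⟪N y, e⟫ ∂σ := fun f hf e => by
    have e1 : ∀ y, ⟪gradient f y, e⟫ = ∑ i, e i * ⟪gradient f y, EuclideanSpace.single i (1:ℝ)⟫ := fun y => by
      rw [PiLp.inner_apply]
      refine Finset.sum_congr rfl fun i _ => ?_
      rw [EuclideanSpace.inner_single_right]; simp
    have hi : ∀ i, Integrable (fun y => f y * n i y) σ := fun i => (hf.memLps 2 σ).integrable_mul (hn2 i)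
    simp_rw [e1, hNe]
    rw [integral_finsetSum _ fun i _ => ((hf.gbc.innerc _).integrable.integrableOn.const_mul _)]
    simp_rw [integral_const_mul, hn3 _ f hf, Finset.mul_sum]
    rw [integral_finsetSum]
    · refine Finset.sum_congr rfl fun i _ => ?_
      rw [← integral_const_mul]
      exact integral_congr_ae (.of_forall fun y => by ring)
    · intro i _
      refine ((hi i).const_mul (e i)).congr (.of_forall fun y => by ring)
  have hNi : Integrable N σ := by
    refine Integrable.mono' (g := fun y => ∑ i, ‖n i y‖) (integrable_finsetSum _ fun i _ => ((hn2 i).integrable (by norm_num)).norm)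
      hNm.aestronglyMeasurable (.of_forall fun y => ?_)
    have : N y = ∑ i, EuclideanSpace.single i (n i y) := by
      ext j; simp [hN]
    rw [this]
    refine (norm_sum_le _ _).trans (Finset.sum_le_sum fun i _ => by simp)
  have hwm : Measurable fun y => ‖N y‖₊ := hNm.nnnorm
  refine ⟨fun y => ‖N y‖⁻¹ • N y, σ.withDensity fun y => ‖N y‖₊, hE, ?_, hNm.norm.inv.smul hNm, fun y => ?_, ?_, fun f hf e => ?_⟩
  · exact isFiniteMeasure_withDensity hNi.2.ne
  · rw [norm_smul, norm_inv, norm_norm]; exact inv_mul_le_one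
  · rw [ae_withDensity_iff (by fun_prop)]
    refine .of_forall fun y hy => ?_
    rw [norm_smul, norm_inv, norm_norm]
    exact inv_mul_cancel₀ (by simpa using hy)
  · rw [heq f hf e, integral_withDensity_eq_integral_smul hwm]
    refine integral_congr_ae (.of_forall fun y => ?_)
    beta_reduce
    rw [real_inner_smul_left, NNReal.smul_def, coe_nnnorm, smul_eq_mul]
    by_cases hy : N y = 0
    · simp [hy]
    · field_simp [norm_ne_zero_iff.mpr hy]

theorem Sol.exists_per (S : Sol D Ω a lam φ u G) : ∃ ν σ, Per Ω ν σ := by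
  obtain ⟨M, -, ρ, hb, h0, h1, h⟩ := S.dens
  obtain ⟨σ, hσ, hl⟩ := ultra_meas hb h0 h1
  refine per_of_bound S.hO.measurableSet σ fun f hf e => ?_
  obtain ⟨E, hE, hle⟩ := h f hf e
  have ht := (hE.mono_left Nat.hyperfilter_le_atTop).add ((hl (fun y => |f y|) hf.cont.abs (hf.2.comp_left abs_zero)).const_mul ‖e‖)
  rw [zero_add] at ht
  exact ge_of_tendsto' ht hle

theorem Per.inner_int {E : Set (Euc d)} {ν : Euc d → Euc d} {σ : Measure (Euc d)} (P : Per E ν σ) (e : Euc d) : Integrable (fun y => ⟪ν y, e⟫) σ := by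
  have := P.fin
  exact Integrable.of_bound (P.mν.inner measurable_const).aestronglyMeasurable ‖e‖ (.of_forall fun y =>
    (abs_real_inner_le_norm _ _).trans (mul_le_of_le_one_left (norm_nonneg _) (P.νle y)))

theorem Per.finper {E : Set (Euc d)} {ν : Euc d → Euc d} {σ : Measure (Euc d)} (P : Per E ν σ) (D : Set (Euc d)) : HasLocFinPerimeterIn D E := by
  have := P.fin
  refine fun K _ _ => ⟨d * σ.real univ, fun Φ hΦ hb => ?_⟩
  have hlc : ∀ i, LC (fun y => Φ y i) := fun i => smooth_LC ((PiLp.proj (𝕜 := ℝ) 2 (fun _ : Fin d => ℝ) i).contDiff.comp hΦ.1) (hΦ.2.1.comp_left (g := fun v : Euc d => v i) rfl)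
  have hdf : Differentiable ℝ Φ := hΦ.1.differentiable (by simp)
  have e1 : ∀ y, divg Φ y = ∑ i, ⟪gradient (fun y => Φ y i) y, EuclideanSpace.single i (1:ℝ)⟫ := fun y => by
    refine Finset.sum_congr rfl fun i _ => ?_
    rw [inner_grad]
    have := ((PiLp.proj (𝕜 := ℝ) 2 (fun _ : Fin d => ℝ) i).hasFDerivAt.comp y (hdf y).hasFDerivAt).fderiv
    change fderiv ℝ (fun y => Φ y i) y = _ at this
    rw [this]; rfl
  simp_rw [e1]
  rw [integral_finsetSum _ fun i _ => ((hlc i).gbc.innerc _).integrable.integrableOn]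
  have e2 : ∀ i : Fin d, ∫ y in E, ⟪gradient (fun y => Φ y i) y, EuclideanSpace.single i (1:ℝ)⟫ ≤ σ.real univ := fun i => by
    rw [P.eq _ (hlc i)]
    refine (le_abs_self _).trans ?_
    have := norm_integral_le_of_norm_le_const (μ := σ) (f := fun y => Φ y i * ⟪ν y, EuclideanSpace.single i (1:ℝ)⟫) (C := 1) (.of_forall fun y => by
      rw [norm_mul]
      refine mul_le_one₀ ((PiLp.norm_apply_le _ i).trans (hb y)) (norm_nonneg _) ((norm_inner_le_norm _ _).trans ?_)
      simpa using P.νle y)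
    rwa [one_mul] at this
  refine (Finset.sum_le_sum fun i _ => e2 i).trans ?_
  simp
end

section
variable {D Ω : Set (Euc d)} {a lam : ℝ} {φ : ℕ → Euc d → ℝ} {u : Euc d → ℝ} {G : Euc d → Euc d}

theorem FG (n b j : ℕ) (hj : 1 ≤ j) {κ0 C : ℝ} (hκ : 0 < κ0) (hC : 0 < C) : ∃ κ > 0, ∀ (F : ℝ → ℝ) (R : ℝ), 0 < R → (∀ r, 0 ≤ F r) → Monotone F →
    (∀ r h t, 0 < h → 0 < t → t ≤ R → r ≤ R → R / 2 ≤ r - h → F r ≤ κ0 * (t ^ n * h ^ b) → F (r - h) ≤ C * (t / h) ^ j * F r) →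
    F R ≤ κ * R ^ (n + b) → F (R / 2) = 0 := by
  set q : ℝ := (1 / 2) ^ (n + b) with hq
  have hq0 : 0 < q := by positivity
  set τ : ℝ := min (1 / 4) (q / (8 * C)) with hτ
  have hτ0 : 0 < τ := by positivity
  refine ⟨κ0 * (τ ^ n * (1 / 4) ^ b), by positivity, fun F R hR h0 hm hs hFR => ?_⟩
  have key : ∀ k : ℕ, F (R / 2 * (1 + (1 / 2) ^ k)) ≤ κ0 * (τ ^ n * (1 / 4) ^ b) * R ^ (n + b) * q ^ k * (1 / 2) ^ k := by
    intro k
    induction k with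
    | zero => rw [show R / 2 * (1 + (1/2:ℝ)^0) = R by ring]; simpa using hFR
    | succ k ih =>
      have e1 : ((1:ℝ) / 2) ^ k ≤ 1 := pow_le_one₀ (by norm_num) (by norm_num)
      have e0 : 0 < ((1:ℝ) / 2) ^ k := by positivity
      have e2 := hs (R / 2 * (1 + (1 / 2) ^ k)) (R / 4 * (1 / 2) ^ k) (τ * R * (1 / 2) ^ k) (by positivity) (by positivity)
        (by
          have h1 : τ ≤ 1 := (min_le_left _ _).trans (by norm_num)
          have h2 : τ * R ≤ R := mul_le_of_le_one_left hR.le h1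
          exact (mul_le_of_le_one_right (by positivity) e1).trans h2) (by nlinarith) (by nlinarith) (by
          refine (ih.trans (mul_le_of_le_one_right (by positivity) e1)).trans (le_of_eq ?_)
          rw [hq, mul_pow, mul_pow, mul_pow, div_eq_mul_one_div R 4, mul_pow, pow_add, pow_add, mul_pow, ← pow_mul, ← pow_mul, ← pow_mul, ← pow_mul]
          rw [mul_comm n k, mul_comm b k]; ring)
      have e3 : R / 2 * (1 + (1 / 2) ^ k) - R / 4 * (1 / 2) ^ k = R / 2 * (1 + (1 / 2) ^ (k + 1)) := by ring
      have e4 : τ * R * (1 / 2) ^ k / (R / 4 * (1 / 2) ^ k) = 4 * τ := by field_simp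
      rw [e3, e4] at e2
      have h4 : 4 * τ ≤ 1 := by have := min_le_left (1 / 4) (q / (8 * C)); linarith
      have h5 : C * (4 * τ) ^ j ≤ q * (1 / 2) := by
        have h6 : (4 * τ) ^ j ≤ (4 * τ) ^ 1 := pow_le_pow_of_le_one (by positivity) h4 hj
        have h7 : τ ≤ q / (8 * C) := min_le_right _ _
        rw [le_div_iff₀ (by positivity)] at h7
        nlinarith
      refine e2.trans ((mul_le_mul h5 ih (h0 _) (by positivity)).trans (le_of_eq ?_))
      ring
  refine le_antisymm ?_ (h0 _)
  have hl : Tendsto (fun k : ℕ => κ0 * (τ ^ n * (1 / 4) ^ b) * R ^ (n + b) * ((1:ℝ) / 2) ^ k) atTop (𝓝 0) := by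
    simpa using (tendsto_pow_atTop_nhds_zero_of_lt_one (by norm_num : (0:ℝ) ≤ 1 / 2) (by norm_num)).const_mul (κ0 * (τ ^ n * (1 / 4) ^ b) * R ^ (n + b))
  refine ge_of_tendsto' hl fun k => (hm ?_).trans ((key k).trans ?_)
  · have : (0:ℝ) ≤ R / 2 * (1 / 2) ^ k := by positivity
    linarith
  · refine mul_le_mul_of_nonneg_right (mul_le_of_le_one_right (by positivity) (pow_le_one₀ hq0.le ?_)) (by positivity)
    exact pow_le_one₀ (by norm_num) (by norm_num)

theorem Sol.A2lim (S : Sol D Ω a lam φ u G) (A : Set (Euc d)) : Tendsto (fun n => ∫ y in A, φ n y ^ 2) atTop (𝓝 (∫ y in A, u y ^ 2)) := by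
  rw [tendsto_iff_dist_tendsto_zero]
  have hp : ∀ n, MemLp (φ n) 2 := fun n => (S.lc n).bc.memLp 2
  have hi : ∀ n, Integrable (fun y => (φ n y - u y) ^ 2) := fun n => ((hp n).sub S.umem).integrable_sq
  have hi2 : ∀ n, Integrable (fun y => (φ n y + u y) ^ 2) := fun n => ((hp n).add S.umem).integrable_sq
  have hu := S.umem.integrable_sq
  have hb : ∀ n, dist (∫ y in A, φ n y ^ 2) (∫ y in A, u y ^ 2) ≤ √((∫ y, (φ n y - u y) ^ 2) * (2 * 1 + 2 * ∫ y, u y ^ 2)) := fun n => by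
    rw [Real.dist_eq, ← integral_sub (hp n).integrable_sq.integrableOn hu.integrableOn]
    refine Real.abs_le_sqrt ?_
    have e1 : ∫ y in A, (φ n y ^ 2 - u y ^ 2) = ∫ y in A, (φ n y - u y) * (φ n y + u y) := integral_congr_ae (.of_forall fun y => by ring)
    rw [e1]
    refine (int_cs (hi n).integrableOn (hi2 n).integrableOn (((hp n).sub S.umem).integrable_mul ((hp n).add S.umem)).integrableOn).trans ?_
    refine mul_le_mul (setIntegral_le_integral (hi n) (.of_forall fun y => sq_nonneg _)) ((setIntegral_le_integral (hi2 n) (.of_forall fun y => sq_nonneg _)).trans ?_)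
      (integral_nonneg fun y => sq_nonneg _) (integral_nonneg fun y => sq_nonneg _)
    rw [← S.one n, ← integral_const_mul, ← integral_const_mul, ← integral_add ((hp n).integrable_sq.const_mul 2) (hu.const_mul 2)]
    refine integral_mono (hi2 n) (((hp n).integrable_sq.const_mul 2).add (hu.const_mul 2)) fun y => ?_
    beta_reduce
    nlinarith [sq_nonneg (φ n y - u y)]
  refine squeeze_zero (fun n => dist_nonneg) hb ?_
  have := (S.conv.mul_const (2 * 1 + 2 * ∫ y, u y ^ 2)).sqrt
  simpa using this

theorem J_mul {f η : Euc d → ℝ} {K : ℝ≥0} (hf : LC f) (hη : LipschitzWith K η) (lam : ℝ) :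
    Jf lam (fun y => f y * η y) = (∫ y, f y ^ 2 * ‖gradient η y‖ ^ 2) + Bf lam f (fun y => f y * η y * η y) := by
  have h1 := hf.mulLip hη
  have h2 := h1.mulLip hη
  have hb : BC (fun y => f y ^ 2 * ‖gradient η y‖ ^ 2) := hf.bc.pow2.mulB ((meas_grad η).norm.pow_const 2).aestronglyMeasurable
    ⟨(K:ℝ) ^ 2, fun y => by rw [abs_of_nonneg (by positivity)]; exact pow_le_pow_left₀ (norm_nonneg _) (grad_bound hη y) 2⟩
  rw [Jf, Bf, ← integral_add hb.integrable (hf.bbc h2 lam).integrable]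
  refine integral_congr_ae ?_
  filter_upwards [hf.diff, hη.ae_differentiableAt, h1.diff] with y d1 d2 d3
  rw [grad_mul (f := fun y => f y * η y) d3 d2, grad_mul d1 d2, ← real_inner_self_eq_norm_sq, ← real_inner_self_eq_norm_sq]
  simp only [inner_add_left, inner_add_right, real_inner_smul_left, real_inner_smul_right, smul_add]
  rw [real_inner_comm (gradient f y) (gradient η y)]
  ring

theorem Sol.cac (S : Sol D Ω a lam φ u G) {η : Euc d → ℝ} {K : ℝ≥0} (hη : LipschitzWith K η) (h0 : ∀ y, |η y| ≤ 1) {A : Set (Euc d)}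
    (hA : MeasurableSet A) (hgA : ∀ y, y ∉ A → gradient η y = 0) {δ : ℝ} (hδ : 0 < δ) :
    ∀ᶠ n in atTop, Jf lam (fun y => φ n y * η y) ≤ K ^ 2 * (∫ y in A, u y ^ 2) + δ := by
  have h1 := fun n => (S.lc n).mulLip hη
  have h2 := fun n => (h1 n).mulLip hη
  have hB := S.B0 (m := fun n y => φ n y * η y * η y) (C := 2 * (lam + 1) + 8 * K ^ 2) h2 (fun n x hx => by rw [S.off n x hx]; ring) (by
    filter_upwards [S.Q_ev] with n hn
    rw [Q_eq (S.lc n)] at hn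
    rw [Q_eq (h2 n)]
    have e1 : 2 * (∫ y, ‖gradient (φ n) y‖ ^ 2) + 8 * K ^ 2 * ∫ y, φ n y ^ 2 ≤ 2 * (lam + 1) + 8 * K ^ 2 := by rw [S.one n]; linarith
    refine le_trans ?_ e1
    rw [← integral_const_mul, ← integral_const_mul, ← integral_add ((S.lc n).g2.const_mul 2).integrable ((S.lc n).bc.pow2.const_mul _).integrable]
    refine integral_mono_ae (h2 n).g2.integrable (((S.lc n).g2.const_mul 2).add ((S.lc n).bc.pow2.const_mul _)).integrable ?_
    filter_upwards [(S.lc n).diff, hη.ae_differentiableAt, (h1 n).diff] with y d1 d2 d3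
    rw [grad_mul (f := fun y => φ n y * η y) d3 d2, grad_mul d1 d2]
    have e2 : (φ n y * η y) • gradient η y + η y • (φ n y • gradient η y + η y • gradient (φ n) y) =
      (η y * η y) • gradient (φ n) y + (2 * η y * φ n y) • gradient η y := by module
    rw [e2]
    have e3 := norm_add_le ((η y * η y) • gradient (φ n) y) ((2 * η y * φ n y) • gradient η y)
    have e4 : ‖(η y * η y) • gradient (φ n) y‖ ≤ ‖gradient (φ n) y‖ := by
      rw [norm_smul, norm_mul]
      exact mul_le_of_le_one_left (norm_nonneg _) (mul_le_one₀ (h0 y) (norm_nonneg _) (h0 y))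
    have e5 : ‖(2 * η y * φ n y) • gradient η y‖ ≤ 2 * φ n y * K := by
      rw [norm_smul, norm_mul, norm_mul, Real.norm_eq_abs, Real.norm_eq_abs, Real.norm_eq_abs, abs_two, abs_of_nonneg (S.nn n y)]
      have := S.nn n y
      exact mul_le_mul (mul_le_mul_of_nonneg_right (by linarith [h0 y]) this) (grad_bound hη y) (norm_nonneg _) (by positivity)
    have e6 := pow_le_pow_left₀ (norm_nonneg _) (e3.trans (add_le_add e4 e5)) 2
    nlinarith [sq_nonneg (‖gradient (φ n) y‖ - 2 * φ n y * K)]) (half_pos hδ)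
  have hl := (S.A2lim A).const_mul ((K:ℝ) ^ 2)
  filter_upwards [hB, hl.eventually (gt_mem_nhds (lt_add_of_pos_right _ (half_pos hδ)))] with n hn1 hn2
  rw [J_mul (S.lc n) hη]
  have e1 : ∫ y, φ n y ^ 2 * ‖gradient η y‖ ^ 2 ≤ K ^ 2 * ∫ y in A, φ n y ^ 2 := by
    rw [← integral_const_mul, ← integral_indicator hA]
    refine integral_mono_of_nonneg (.of_forall fun y => by positivity) (((S.lc n).bc.pow2.const_mul _).ind hA).integrable (.of_forall fun y => ?_)
    beta_reduce
    by_cases hy : y ∈ A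
    · rw [indicator_of_mem hy, mul_comm]
      exact mul_le_mul_of_nonneg_right (pow_le_pow_left₀ (norm_nonneg _) (grad_bound hη y) 2) (sq_nonneg _)
    · rw [indicator_of_notMem hy, hgA y hy]; simp
  have := (abs_le.mp hn1).2
  linarith
end

section
variable {D Ω : Set (Euc d)} {a lam : ℝ} {φ : ℕ → Euc d → ℝ} {u : Euc d → ℝ} {G : Euc d → Euc d}

theorem grad_const_ev {f : Euc d → ℝ} {c : ℝ} {y : Euc d} (h : f =ᶠ[𝓝 y] fun _ => c) : gradient f y = 0 := by
  rw [gradient, h.fderiv_eq]; simp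

theorem cut_ev (x : Euc d) {ρ δ : ℝ} (hδ : 0 < δ) {y : Euc d} (hy : y ∉ closedBall x (ρ + δ)) : cut x ρ δ =ᶠ[𝓝 y] fun _ => 0 := by
  filter_upwards [isClosed_closedBall.isOpen_compl.mem_nhds hy] with z hz
  refine cut_zero hδ ?_
  rw [mem_compl_iff, mem_closedBall, dist_eq_norm, not_le] at hz
  exact hz.le

theorem Sol.nd1 (S : Sol D Ω a lam φ u G) {x : Euc d} (hx : x ∉ Ω) : ∃ c > 0, ∃ r0 > 0, ∀ s r, s < r → r ≤ r0 →
    c * mvol (Ω ∩ closedBall x s) ≤ (1 / (r - s)) ^ 2 * ∫ y in closedBall x r, u y ^ 2 := by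
  obtain ⟨xs, hxs, s0, hs0, δ, hδ, hu, h⟩ := S.pen'
  have hdist : 0 < dist xs x := dist_pos.mpr fun h => hx (h ▸ hxs)
  set s' := min s0 (dist xs x / 2) with hs'
  obtain ⟨c, hc, C, hC, hp⟩ := h s' (by positivity) (min_le_left _ _)
  refine ⟨c, hc, dist xs x / 2, by positivity, fun s r hsr hr => ?_⟩
  have hδ' : 0 < r - s := sub_pos.mpr hsr
  have hl : LipschitzWith (Real.toNNReal (1 / (r - s))) (fun y => 1 - cut x s (r - s) y) := by
    refine LipschitzWith.of_dist_le_mul fun y z => ?_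
    rw [Real.dist_eq, show 1 - cut x s (r - s) y - (1 - cut x s (r - s) z) = -(cut x s (r - s) y - cut x s (r - s) z) by ring, abs_neg, ← Real.dist_eq]
    exact (cut_lip x s hδ').dist_le_mul y z
  have hbd : ∀ y, |1 - cut x s (r - s) y| ≤ 1 := fun y => by
    rw [abs_le]; constructor <;> linarith [cut_nonneg x s (r - s) y, cut_le_one x s (r - s) y]
  have hcac := fun {ε : ℝ} (hε : 0 < ε) => S.cac hl hbd (A := closedBall x r) measurableSet_closedBall (fun y hy => by
    refine grad_const_ev (c := 1) ?_
    filter_upwards [cut_ev x (ρ := s) hδ' (y := y) (by rwa [add_sub_cancel])] with z hz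
    rw [hz, sub_zero]) hε
  rw [Real.coe_toNNReal _ (by positivity)] at hcac
  refine le_of_forall_pos_le_add fun ε hε => ?_
  have hl1 := S.l1.const_mul C
  rw [mul_zero] at hl1
  obtain ⟨n, hn1, hn2⟩ := ((hcac (half_pos hε)).and (hl1.eventually (gt_mem_nhds (half_pos hε)))).exists
  have hw := (S.lc n).mulLip hl
  have h1 := hp _ hw (fun y => mul_nonneg (S.nn n y) (by linarith [cut_le_one x s (r - s) y])) (fun y hy => by rw [S.off n y hy, zero_mul])
  have h2 : ∫ y in ball xs s', max (δ - φ n y * (1 - cut x s (r - s) y)) 0 ≤ ∫ y, |φ n y - u y| := by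
    refine le_trans (le_of_eq (setIntegral_congr_fun measurableSet_ball fun y hy => ?_)) (S.l1_ball (x := xs) (s := s') (δ := 2 * δ) (δ' := δ) (ε := 0) ?_ (by linarith) n (S.lc n) fun y => by linarith)
    · beta_reduce
      rw [cut_zero hδ', sub_zero, mul_one]
      rw [mem_ball] at hy
      have := dist_triangle xs y x
      rw [dist_comm xs y] at this
      have := min_le_right s0 (dist xs x / 2)
      rw [← dist_eq_norm]; linarith
    · filter_upwards [hu] with y hy hyb
      exact hy (ball_subset_ball (min_le_left _ _) hyb)
  have h3 : mvol {y | φ n y * (1 - cut x s (r - s) y) ≠ 0} + mvol (Ω ∩ closedBall x s) ≤ a := by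
    rw [← S.vol, mvol, mvol, mvol, ← ENNReal.toReal_add hw.fin_ne (measure_ne_top_of_subset inter_subset_left S.finO), ← measure_union _ (S.hO.measurableSet.inter measurableSet_closedBall)]
    · refine ENNReal.toReal_mono S.finO (measure_mono (union_subset (fun y hy => ?_) inter_subset_left))
      by_contra hc
      exact hy (by rw [S.off n y hc, zero_mul])
    · rw [disjoint_left]
      intro y hy hy2
      refine hy ?_
      have := hy2.2
      rw [mem_closedBall, dist_eq_norm] at this
      rw [cut_one hδ' this]; ring
  have h4 := mul_le_mul_of_nonneg_left h2 hC
  have h5 := mul_le_mul_of_nonneg_left (show mvol (Ω ∩ closedBall x s) ≤ a - mvol {y | φ n y * (1 - cut x s (r - s) y) ≠ 0} by linarith) hc.le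
  linarith

theorem Sol.nd2 (S : Sol D Ω a lam φ u G) (x : Euc d) {s r t : ℝ} (hsr : s < r) (ht : 0 < t) (hV : 2 * mvol (Ω ∩ closedBall x r) ≤ t ^ d * omg d)
    (hl : lam * t ^ 2 ≤ 1 / 2) : ∫ y in closedBall x s, u y ^ 2 ≤ 2 * (t / (r - s)) ^ 2 * ∫ y in closedBall x r, u y ^ 2 := by
  have hδ' : 0 < r - s := sub_pos.mpr hsr
  have hcac := fun {ε : ℝ} (hε : 0 < ε) => S.cac (cut_lip x s hδ') (fun y => abs_le.mpr ⟨by linarith [cut_nonneg x s (r - s) y], cut_le_one _ _ _ _⟩)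
    (A := closedBall x r) measurableSet_closedBall (fun y hy => grad_const_ev (cut_ev x (ρ := s) hδ' (y := y) (by rwa [add_sub_cancel]))) hε
  rw [Real.coe_toNNReal _ (by positivity)] at hcac
  refine le_of_forall_pos_le_add fun ε hε => ?_
  have hε' : 0 < ε / (2 * t ^ 2) := by positivity
  refine le_of_tendsto (S.A2lim (closedBall x s)) ?_
  filter_upwards [hcac hε'] with n hn
  have hf := (S.lc n).mulLip (cut_lip x s hδ')
  have h1 := FK hf ht (by
    rw [mvol_ball S.hd 0 ht.le]
    refine le_trans (mul_le_mul_of_nonneg_left (mvol_mono (show {y | φ n y * cut x s (r - s) y ≠ 0} ⊆ Ω ∩ closedBall x r from fun y hy => ⟨?_, ?_⟩)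
      (measure_ne_top_of_subset inter_subset_left S.finO)) zero_le_two) hV
    · by_contra hc
      exact hy (by rw [S.off n y hc, zero_mul])
    · by_contra hc
      refine hy ?_
      rw [mem_closedBall, dist_eq_norm, not_le] at hc
      rw [cut_zero hδ' (by linarith), mul_zero])
  have h2 : ∫ y in closedBall x s, φ n y ^ 2 ≤ ∫ y, (φ n y * cut x s (r - s) y) ^ 2 := by
    refine le_trans (le_of_eq (setIntegral_congr_fun measurableSet_closedBall fun y hy => ?_)) (setIntegral_le_integral hf.bc.pow2.integrable (.of_forall fun y => sq_nonneg _))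
    beta_reduce
    rw [mem_closedBall, dist_eq_norm] at hy
    rw [cut_one hδ' hy, mul_one]
  have h3 := Jf_eq hf lam
  rw [← Q_eq hf] at h1
  have h4 : Jf lam (fun y => φ n y * cut x s (r - s) y) = Jf 0 (fun y => φ n y * cut x s (r - s) y) - lam * ∫ y, (φ n y * cut x s (r - s) y) ^ 2 := by
    rw [Q_eq hf]; exact h3
  set X := ∫ y, (φ n y * cut x s (r - s) y) ^ 2
  have hX : 0 ≤ X := integral_nonneg fun y => sq_nonneg _
  have h5 : X ≤ t ^ 2 * Jf lam (fun y => φ n y * cut x s (r - s) y) + lam * t ^ 2 * X := by rw [h4]; linarith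
  have h6 := mul_le_mul_of_nonneg_left hn (sq_nonneg t)
  have h7 : t ^ 2 * ((1 / (r - s)) ^ 2 * (∫ y in closedBall x r, u y ^ 2) + ε / (2 * t ^ 2)) = (t / (r - s)) ^ 2 * (∫ y in closedBall x r, u y ^ 2) + ε / 2 := by
    field_simp
  nlinarith

theorem Sol.nd (S : Sol D Ω a lam φ u G) {x : Euc d} (hx : x ∈ frontier Ω) : ∃ κ > 0, ∃ r1 > 0, ∀ r, 0 < r → r ≤ r1 →
    κ * r ^ (d + 2) ≤ ∫ y in closedBall x r, u y ^ 2 := by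
  have hxO : x ∉ Ω := fun h => (S.hO.frontier_eq ▸ hx).2 h
  obtain ⟨c, hc, r0, hr0, h1⟩ := S.nd1 hxO
  obtain ⟨κ, hκ, hF⟩ := FG d 2 2 (by norm_num) (κ0 := c * omg d / 8) (C := 8) (by have := omg_pos (d := d); positivity) (by norm_num)
  have hint : ∀ r, IntegrableOn (fun y => u y ^ 2) (closedBall x r) := fun r => S.umem.integrable_sq.integrableOn
  have hnn : ∀ r, 0 ≤ ∫ y in closedBall x r, u y ^ 2 := fun r => integral_nonneg fun y => sq_nonneg _
  set r1 := min r0 (1 / (2 * (lam + 1))) with hr1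
  have hl0 := S.lam0
  have hl1 : lam * r1 ^ 2 ≤ 1 / 2 := by
    have e1 : r1 ≤ 1 / (2 * (lam + 1)) := min_le_right _ _
    have e0 : 0 < r1 := by positivity
    rw [le_div_iff₀ (by positivity)] at e1
    nlinarith
  refine ⟨κ, hκ, r1, by positivity, fun R hR hR1 => ?_⟩
  by_contra hlt
  have h2 := hF (fun r => ∫ y in closedBall x r, u y ^ 2) R hR hnn
    (fun r s hrs => setIntegral_mono_set (hint _) (.of_forall fun y => sq_nonneg _) (closedBall_subset_closedBall hrs).eventuallyLE)
    (fun r h t hh ht htR hrR hrh hle => by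
      have e1 := h1 (r - h / 2) r (by linarith) (hrR.trans (hR1.trans (min_le_left _ _)))
      have e2 := S.nd2 x (s := r - h) (r := r - h / 2) (t := t) (by linarith) ht ?_ ?_
      · beta_reduce
        have e3 : ∫ y in closedBall x (r - h / 2), u y ^ 2 ≤ ∫ y in closedBall x r, u y ^ 2 :=
          setIntegral_mono_set (hint _) (.of_forall fun y => sq_nonneg _) (closedBall_subset_closedBall (by linarith)).eventuallyLE
        have e4 : 2 * (t / (r - h / 2 - (r - h))) ^ 2 = 8 * (t / h) ^ 2 := by
          rw [show r - h / 2 - (r - h) = h / 2 by ring, show t / (h / 2) = 2 * (t / h) by field_simp]; ring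
        rw [e4] at e2
        exact e2.trans (mul_le_mul_of_nonneg_left e3 (by positivity))
      · beta_reduce at hle
        have e3 := e1.trans (mul_le_mul_of_nonneg_left hle (by positivity))
        have e4 : (1 / (r - (r - h / 2))) ^ 2 * (c * omg d / 8 * (t ^ d * h ^ 2)) = c * (t ^ d * omg d / 2) := by
          rw [show r - (r - h / 2) = h / 2 by ring, show (1 / (h / 2)) ^ 2 = 4 / h ^ 2 by field_simp; norm_num]; field_simp; ring
        rw [e4] at e3
        have := le_of_mul_le_mul_left e3 hc
        linarith
      · refine le_trans (mul_le_mul_of_nonneg_left (pow_le_pow_left₀ ht.le (htR.trans hR1) 2) hl0) hl1) (not_le.mp hlt).le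
  beta_reduce at h2
  have h3 := h1 (R / 4) (R / 2) (by linarith) ((by linarith : R / 2 ≤ R).trans (hR1.trans (min_le_left _ _)))
  rw [h2, mul_zero] at h3
  have h4 : mvol (Ω ∩ closedBall x (R / 4)) ≤ 0 := by
    by_contra h; push Not at h
    have := mul_pos hc h; linarith
  obtain ⟨y, hy1, hy2⟩ := mem_closure_iff_nhds.mp (frontier_subset_closure hx) (ball x (R / 4)) (ball_mem_nhds x (by positivity))
  have h5 : 0 < volume (Ω ∩ ball x (R / 4)) := (S.hO.inter isOpen_ball).measure_pos volume ⟨y, hy2, hy1⟩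
  have h6 : 0 < mvol (Ω ∩ ball x (R / 4)) := ENNReal.toReal_pos h5.ne' (measure_ne_top_of_subset inter_subset_left S.finO)
  have h7 := mvol_mono (inter_subset_inter_right Ω (ball_subset_closedBall (x := x) (ε := R / 4))) (measure_ne_top_of_subset inter_subset_left S.finO)
  linarith

theorem Sol.dens0 (S : Sol D Ω a lam φ u G) {x : Euc d} (hx : x ∈ frontier Ω) :
    ∃ τ > 0, ∀ R > 0, ∃ r, 0 < r ∧ r ≤ R ∧ τ * r ^ d ≤ mvol (Ω ∩ closedBall x r) := by
  obtain ⟨κ, hκ, r1, hr1, h1⟩ := S.nd hx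
  have ho := omg_pos (d := d)
  set θ : ℝ := (1 / 2) ^ (d + 3) with hθ
  have hθ0 : 0 < θ := by positivity
  refine ⟨θ ^ d * omg d / 2, by positivity, fun R hR => ?_⟩
  by_contra hcon
  push Not at hcon
  have hl0 := S.lam0
  set r2 := min R (min r1 (1 / (2 * (lam + 1)))) with hr2
  have hr20 : 0 < r2 := by positivity
  have e1 : r2 ≤ 1 / (2 * (lam + 1)) := (min_le_right _ _).trans (min_le_right _ _)
  rw [le_div_iff₀ (by positivity)] at e1
  have hθ1 : θ ≤ 1 / 8 := by
    rw [hθ, pow_add]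
    have : ((1:ℝ) / 2) ^ d ≤ 1 := pow_le_one₀ (by norm_num) (by norm_num)
    nlinarith
  have hnn : ∀ r, 0 ≤ ∫ y in closedBall x r, u y ^ 2 := fun r => integral_nonneg fun y => sq_nonneg _
  have step : ∀ r, 0 < r → r ≤ r2 → ∫ y in closedBall x (r / 2), u y ^ 2 ≤ θ * ∫ y in closedBall x r, u y ^ 2 := fun r hr hrr => by
    have e2 := S.nd2 x (s := r / 2) (r := r) (t := θ * r) (by linarith) (by positivity) (by
      have := hcon r hr (hrr.trans (min_le_left _ _))
      rw [mul_pow]; linarith) (by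
      have : (θ * r) ^ 2 ≤ r2 ^ 2 := pow_le_pow_left₀ (by positivity) (by nlinarith) 2
      have e3 := mul_le_mul_of_nonneg_left this hl0
      nlinarith)
    refine e2.trans (mul_le_mul_of_nonneg_right ?_ (hnn r))
    rw [show θ * r / (r - r / 2) = 2 * θ by field_simp; ring]
    nlinarith
  have key : ∀ k : ℕ, ∫ y in closedBall x (r2 * (1 / 2) ^ k), u y ^ 2 ≤ θ ^ k * ∫ y in closedBall x r2, u y ^ 2 := by
    intro k
    induction k with
    | zero => rw [pow_zero, mul_one, pow_zero, one_mul]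
    | succ k ih =>
      have := step (r2 * (1 / 2) ^ k) (by positivity) (mul_le_of_le_one_right hr20.le (pow_le_one₀ (by norm_num) (by norm_num)))
      rw [show r2 * (1 / 2) ^ k / 2 = r2 * (1 / 2) ^ (k + 1) by ring] at this
      refine this.trans ((mul_le_mul_of_nonneg_left ih hθ0.le).trans (le_of_eq (by ring)))
  have key2 : ∀ k : ℕ, κ * r2 ^ (d + 2) ≤ (1 / 2) ^ k * ∫ y in closedBall x r2, u y ^ 2 := fun k => by
    have e2 := (h1 (r2 * (1 / 2) ^ k) (by positivity) ((mul_le_of_le_one_right hr20.le (pow_le_one₀ (by norm_num) (by norm_num))).trans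
      ((min_le_right _ _).trans (min_le_left _ _)))).trans (key k)
    have e3 : θ ^ k = (1 / 2) ^ k * ((1 / 2) ^ k) ^ (d + 2) := by
      rw [hθ, ← pow_mul, ← pow_mul, ← pow_add]; ring
    rw [mul_pow, e3] at e2
    have e4 : 0 < (((1:ℝ) / 2) ^ k) ^ (d + 2) := by positivity
    refine le_of_mul_le_mul_right ?_ e4
    linarith
  have hlim : Tendsto (fun k : ℕ => ((1:ℝ) / 2) ^ k * ∫ y in closedBall x r2, u y ^ 2) atTop (𝓝 (0 * _)) :=
    (tendsto_pow_atTop_nhds_zero_of_lt_one (by norm_num) (by norm_num)).mul_const _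
  rw [zero_mul] at hlim
  have := ge_of_tendsto' hlim key2
  have : 0 < κ * r2 ^ (d + 2) := by positivity
  linarith
end

section
variable {D Ω : Set (Euc d)} {a lam : ℝ} {φ : ℕ → Euc d → ℝ} {u : Euc d → ℝ} {G : Euc d → Euc d}

theorem Sol.exf (S : Sol D Ω a lam φ u G) {x : Euc d} (hx : x ∉ Ω) : ∃ r0 > 0, ∃ f, LC f ∧ (∀ y ∈ ball x r0, f y = 0) ∧ ∃ e, 0 < ∫ y in Ω, ⟪gradient f y, e⟫ := by
  have hne : Ω.Nonempty := by
    by_contra h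
    rw [not_nonempty_iff_eq_empty] at h
    have := S.vol
    rw [h, mvol, measure_empty, ENNReal.toReal_zero] at this
    linarith [S.ha]
  obtain ⟨z, hz⟩ := hne
  obtain ⟨R, hR⟩ := (S.hDb.subset S.hOD).subset_ball 0
  set e := z - x with he
  have he0 : 0 < ‖e‖ := norm_pos_iff.mpr fun h => hx (by rw [he, sub_eq_zero] at h; exact h ▸ hz)
  have hl : LipschitzWith (Real.toNNReal ‖e‖) (fun y : Euc d => ⟪y - x, e⟫ - ‖e‖ ^ 2 / 2) := by
    refine LipschitzWith.of_dist_le_mul fun y y' => ?_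
    rw [Real.dist_eq, Real.coe_toNNReal _ he0.le, show ⟪y - x, e⟫ - ‖e‖ ^ 2 / 2 - (⟪y' - x, e⟫ - ‖e‖ ^ 2 / 2) = ⟪y - y', e⟫ by
      rw [show y - y' = (y - x) - (y' - x) by abel, inner_sub_left (y - x)]; ring, dist_eq_norm, mul_comm]
    exact abs_real_inner_le_norm _ _
  set g : Euc d → ℝ := fun y => cut 0 R 1 y * (⟪y - x, e⟫ - ‖e‖ ^ 2 / 2) with hg
  have hgl : LC g := (cut_lc 0 R one_pos).mulLip hl
  have hgO : ∀ y ∈ Ω, g y = ⟪y - x, e⟫ - ‖e‖ ^ 2 / 2 := fun y hy => by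
    have := hR hy
    rw [mem_ball, dist_eq_norm] at this
    rw [hg]; beta_reduce; rw [cut_one one_pos this.le, one_mul]
  have hgr : ∀ y ∈ Ω, gradient g y = e := fun y hy => by
    have h1 : HasGradientAt (fun y : Euc d => ⟪y - x, e⟫ - ‖e‖ ^ 2 / 2) e y := by
      rw [hasGradientAt_iff_hasFDerivAt]
      have h2 := (((hasFDerivAt_id y).sub_const x).inner ℝ (hasFDerivAt_const e y)).sub_const (‖e‖ ^ 2 / 2)
      refine h2.congr_fderiv ?_
      ext v
      simp [real_inner_comm]
    have h3 : g =ᶠ[𝓝 y] (fun y : Euc d => ⟪y - x, e⟫ - ‖e‖ ^ 2 / 2) := by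
      filter_upwards [S.hO.mem_nhds hy] with w hw using hgO w hw
    exact (h1.congr_of_eventuallyEq h3).gradient
  refine ⟨‖e‖ / 2, by positivity, fun y => max (g y) 0, hgl.max0, fun y hy => ?_, e, ?_⟩
  · refine max_eq_right (mul_nonpos_of_nonneg_of_nonpos (cut_nonneg _ _ _ _) ?_)
    rw [mem_ball, dist_eq_norm] at hy
    have := real_inner_le_norm (y - x) e
    nlinarith
  · have hm : MeasurableSet {y | 0 < g y} := measurableSet_lt measurable_const hgl.cont.measurable
    rw [setIntegral_congr_fun (g := {y | 0 < g y}.indicator fun _ => ‖e‖ ^ 2) S.hO.measurableSet fun y hy => ?_, setIntegral_indicator hm, setIntegral_const, smul_eq_mul]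
    · refine mul_pos (ENNReal.toReal_pos (IsOpen.measure_pos _ (S.hO.inter (isOpen_lt continuous_const hgl.cont)) ⟨z, hz, ?_⟩).ne'
        (measure_ne_top_of_subset inter_subset_left S.finO)) (by positivity)
      rw [mem_ofPred_eq, hgO z hz, ← he, real_inner_self_eq_norm_sq]; nlinarith
    · beta_reduce
      rw [grad_pos hgl.cont]
      by_cases h : 0 < g y
      · rw [if_pos h, indicator_of_mem (by exact h), hgr y hy, real_inner_self_eq_norm_sq]
      · rw [if_neg h, indicator_of_notMem (by exact h), inner_zero_left]

theorem Sol.off_ball (S : Sol D Ω a lam φ u G) {x : Euc d} (hx : x ∉ Ω) : ∃ r0 > 0, ∃ c1 > 0, ∃ ε1 > 0, ∀ ε, 0 < ε → ε ≤ ε1 → ∀ᶠ n in atTop,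
    c1 * ε ≤ mvol ((Ω ∩ {y | φ n y ≤ ε}) \ ball x r0) := by
  obtain ⟨r0, hr0, f, hf, hf0, e, he⟩ := S.exf hx
  obtain ⟨M, hM, ε0, hε0, hdec⟩ := S.decay'
  obtain ⟨F0, hF0⟩ := hf.bc.bd
  obtain ⟨K, hK⟩ := hf.1
  set m0 := ∫ y in Ω, ⟪gradient f y, e⟫ with hm0
  set F := |F0| + 1
  have hF : 0 < F := by positivity
  have hfF : ∀ y, |f y| ≤ F := fun y => (hF0 y).trans ((le_abs_self _).trans (by simp [F]))
  set E := ‖e‖ + 1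
  have hE : 0 < E := by positivity
  refine ⟨r0, hr0, (m0 / 2) ^ 2 / (E ^ 2 * F ^ 2 * M), by positivity, min ε0 (m0 / (2 * (E * (K + 1) * M))), by positivity, fun ε hε hε1 => ?_⟩
  filter_upwards [hdec ε hε (hε1.trans (min_le_left _ _))] with n ⟨hn1, hn2⟩
  have hc := S.core hf (fun y => grad_bound hK y) e hε n
  rw [← hm0, abs_of_pos he] at hc
  set W := (Ω ∩ {y | φ n y ≤ ε}) \ ball x r0 with hW
  have hmW : MeasurableSet W := (S.hO.measurableSet.inter (measurableSet_le (S.lc n).cont.measurable measurable_const)).diff measurableSet_ball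
  have hWf : volume W ≠ ⊤ := measure_ne_top_of_subset (sdiff_subset.trans inter_subset_left) S.finO
  have hmS : MeasurableSet {y | φ n y < ε} := measurableSet_lt (S.lc n).cont.measurable measurable_const
  have hg2 : Integrable (fun y => ‖gradient (φ n) y‖ ^ 2) := (S.lc n).g2.integrable
  have hgi : Integrable (fun y => ‖gradient (φ n) y‖) := (S.lc n).gbc.norm.integrable
  have hWi : Integrable (W.indicator fun _ => (1:ℝ)) := (integrable_indicator_iff hmW).mpr (integrableOn_const hWf)
  have hWg : Integrable (fun y => W.indicator (fun _ => (1:ℝ)) y * ‖gradient (φ n) y‖) := by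
    refine (hgi.indicator hmW).congr (.of_forall fun y => ?_)
    by_cases h : y ∈ W <;> simp [h]
  have hWsq : (fun y => W.indicator (fun _ => (1:ℝ)) y ^ 2) = W.indicator fun _ => (1:ℝ) := by
    ext y; by_cases h : y ∈ W <;> simp [h]
  have h1 : ∫ y in {y | φ n y < ε}, |f y| * ‖gradient (φ n) y‖ ≤ F * ∫ y in {y | φ n y < ε}, W.indicator (fun _ => (1:ℝ)) y * ‖gradient (φ n) y‖ := by
    rw [← integral_const_mul]
    refine setIntegral_mono_on (hf.bc.abs.mul (S.lc n).gbc.norm).integrable.integrableOn (hWg.const_mul F).integrableOn hmS fun y hy => ?_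
    by_cases h : y ∈ W
    · rw [indicator_of_mem h, one_mul]
      exact mul_le_mul_of_nonneg_right (hfF y) (norm_nonneg _)
    · rw [indicator_of_notMem h, zero_mul, mul_zero]
      refine le_of_eq ?_
      by_cases hO : y ∈ Ω
      · have : y ∈ ball x r0 := by
          by_contra hb
          exact h ⟨⟨hO, (show φ n y < ε from hy).le⟩, hb⟩
        rw [hf0 y this, abs_zero, zero_mul]
      · rw [grad_zero_of_notMem fun hc => hO (S.sup n hc), norm_zero, mul_zero]
  set I := ∫ y in {y | φ n y < ε}, W.indicator (fun _ => (1:ℝ)) y * ‖gradient (φ n) y‖ with hI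
  have hI0 : 0 ≤ I := integral_nonneg fun y => mul_nonneg (indicator_nonneg (fun _ _ => zero_le_one) _) (norm_nonneg _)
  have h2 : I ^ 2 ≤ mvol W * (M * ε) := by
    refine (int_cs (by rw [hWsq]; exact hWi.integrableOn) hg2.integrableOn hWg.integrableOn).trans (mul_le_mul ?_ hn1 (integral_nonneg fun y => sq_nonneg _) (mvol_nonneg _))
    rw [hWsq]
    refine (setIntegral_le_integral hWi (.of_forall fun y => indicator_nonneg (fun _ _ => zero_le_one) _)).trans (le_of_eq ?_)
    rw [integral_indicator hmW, setIntegral_const, smul_eq_mul, mul_one]; rfl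
  have hε2 : ε ≤ m0 / (2 * (E * (K + 1) * M)) := hε1.trans (min_le_right _ _)
  rw [le_div_iff₀ (by positivity)] at hε2
  have hK0 : (0:ℝ) ≤ K := K.2
  have h3 : m0 ≤ E * ((K + 1) * (M * ε) + 1 / ε * (F * I)) := by
    refine hc.trans (mul_le_mul (by simp [E]) (add_le_add (mul_le_mul (by linarith) hn2 (mvol_nonneg _) (by positivity))
      (mul_le_mul_of_nonneg_left h1 (by positivity))) (add_nonneg (mul_nonneg hK0 (mvol_nonneg _)) (mul_nonneg (by positivity) (integral_nonneg fun y => by positivity))) hE.le)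
  have h4 : m0 / 2 * ε ≤ E * F * I := by
    have : E * ((K + 1) * (M * ε) + 1 / ε * (F * I)) = E * ((K + 1) * (M * ε)) + E * F * I / ε := by field_simp
    rw [this] at h3
    have h5 : m0 / 2 ≤ E * F * I / ε := by linarith
    rwa [le_div_iff₀ hε] at h5
  have h5 := pow_le_pow_left₀ (by positivity) h4 2
  have h6 : (m0 / 2) ^ 2 * ε ^ 2 ≤ E ^ 2 * F ^ 2 * M * mvol W * ε := by
    have := mul_le_mul_of_nonneg_left h2 (show 0 ≤ E ^ 2 * F ^ 2 by positivity)
    nlinarith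
  rw [div_mul_eq_mul_div, div_le_iff₀ (by positivity)]
  refine le_of_mul_le_mul_right ?_ hε
  linarith
end

section
variable {D Ω : Set (Euc d)} {a lam : ℝ} {φ : ℕ → Euc d → ℝ} {u : Euc d → ℝ} {G : Euc d → Euc d}

theorem hk3_grad (r : ℝ) (x y : Euc d) : gradient (hk 3 r x) y = (-6 * hk 2 r x y) • (y - x) := by
  refine ext_inner_right ℝ fun v => ?_
  rw [hk_inner 1, real_inner_smul_left]; norm_num

theorem int_ball_le {F : Euc d → ℝ} (hF : Integrable F) {C r : ℝ} (hd : 0 < d) (hr : 0 ≤ r) (x : Euc d) (h0 : ∀ y, r ≤ ‖y - x‖ → F y = 0) (h1 : ∀ y, ‖y - x‖ < r → F y ≤ C) :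
    ∫ y, F y ≤ C * (r ^ d * omg d) := by
  rw [← mvol_ball hd x hr, ← setIntegral_eq_integral_of_forall_compl_eq_zero (s := ball x r) fun y hy => h0 y (by rw [mem_ball, dist_eq_norm] at hy; linarith)]
  refine (setIntegral_mono_on hF.integrableOn (integrableOn_const measure_ball_lt_top.ne) measurableSet_ball fun y hy => h1 y (by rwa [mem_ball, dist_eq_norm] at hy)).trans (le_of_eq ?_)
  rw [setIntegral_const, smul_eq_mul, mul_comm]; rfl

theorem hk3_J (hd : 0 < d) {r : ℝ} (hr : 0 ≤ r) (x : Euc d) (hl : 0 ≤ lam) : Jf lam (hk 3 r x) ≤ 36 * r ^ 10 * (r ^ d * omg d) := by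
  have hlc := hk_lc (k := 3) (by norm_num) hr x
  refine (Jf_mono_lam hlc hl).trans ?_
  rw [Q_eq hlc]
  refine int_ball_le hlc.g2.integrable hd hr x (fun y hy => ?_) fun y hy => ?_
  · rw [hk3_grad, hk_zero two_ne_zero hr hy]; simp
  · rw [hk3_grad, norm_smul, norm_mul, Real.norm_eq_abs, Real.norm_eq_abs, abs_of_nonneg (hk_nonneg _ _ _ _)]
    have h1 := mul_le_mul (hk_le 2 r x y) hy.le (norm_nonneg _) (by positivity)
    have h2 : (|(-6:ℝ)| * hk 2 r x y * ‖y - x‖) ≤ 6 * r ^ 5 := by norm_num; nlinarith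
    refine (pow_le_pow_left₀ (mul_nonneg (mul_nonneg (abs_nonneg _) (hk_nonneg _ _ _ _)) (norm_nonneg _)) h2 2).trans (le_of_eq (by ring))

theorem Sol.outer (S : Sol D Ω a lam φ u G) {x : Euc d} (hx : x ∉ Ω) (hxD : x ∈ D) : ∃ R0 > 0, ∃ c1 > 0, ∃ ε1 > 0, ∃ M > 0, ∀ r, 0 < r → r ≤ R0 →
    ∀ s, 0 ≤ s → s * r ^ 6 ≤ 1 → ∀ ε, 0 < ε → ε ≤ ε1 → mvol (ball x r \ Ω) ≤ c1 * ε →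
      2 * s * mu lam u x r ≤ s ^ 2 * (36 * r ^ 10 * (r ^ d * omg d)) + M * ε := by
  obtain ⟨r0, hr0, c1, hc1, ε1, hε1, h⟩ := S.off_ball hx
  obtain ⟨rD, hrD, hbD⟩ := Metric.isOpen_iff.mp S.hD x hxD
  have ho := omg_pos (d := d)
  have hl0 := S.lam0
  have ha := S.ha
  refine ⟨min 1 (min r0 rD), by positivity, c1, hc1, ε1, hε1, 2 * lam * (a + 1 + omg d) + 1, by positivity, fun r hr hrR s hs hsr ε hε hε1' hh => ?_⟩
  have hr1 : r ≤ 1 := hrR.trans (min_le_left _ _)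
  have hrr0 : r ≤ r0 := hrR.trans ((min_le_right _ _).trans (min_le_left _ _))
  have hrrD : r ≤ rD := hrR.trans ((min_le_right _ _).trans (min_le_right _ _))
  have hz : LC (hk 3 r x) := hk_lc (by norm_num) hr.le x
  have hz0 : ∀ y, y ∉ ball x r → hk 3 r x y = 0 := fun y hy => hk_zero (by norm_num) hr.le (by rw [mem_ball, dist_eq_norm] at hy; linarith)
  have hJ := hk3_J S.hd hr.le x hl0 (lam := lam)
  have key : ∀ᶠ n in atTop, 2 * s * mu lam (φ n) x r ≤ Jf lam (φ n) + (s ^ 2 * (36 * r ^ 10 * (r ^ d * omg d)) + (2 * lam * (a + 1 + omg d)) * ε) := by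
    filter_upwards [h ε hε hε1'] with n hn
    have hw : LC (fun y => φ n y + s * hk 3 r x y) := (S.lc n).add (hz.cmul s)
    have hw0 : ∀ y, 0 ≤ φ n y + s * hk 3 r x y := fun y => add_nonneg (S.nn n y) (mul_nonneg hs (hk_nonneg _ _ _ _))
    have h1 := Jf_posl_le hw hl0 hε.le hw0
    have h2 : 0 ≤ Jf lam (fun y => max (φ n y + s * hk 3 r x y - ε) 0) := by
      refine S.minJ _ (hw.posl hε.le) (fun y hy => ?_) ?_
      · rw [hz0 y fun hb => hy (hbD (ball_subset_ball hrrD hb)), S.off n y fun hO => hy (S.hOD hO), mul_zero, add_zero, zero_sub]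
        exact max_eq_right (by linarith)
      · have hmW : MeasurableSet ((Ω ∩ {y | φ n y ≤ ε}) \ ball x r0) := (S.hO.measurableSet.inter (measurableSet_le (S.lc n).cont.measurable measurable_const)).diff measurableSet_ball
        have e1 : mvol ({y | max (φ n y + s * hk 3 r x y - ε) 0 ≠ 0} ∪ ((Ω ∩ {y | φ n y ≤ ε}) \ ball x r0)) =
          mvol {y | max (φ n y + s * hk 3 r x y - ε) 0 ≠ 0} + mvol ((Ω ∩ {y | φ n y ≤ ε}) \ ball x r0) := by
          rw [mvol, measure_union _ hmW, ENNReal.toReal_add (hw.posl hε.le).fin_ne (measure_ne_top_of_subset (sdiff_subset.trans inter_subset_left) S.finO)]; rfl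
          rw [disjoint_left]
          rintro y hy ⟨⟨-, hy2⟩, hy3⟩
          refine hy (max_eq_right ?_)
          rw [hz0 y fun hb => hy3 (ball_subset_ball hrr0 hb), mul_zero, add_zero]
          exact sub_nonpos.mpr hy2
        have e2 : mvol ({y | max (φ n y + s * hk 3 r x y - ε) 0 ≠ 0} ∪ ((Ω ∩ {y | φ n y ≤ ε}) \ ball x r0)) ≤ mvol (Ω ∪ (ball x r \ Ω)) := by
          refine mvol_mono (union_subset (fun y hy => ?_) fun y hy => Or.inl hy.1.1) (measure_union_lt_top S.finO.lt_top ((measure_mono sdiff_subset).trans_lt measure_ball_lt_top)).ne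
          by_contra hc
          rw [mem_union, mem_diff, not_or, not_and, not_not] at hc
          have hyb : y ∉ ball x r := fun hb => hc.1 (hc.2 hb)
          refine hy ?_
          rw [hz0 y hyb, S.off n y hc.1, mul_zero, add_zero, zero_sub]
          exact max_eq_right (by linarith)
        have e3 : mvol (Ω ∪ (ball x r \ Ω)) ≤ a + mvol (ball x r \ Ω) := by
          rw [← S.vol, mvol, mvol, mvol, ← ENNReal.toReal_add S.finO (measure_ne_top_of_subset sdiff_subset measure_ball_lt_top.ne)]
          exact ENNReal.toReal_mono (ENNReal.add_ne_top.mpr ⟨S.finO, measure_ne_top_of_subset sdiff_subset measure_ball_lt_top.ne⟩) (measure_union_le _ _)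
        linarith
    have h3 : 0 ≤ ∫ y in {y | φ n y + s * hk 3 r x y < ε}, ‖gradient (fun y => φ n y + s * hk 3 r x y) y‖ ^ 2 := integral_nonneg fun y => sq_nonneg _
    have h4 : ∫ y, (φ n y + s * hk 3 r x y) ≤ a + 1 + omg d := by
      rw [integral_add (S.lc n).bc.integrable (hz.cmul s).bc.integrable]
      refine add_le_add (S.intphi n) ?_
      refine (int_ball_le (C := 1) (hz.cmul s).bc.integrable S.hd hr.le x (fun y hy => ?_) fun y hy => ?_).trans ?_
      · rw [hk_zero (by norm_num) hr.le hy, mul_zero]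
      · refine (mul_le_mul_of_nonneg_left (hk_le 3 r x y) hs).trans (le_trans (le_of_eq (by ring)) hsr)
      · rw [one_mul]; exact mul_le_of_le_one_left ho.le (pow_le_one₀ hr.le hr1)
    rw [Jf_add (S.lc n) hz, Bf_hk (S.lc n) lam x hr.le] at h1
    have h5 := mul_le_mul_of_nonneg_left h4 (show 0 ≤ 2 * lam * ε by positivity)
    have h6 := mul_le_mul_of_nonneg_left hJ (sq_nonneg s)
    linarith
  have := le_of_tendsto_of_tendsto ((S.mulim x r).const_mul (2 * s)) (S.J0.add_const _) key
  nlinarith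

theorem Sol.dens1 (S : Sol D Ω a lam φ u G) {x : Euc d} (hx : x ∈ frontier Ω) (hxD : x ∈ D)
    (hA : ∀ ε > 0, ∃ r, 0 < r ∧ r ≤ 1 ∧ Ak u x r < ε) :
    ∃ τ > 0, ∀ R > 0, ∃ r, 0 < r ∧ r ≤ R ∧ τ * r ^ d ≤ mvol (ball x r \ Ω) := by
  have hxO : x ∉ Ω := fun h => (S.hO.frontier_eq ▸ hx).2 h
  obtain ⟨κ, hκ, r1, hr1, hnd⟩ := S.nd hx
  obtain ⟨R0, hR0, c1, hc1, ε1, hε1, M, hM, hout⟩ := S.outer hxO hxD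
  have ho := omg_pos (d := d)
  have hcd := cd_pos (d := d)
  have hl0 := S.lam0
  set C := 18 * omg d + M / (2 * c1) with hC
  have hC0 : 0 < C := by positivity
  set C2 := Real.exp (lam / 12) * (3 ^ (d + 4) * (C * 3)) / cd d with hC2
  have hC20 : 0 < C2 := by positivity
  set θ := min 1 (κ / (8 * (C2 ^ 2 * omg d) + 1)) with hθ
  have hθ0 : 0 < θ := by positivity
  have hθ1 : θ ≤ 1 := min_le_left _ _
  refine ⟨θ ^ 2, by positivity, fun R hR => ?_⟩
  by_contra hcon
  push Not at hcon
  set R2 := min R (min R0 (min 1 (c1 * ε1))) with hR2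
  have hR20 : 0 < R2 := by positivity
  have hR21 : R2 ≤ 1 := (min_le_right _ _).trans ((min_le_right _ _).trans (min_le_left _ _))
  have hmu : ∀ r, 0 < r → r ≤ R2 → mu lam u x r ≤ C * θ * r ^ (d + 5) := fun r hr hrr => by
    have hr1 : r ≤ 1 := hrr.trans hR21
    have e1 := hout r hr (hrr.trans ((min_le_right _ _).trans (min_le_left _ _))) (θ / r ^ 5) (by positivity) (by
      rw [show θ / r ^ 5 * r ^ 6 = θ * r by field_simp]; exact mul_le_one₀ hθ1 hr.le hr1) (θ ^ 2 * r ^ d / c1) (by positivity) (by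
      rw [div_le_iff₀ hc1]
      have h1 : r ^ d ≤ r := pow_le_of_le_one hr.le hr1 S.hd.ne'
      have h2 : r ≤ c1 * ε1 := hrr.trans ((min_le_right _ _).trans ((min_le_right _ _).trans (min_le_right _ _)))
      have h3 : θ ^ 2 ≤ 1 := pow_le_one₀ hθ0.le hθ1
      have h4 : θ ^ 2 * r ^ d ≤ r ^ d := mul_le_of_le_one_left (by positivity) h3
      linarith) (by
      rw [mul_div_cancel₀ _ hc1.ne']; exact (hcon r hr (hrr.trans (min_le_left _ _))).le)
    have e2 : (θ / r ^ 5) ^ 2 * (36 * r ^ 10 * (r ^ d * omg d)) + M * (θ ^ 2 * r ^ d / c1) = 2 * (θ / r ^ 5) * (C * θ * r ^ (d + 5)) := by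
      rw [hC]; field_simp; ring
    rw [e2] at e1
    exact le_of_mul_le_mul_left e1 (by positivity)
  have hAr : ∀ r, 0 < r → r ≤ R2 → Ak u x r ≤ C * θ * r := fun r hr hrr => by
    refine le_of_forall_pos_le_add fun ε hε => ?_
    obtain ⟨s, hs, hs1, hsε⟩ := hA (ε / Real.exp (lam / 12)) (by positivity)
    set t := min s r with ht
    have ht0 : 0 < t := lt_min hs hr
    have e1 : Ak u x t ≤ ε := by
      refine (S.Amono x ht0 (min_le_left _ _)).trans ?_
      rw [lt_div_iff₀ (by positivity)] at hsε
      have e0 : Real.exp (lam * s ^ 2 / 12) ≤ Real.exp (lam / 12) := Real.exp_le_exp.mpr (by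
        have : lam * s ^ 2 ≤ lam * 1 := mul_le_mul_of_nonneg_left (pow_le_one₀ hs.le hs1) hl0
        linarith)
      have := mul_le_mul_of_nonneg_right e0 (Ak_nonneg S.unn x hs.le)
      linarith
    have e2 := mono_of (g := fun r => C * θ * r - Ak u x r) (g' := fun r => C * θ - (mu lam u x r - lam * Ik 3 u x r) / (6 * r ^ (d + 5))) (s := t) (r := r) (min_le_right _ _)
      (fun ρ hρ => by simpa using ((hasDerivAt_id ρ).const_mul (C * θ)).fun_sub (Ak_deriv S.uint lam x (ht0.trans_le hρ.1))) (fun ρ hρ => by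
        have hρ0 := ht0.trans_le hρ.1
        rw [sub_nonneg, div_le_iff₀ (by positivity)]
        have h1 := hmu ρ hρ0 (hρ.2.trans hrr)
        have h2 := mul_nonneg hl0 (Ik_nonneg S.unn 3 x ρ)
        have h3 : 0 ≤ C * θ * ρ ^ (d + 5) := by positivity
        linarith)
    beta_reduce at e2
    have : 0 ≤ C * θ * t := by positivity
    linarith
  set r := min r1 (R2 / 4) / 2 with hr
  have hr0 : 0 < r := by positivity
  have hrr1 : r ≤ r1 := by have := min_le_left r1 (R2 / 4); linarith
  have hrR2 : 8 * r ≤ R2 := by have := min_le_right r1 (R2 / 4); linarith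
  have e1 := hnd r hr0 hrr1
  have e2 : ∫ y in closedBall x r, u y ^ 2 ≤ (C2 * θ * (2 * r)) ^ 2 * mvol (closedBall x r) := by
    rw [mul_comm (_ ^ 2), mvol, ← smul_eq_mul, ← Measure.real, ← setIntegral_const]
    refine setIntegral_mono_on_ae S.umem.integrable_sq.integrableOn (integrableOn_const measure_closedBall_lt_top.ne) measurableSet_closedBall ?_
    filter_upwards [S.ubd] with y hy hyb
    rw [mem_closedBall, dist_eq_norm] at hyb
    refine pow_le_pow_left₀ (S.unn y) ?_ 2
    have h1 := hy x (2 * r) (by linarith) (by linarith)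
    have h2 := hAr (3 * (2 * r)) (by linarith) (by linarith)
    have h3 : Real.exp (lam * (2 * r) ^ 2 / 12) ≤ Real.exp (lam / 12) := Real.exp_le_exp.mpr (by
      have : lam * (2 * r) ^ 2 ≤ lam * 1 := mul_le_mul_of_nonneg_left (pow_le_one₀ (by linarith) (by linarith)) hl0
      linarith)
    have h4 : cd d * u y ≤ cd d * (C2 * θ * (2 * r)) := by
      refine h1.trans ((mul_le_mul h3 (mul_le_mul_of_nonneg_left h2 (by positivity)) (mul_nonneg (by positivity) (Ak_nonneg S.unn x (by linarith))) (by positivity)).trans (le_of_eq ?_))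
      rw [hC2]; field_simp
    exact le_of_mul_le_mul_left h4 hcd
  rw [mvol_closedBall x hr0.le] at e2
  have e3 : (C2 * θ * (2 * r)) ^ 2 * (r ^ d * omg d) = 4 * C2 ^ 2 * omg d * θ ^ 2 * r ^ (d + 2) := by ring
  rw [e3] at e2
  have e4 := le_of_mul_le_mul_right (e1.trans e2) (by positivity)
  have e5 : θ ≤ κ / (8 * (C2 ^ 2 * omg d) + 1) := min_le_right _ _
  rw [le_div_iff₀ (by positivity)] at e5
  have e6 : C2 ^ 2 * omg d * (θ * θ) ≤ C2 ^ 2 * omg d * θ := mul_le_mul_of_nonneg_left (mul_le_of_le_one_left hθ0.le hθ1) (by positivity)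
  have e7 : 0 < C2 ^ 2 * omg d * θ := by positivity
  linarith
end

section
theorem HPcov (hd : 0 < d) {N : Set (Euc d)} {R ε : ℝ} (m : Measure (Euc d)) (hm : m univ ≤ ENNReal.ofReal ε)
    (h : ∀ x ∈ N, ∃ r, 0 < r ∧ r ≤ R ∧ ENNReal.ofReal (r ^ (d - 1)) ≤ m (closedBall x r)) :
    ∃ (v : Set (Euc d)) (r : Euc d → ℝ), v.Countable ∧ (∀ y ∈ v, 0 < r y ∧ r y ≤ R) ∧ N ⊆ (⋃ y : v, closedBall (y : Euc d) (4 * r y)) ∧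
      ∑' y : v, ENNReal.ofReal (r y ^ (d - 1)) ≤ ENNReal.ofReal ε := by
  choose! r hr0 hrR hrm using h
  obtain ⟨v, hvN, hvd, hvc⟩ := Vitali.exists_disjoint_subfamily_covering_enlargement_closedBall N (fun x => x) r R hrR 4 (by norm_num)
  have hc : v.Countable := hvd.countable_of_nonempty_interior fun y hy => ⟨y, ball_subset_interior_closedBall (mem_ball_self (hr0 y (hvN hy)))⟩
  refine ⟨v, r, hc, fun y hy => ⟨hr0 y (hvN hy), hrR y (hvN hy)⟩, fun x hx => ?_, ?_⟩
  · obtain ⟨b, hb, hbb⟩ := hvc x hx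
    exact mem_iUnion.mpr ⟨⟨b, hb⟩, hbb (mem_closedBall_self (hr0 x hx).le)⟩
  · refine (ENNReal.tsum_le_tsum fun y : v => hrm y (hvN y.2)).trans (le_trans ?_ hm)
    haveI := hc.to_subtype
    exact tsum_measure_le_measure_univ (fun y => measurableSet_closedBall.nullMeasurableSet) fun y z hyz =>
      (hvd y.2 z.2 fun h => hyz (Subtype.ext h)).aedisjoint

theorem HP (hd : 0 < d) {N : Set (Euc d)} (h : ∀ R > 0, ∀ ε > 0, ∃ m : Measure (Euc d), m univ ≤ ENNReal.ofReal ε ∧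
    ∀ x ∈ N, ∃ r, 0 < r ∧ r ≤ R ∧ ENNReal.ofReal (r ^ (d - 1)) ≤ m (closedBall x r)) : μH[(d : ℝ) - 1] N = 0 := by
  have h1 : ∀ n : ℕ, ∃ (v : Set (Euc d)) (r : Euc d → ℝ), v.Countable ∧ (∀ y ∈ v, 0 < r y ∧ r y ≤ 1 / ((n:ℝ) + 1)) ∧ N ⊆ (⋃ y : v, closedBall (y : Euc d) (4 * r y)) ∧
      ∑' y : v, ENNReal.ofReal (r y ^ (d - 1)) ≤ ENNReal.ofReal (1 / ((n:ℝ) + 1)) := fun n => by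
    obtain ⟨m, hm, h2⟩ := h (1 / ((n:ℝ) + 1)) (by positivity) (1 / ((n:ℝ) + 1)) (by positivity)
    exact HPcov hd m hm h2
  choose v r hvc hr hN hs using h1
  haveI : ∀ n, Countable (v n) := fun n => (hvc n).to_subtype
  have hd1 : ((d:ℝ) - 1) = ((d - 1 : ℕ) : ℝ) := by rw [Nat.cast_sub hd, Nat.cast_one]
  have hl : Tendsto (fun n : ℕ => ENNReal.ofReal (1 / ((n:ℝ) + 1))) atTop (𝓝 0) := by
    rw [← ENNReal.ofReal_zero]; exact ENNReal.tendsto_ofReal tendsto_one_div_add_atTop_nhds_zero_nat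
  have hdi : ∀ n (y : v n), ediam (closedBall (y : Euc d) (4 * r n y)) ≤ ENNReal.ofReal (8 * r n y) := fun n y => by
    rw [← closedEBall_ofReal (by have := (hr n y y.2).1; positivity)]
    refine (ediam_closedEBall_le).trans (le_of_eq ?_)
    rw [show (2:ℝ≥0∞) = ENNReal.ofReal 2 by simp, ← ENNReal.ofReal_mul (by norm_num)]
    congr 1; ring
  have hb : ∀ n, ∑' y : v n, ediam (closedBall (y : Euc d) (4 * r n y)) ^ ((d:ℝ) - 1) ≤ ENNReal.ofReal (8 ^ (d - 1)) * ENNReal.ofReal (1 / ((n:ℝ) + 1)) := fun n => by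
    refine le_trans ?_ (mul_le_mul_right (hs n) _)
    rw [← ENNReal.tsum_mul_left]
    refine ENNReal.tsum_le_tsum fun y => ?_
    rw [hd1, ENNReal.rpow_natCast, ← ENNReal.ofReal_mul (by positivity), ← mul_pow, ENNReal.ofReal_pow (by have := (hr n y y.2).1; positivity)]
    exact pow_le_pow_left' (hdi n y) _
  have h3 := Measure.hausdorffMeasure_le_liminf_tsum ((d:ℝ) - 1) N (l := atTop) (fun n : ℕ => ENNReal.ofReal 8 * ENNReal.ofReal (1 / ((n:ℝ) + 1)))
    (by simpa using ENNReal.Tendsto.const_mul hl (Or.inr (ENNReal.ofReal_ne_top (r := 8)))) (fun n (y : v n) => closedBall (y : Euc d) (4 * r n y))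
    (.of_forall fun n y => (hdi n y).trans (by
      rw [← ENNReal.ofReal_mul (by norm_num)]
      exact ENNReal.ofReal_le_ofReal (mul_le_mul_of_nonneg_left (hr n y y.2).2 (by norm_num)))) (.of_forall hN)
  have h4 : Tendsto (fun n : ℕ => ENNReal.ofReal (8 ^ (d - 1)) * ENNReal.ofReal (1 / ((n:ℝ) + 1))) atTop (𝓝 0) := by
    simpa using ENNReal.Tendsto.const_mul hl (Or.inr (ENNReal.ofReal_ne_top (r := 8 ^ (d - 1))))
  have h5 := h3.trans (liminf_le_liminf (.of_forall hb))
  rw [h4.liminf_eq] at h5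
  exact le_antisymm h5 bot_le
end

section
variable {D Ω : Set (Euc d)} {a lam : ℝ} {φ : ℕ → Euc d → ℝ} {u : Euc d → ℝ} {G : Euc d → Euc d}

theorem mu0_sq {g : Euc d → ℝ} (hg : LC g) (x : Euc d) {r : ℝ} (hr : 0 ≤ r) :
    (mu 0 g x r) ^ 2 ≤ 36 * r ^ 10 * (r ^ d * omg d) * ∫ y in closedBall x r, ‖gradient g y‖ ^ 2 := by
  have h1 := Bf_hk hg 0 x hr
  have hz : ∀ y, y ∉ closedBall x r → gradient (hk 3 r x) y = 0 := fun y hy => by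
    rw [mem_closedBall, dist_eq_norm, not_le] at hy
    rw [hk3_grad, hk_zero two_ne_zero hr hy.le, mul_zero, zero_smul]
  have hn : ∀ y ∈ closedBall x r, ‖gradient (hk 3 r x) y‖ ≤ 6 * r ^ 5 := fun y hy => by
    rw [mem_closedBall, dist_eq_norm] at hy
    rw [hk3_grad, norm_smul, norm_mul, Real.norm_eq_abs, Real.norm_eq_abs, abs_of_nonneg (hk_nonneg _ _ _ _)]
    have h1 := mul_le_mul (hk_le 2 r x y) hy (norm_nonneg _) (by positivity)
    norm_num; nlinarith
  have h2 : Bf 0 g (hk 3 r x) = ∫ y in closedBall x r, ⟪gradient g y, gradient (hk 3 r x) y⟫ := by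
    rw [setIntegral_eq_integral_of_forall_compl_eq_zero fun y hy => by rw [hz y hy, inner_zero_right], Bf]
    simp
  have hgi : IntegrableOn (fun y => ‖gradient g y‖) (closedBall x r) := hg.gbc.norm.integrable.integrableOn
  have h3 : |Bf 0 g (hk 3 r x)| ≤ 6 * r ^ 5 * ∫ y in closedBall x r, 1 * ‖gradient g y‖ := by
    rw [h2, ← integral_const_mul, ← Real.norm_eq_abs]
    refine norm_integral_le_of_norm_le ((hgi.const_mul (6 * r ^ 5)).congr (.of_forall fun y => by beta_reduce; rw [one_mul])) ?_
    filter_upwards [ae_restrict_mem measurableSet_closedBall] with y hy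
    rw [one_mul, mul_comm]
    exact (norm_inner_le_norm _ _).trans (mul_le_mul_of_nonneg_left (hn y hy) (norm_nonneg _))
  have h4 := int_cs (μ := volume.restrict (closedBall x r)) (f := fun _ => (1:ℝ)) (g := fun y => ‖gradient g y‖) (by simp only [one_pow]; exact integrableOn_const (measure_closedBall_lt_top (x := x) (r := r)).ne) hg.g2.integrable.integrableOn (by simp only [one_mul]; exact hgi)
  have h5 : ∫ y in closedBall x r, (1:ℝ) ^ 2 = r ^ d * omg d := by
    rw [setIntegral_const, one_pow, smul_eq_mul, mul_one]; exact mvol_closedBall x hr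
  rw [h5] at h4
  have h6 : (mu 0 g x r) ^ 2 = |Bf 0 g (hk 3 r x)| ^ 2 := by rw [h1, abs_neg, sq_abs]
  rw [h6]
  refine (pow_le_pow_left₀ (abs_nonneg _) h3 2).trans ?_
  rw [mul_pow]
  refine (mul_le_mul_of_nonneg_left h4 (by positivity)).trans (le_of_eq (by ring))

theorem Ak_grow {g : Euc d → ℝ} (hd : 0 < d) (hg : LC g) (x : Euc d) {s T : ℝ} (hs : 0 < s) (hsT : s ≤ T)
    (h : ∀ ρ ∈ Icc s T, ∫ y in closedBall x ρ, ‖gradient g y‖ ^ 2 ≤ 4 * ρ ^ (d - 1)) : Ak g x s ≤ Ak g x T + 4 * √(omg d) * √T := by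
  have ho := omg_pos (d := d)
  have e2 := mono_of (g := fun r => 4 * √(omg d) * √r + Ak g x r) (g' := fun r => 4 * √(omg d) * (1 / (2 * √r)) + (mu 0 g x r - 0 * Ik 3 g x r) / (6 * r ^ (d + 5))) hsT
    (fun ρ hρ => ((Real.hasDerivAt_sqrt (hs.trans_le hρ.1).ne').const_mul (4 * √(omg d))).fun_add (Ak_deriv hg.bc.integrable 0 x (hs.trans_le hρ.1))) (fun ρ hρ => by
      have hρ0 := hs.trans_le hρ.1
      have h1 := (mu0_sq hg x hρ0.le).trans (mul_le_mul_of_nonneg_left (h ρ hρ) (by positivity))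
      have h2 : 36 * ρ ^ 10 * (ρ ^ d * omg d) * (4 * ρ ^ (d - 1)) = (12 * √(omg d) * ρ ^ (d + 5) / √ρ) ^ 2 := by
        obtain ⟨k, rfl⟩ : ∃ k, d = k + 1 := ⟨d - 1, by omega⟩
        rw [Nat.add_sub_cancel, div_pow, mul_pow, mul_pow, Real.sq_sqrt hρ0.le, Real.sq_sqrt ho.le]
        field_simp; ring
      rw [h2] at h1
      have h3 := (abs_le_of_sq_le_sq' h1 (by positivity)).1
      have h4 : 4 * √(omg d) * (1 / (2 * √ρ)) = 12 * √(omg d) * ρ ^ (d + 5) / √ρ / (6 * ρ ^ (d + 5)) := by field_simp; norm_num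
      rw [h4, ← add_div]
      refine div_nonneg ?_ (by positivity)
      linarith)
  beta_reduce at e2
  have : 0 ≤ 4 * √(omg d) * √s := by positivity
  linarith

theorem Ik_sub {f g : Euc d → ℝ} (hf : Integrable f) (hg : Integrable g) (k : ℕ) (x : Euc d) (r : ℝ) : Ik k (fun y => f y - g y) x r = Ik k f x r - Ik k g x r := by
  rw [Ik, Ik, Ik, ← integral_sub (Ik_int hf k x r) (Ik_int hg k x r)]
  exact integral_congr_ae (.of_forall fun y => by ring)

theorem Sol.Asmall (S : Sol D Ω a lam φ u G) {x : Euc d} (hx : x ∉ Ω) (n : ℕ) {T : ℝ} (hT : 0 < T)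
    (h : ∀ ρ, 0 < ρ → ρ ≤ T → ∫ y in closedBall x ρ, ‖gradient (φ n) y - G y‖ ^ 2 ≤ ρ ^ (d - 1)) :
    ∃ s, 0 < s ∧ s ≤ T ∧ Ak u x s ≤ (∫ y, |φ n y - u y|) / T ^ d + 4 * √(omg d) * √T := by
  obtain ⟨s0, hs0, hb⟩ := Metric.isOpen_iff.mp (isClosed_tsupport (φ n)).isOpen_compl x fun hc => hx (S.sup n hc)
  set s := min s0 T with hs
  have hs' : 0 < s := lt_min hs0 hT
  refine ⟨s, hs', min_le_right _ _, ?_⟩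
  have hz : Ak (φ n) x s = 0 := by
    rw [Ak, Ik]
    refine div_eq_zero_iff.mpr (Or.inl ?_)
    rw [integral_eq_zero_of_ae]
    refine .of_forall fun y => ?_
    by_cases hy : ‖y - x‖ < s
    · have : φ n y = 0 := image_eq_zero_of_notMem_tsupport (hb (by rw [mem_ball, dist_eq_norm]; exact hy.trans_le (min_le_left _ _)))
      simp [this]
    · simp [hk_zero two_ne_zero hs'.le (not_lt.mp hy)]
  have hgi : ∀ m, Integrable (fun y => ‖gradient (φ m) y - G y‖ ^ 2) := fun m => ((S.lc m).gbc.memLp 2).sub S.Gmem |>.integrable_norm_pow (by norm_num)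
  have key : ∀ᶠ m in atTop, Ak (φ m) x s ≤ Ak (φ m) x T - Ak (φ n) x T + 4 * √(omg d) * √T := by
    filter_upwards [S.Gconv.eventually (gt_mem_nhds (show 0 < s ^ (d - 1) by positivity))] with m hm
    have hl : LC (fun y => φ m y - φ n y) := (S.lc m).sub (S.lc n)
    have e1 := Ak_grow S.hd hl x hs' (min_le_right _ _) (fun ρ hρ => by
      have hρ0 := hs'.trans_le hρ.1
      have h1 := h ρ hρ0 hρ.2
      have h2 : ∫ y in closedBall x ρ, ‖gradient (φ m) y - G y‖ ^ 2 ≤ ρ ^ (d - 1) :=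
        (setIntegral_le_integral (hgi m) (.of_forall fun y => sq_nonneg _)).trans (hm.le.trans (pow_le_pow_left₀ hs'.le hρ.1 _))
      have h3 : ∫ y in closedBall x ρ, ‖gradient (fun y => φ m y - φ n y) y‖ ^ 2 ≤ ∫ y in closedBall x ρ, (2 * ‖gradient (φ m) y - G y‖ ^ 2 + 2 * ‖gradient (φ n) y - G y‖ ^ 2) := by
        refine setIntegral_mono_ae hl.g2.integrable.integrableOn (((hgi m).const_mul 2).add ((hgi n).const_mul 2)).integrableOn ?_
        filter_upwards [(S.lc m).diff, (S.lc n).diff] with y d1 d2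
        rw [grad_sub d1 d2]
        have := norm_sub_le (gradient (φ m) y - G y) (gradient (φ n) y - G y)
        rw [sub_sub_sub_cancel_right] at this
        have := pow_le_pow_left₀ (norm_nonneg _) this 2
        nlinarith [sq_nonneg (‖gradient (φ m) y - G y‖ - ‖gradient (φ n) y - G y‖)]
      rw [integral_add ((hgi m).const_mul 2).integrableOn ((hgi n).const_mul 2).integrableOn, integral_const_mul, integral_const_mul] at h3
      linarith)
    have h5 : ∀ r, Ak (fun y => φ m y - φ n y) x r = Ak (φ m) x r - Ak (φ n) x r := fun r => by
      rw [Ak, Ik_sub (S.lc m).bc.integrable (S.lc n).bc.integrable, sub_div]; rfl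
    rw [h5, h5, hz] at e1
    linarith
  have hA : ∀ r, Tendsto (fun m => Ak (φ m) x r) atTop (𝓝 (Ak u x r)) := fun r => (S.Iklim 2 x r).div_const _
  have e1 := le_of_tendsto_of_tendsto (hA s) (((hA T).sub_const _).add_const _) key
  refine e1.trans (add_le_add_left ?_ _)
  rw [Ak, Ak, ← sub_div, ← Ik_sub S.uint (S.lc n).bc.integrable, div_le_div_iff₀ (by positivity) (by positivity)]
  have h6 : Ik 2 (fun y => u y - φ n y) x T ≤ (∫ y, |φ n y - u y|) * T ^ 4 := by
    rw [Ik, ← integral_mul_const]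
    refine integral_mono (Ik_int (S.uint.sub (S.lc n).bc.integrable) 2 x T) (((S.lc n).bc.integrable.sub S.uint).abs.mul_const _) fun y => ?_
    beta_reduce
    rw [abs_sub_comm]
    refine mul_le_mul (le_abs_self _) ((hk_le 2 T x y).trans (le_of_eq (by ring))) (hk_nonneg _ _ _ _) (abs_nonneg _)
  refine (mul_le_mul_of_nonneg_right h6 (by positivity)).trans (le_of_eq (by ring))

theorem Sol.Anull (S : Sol D Ω a lam φ u G) : μH[(d : ℝ) - 1] {x | x ∉ Ω ∧ ∃ ε > 0, ∀ r, 0 < r → r ≤ 1 → ε ≤ Ak u x r} = 0 := by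
  have h1 : {x | x ∉ Ω ∧ ∃ ε > 0, ∀ r, 0 < r → r ≤ 1 → ε ≤ Ak u x r} ⊆ ⋃ k : ℕ, {x | x ∉ Ω ∧ ∀ r, 0 < r → r ≤ 1 → 1 / ((k:ℝ) + 1) ≤ Ak u x r} := by
    rintro x ⟨hx, ε, hε, h⟩
    obtain ⟨k, hk⟩ := exists_nat_one_div_lt hε
    exact mem_iUnion.mpr ⟨k, hx, fun r hr hr1 => hk.le.trans (h r hr hr1)⟩
  refine measure_mono_null h1 (measure_iUnion_null fun k => HP S.hd fun R hR ε hε => ?_)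
  have ho := omg_pos (d := d)
  set η : ℝ := 1 / ((k:ℝ) + 1) with hη
  have hη0 : 0 < η := by positivity
  set T := min (min R 1) ((η / (16 * √(omg d))) ^ 2) with hT
  have hT0 : 0 < T := by positivity
  have hTs : 4 * √(omg d) * √T ≤ η / 4 := by
    have : √T ≤ η / (16 * √(omg d)) := by
      rw [Real.sqrt_le_left (by positivity)]; exact min_le_right _ _
    rw [le_div_iff₀ (by positivity)] at this
    linarith
  obtain ⟨n, hn1, hn2⟩ := ((S.Gconv.eventually (gt_mem_nhds hε)).and (S.l1.eventually (gt_mem_nhds (show 0 < η / 4 * T ^ d by positivity)))).exists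
  have hgi : Integrable (fun y => ‖gradient (φ n) y - G y‖ ^ 2) := ((S.lc n).gbc.memLp 2).sub S.Gmem |>.integrable_norm_pow (by norm_num)
  have hmv : ∀ s, MeasurableSet s → (volume.withDensity fun y => ENNReal.ofReal (‖gradient (φ n) y - G y‖ ^ 2)) s = ENNReal.ofReal (∫ y in s, ‖gradient (φ n) y - G y‖ ^ 2) := fun s hs => by
    rw [withDensity_apply _ hs, ofReal_integral_eq_lintegral_ofReal hgi.integrableOn (.of_forall fun y => sq_nonneg _)]
  refine ⟨volume.withDensity fun y => ENNReal.ofReal (‖gradient (φ n) y - G y‖ ^ 2), ?_, fun x hx => ?_⟩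
  · rw [hmv _ MeasurableSet.univ, setIntegral_univ]; exact ENNReal.ofReal_le_ofReal hn1.le
  · by_contra hcon
    push Not at hcon
    obtain ⟨s, hs, hsT, hA⟩ := S.Asmall hx.1 n hT0 fun ρ hρ hρT => by
      have := hcon ρ hρ (hρT.trans ((min_le_left _ _).trans (min_le_left _ _)))
      rw [hmv _ measurableSet_closedBall] at this
      exact ((ENNReal.ofReal_lt_ofReal_iff (by positivity)).mp this).le
    have h2 := hx.2 s hs (hsT.trans ((min_le_left _ _).trans (min_le_right _ _)))
    have h3 : (∫ y, |φ n y - u y|) / T ^ d ≤ η / 4 := by rw [div_le_iff₀ (by positivity)]; exact hn2.le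
    linarith
end

section
variable {E : Set (Euc d)} {ν : Euc d → Euc d} {σ : Measure (Euc d)}

theorem Per.dev_int (P : Per E ν σ) (ν0 : Euc d) : Integrable (fun y => ‖ν y - ν0‖) σ := by
  haveI := P.fin
  refine Integrable.of_bound (C := 1 + ‖ν0‖) (P.mν.sub_const ν0).norm.aestronglyMeasurable (.of_forall fun y => ?_)
  rw [norm_norm]
  exact (norm_sub_le _ _).trans (by linarith [P.νle y])

theorem Per.tr (P : Per E ν σ) (hE : volume E ≠ ⊤) {k : Euc d → ℝ} (hk : LC k) (k0 : ∀ y, 0 ≤ k y) (k1 : ∀ y, k y ≤ 1)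
    {x : Euc d} {R : ℝ} (ks : ∀ y, y ∉ closedBall x R → k y = 0) {ν0 v : Euc d} (hv : 0 ≤ ⟪v, ν0⟫) :
    ∫ y, k y * (E.indicator (fun _ => (1:ℝ)) (y + v) - E.indicator (fun _ => (1:ℝ)) y) ≤ ‖v‖ * ∫ y in closedBall x (R + ‖v‖), ‖ν y - ν0‖ ∂σ := by
  haveI := P.fin
  set χ : Euc d → ℝ := E.indicator (fun _ => (1:ℝ)) with hχ
  have hχi : Integrable χ := (integrable_indicator_iff P.mE).mpr (integrableOn_const hE)
  have hi : ∀ z, Integrable (fun w => χ w * k (w + z)) := fun z => by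
    have h1 := (hk.trans z).bc
    obtain ⟨C, hC⟩ := h1.bd
    exact hχi.mul_bdd (c := C) h1.meas (.of_forall hC)
  have h1 := mono_of (g := fun s => s * (‖v‖ * ∫ y in closedBall x (R + ‖v‖), ‖ν y - ν0‖ ∂σ) - ∫ w, χ w * k (w + s • (-v)))
    (g' := fun s => 1 * (‖v‖ * ∫ y in closedBall x (R + ‖v‖), ‖ν y - ν0‖ ∂σ) - ∫ w, χ w * ⟪gradient k (w + s • (-v)), -v⟫) zero_le_one
    (fun s _ => ((hasDerivAt_id s).mul_const _).fun_sub (lemD hχi hk (-v) s)) (fun s hs => by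
      have e1 : ∫ w, χ w * ⟪gradient k (w + s • (-v)), -v⟫ = ∫ y, k (y + s • (-v)) * ⟪ν y, -v⟫ ∂σ := by
        rw [← P.eq _ (hk.trans (s • (-v))) (-v), ← integral_indicator P.mE]
        refine integral_congr_ae (.of_forall fun w => ?_)
        by_cases hw : w ∈ E
        · simp only [hχ, indicator_of_mem hw, one_mul]; rw [grad_trans]
        · simp only [hχ, indicator_of_notMem hw, zero_mul]
      rw [e1, one_mul, sub_nonneg, ← integral_indicator measurableSet_closedBall, ← integral_const_mul]
      refine integral_mono ?_ (((P.dev_int ν0).indicator measurableSet_closedBall).const_mul _) fun y => ?_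
      · exact (P.inner_int _).bdd_mul (c := 1) (hk.trans (s • (-v))).cont.aestronglyMeasurable
          (.of_forall fun y => by rw [Real.norm_eq_abs, abs_of_nonneg (k0 _)]; exact k1 _)
      beta_reduce
      by_cases hy : y ∈ closedBall x (R + ‖v‖)
      · rw [indicator_of_mem hy]
        have e2 : ⟪ν y, -v⟫ ≤ ‖v‖ * ‖ν y - ν0‖ := by
          have h1 : ⟪ν y, -v⟫ = -⟪v, ν0⟫ - ⟪v, ν y - ν0⟫ := by
            rw [inner_neg_right, inner_sub_right, real_inner_comm]; ring
          have h2 := abs_le.mp (abs_real_inner_le_norm v (ν y - ν0))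
          linarith [h2.1]
        have e3 : 0 ≤ ‖v‖ * ‖ν y - ν0‖ := by positivity
        nlinarith [k0 (y + s • (-v)), k1 (y + s • (-v))]
      · have : k (y + s • (-v)) = 0 := ks _ fun hc => hy (by
          rw [mem_closedBall, dist_eq_norm] at hc ⊢
          have h1 : ‖s • v‖ ≤ ‖v‖ := by
            rw [norm_smul, Real.norm_eq_abs, abs_of_nonneg hs.1]; nlinarith [norm_nonneg v, hs.2]
          calc ‖y - x‖ = ‖(y + s • (-v) - x) + s • v‖ := by congr 1; rw [smul_neg]; abel
            _ ≤ _ := (norm_add_le _ _).trans (add_le_add hc h1))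
        rw [this, indicator_of_notMem hy]; simp)
  beta_reduce at h1
  rw [zero_mul, zero_smul, one_mul, one_smul] at h1
  have h2 : ∫ y, k y * (χ (y + v) - χ y) = (∫ w, χ w * k (w + (-v))) - ∫ w, χ w * k (w + 0) := by
    rw [← int_trans (fun w => χ w * k (w + (-v))) v, ← integral_sub ((hi (-v)).comp_add_right v) (hi 0)]
    refine integral_congr_ae (.of_forall fun w => ?_)
    beta_reduce
    rw [add_zero, add_neg_cancel_right]; ring
  linarith

theorem Per.tv1 (P : Per E ν σ) (hE : volume E ≠ ⊤) (x : Euc d) (ρ : ℝ) {t : ℝ} (ht : 0 < t) {ν0 v : Euc d} (hv : 0 ≤ ⟪v, ν0⟫) :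
    mvol {y | y ∈ closedBall x ρ ∧ y ∉ E ∧ y + v ∈ E} ≤ ‖v‖ * ∫ y in closedBall x (ρ + t + ‖v‖), ‖ν y - ν0‖ ∂σ := by
  haveI := P.fin
  set A := {y | y ∈ closedBall x ρ ∧ y ∉ E ∧ y + v ∈ E} with hA
  set χ : Euc d → ℝ := E.indicator (fun _ => (1:ℝ)) with hχ
  have mA : MeasurableSet A := measurableSet_closedBall.inter (P.mE.compl.inter (P.mE.preimage (measurable_add_const v)))
  have fA : volume A ≠ ⊤ := measure_ne_top_of_subset (fun y hy => hy.1) (measure_closedBall_lt_top (x := x) (r := ρ)).ne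
  set g : Euc d → ℝ := A.indicator (fun _ => (1:ℝ)) with hg
  have gi : Integrable g := (integrable_indicator_iff mA).mpr (integrableOn_const fA)
  have g0 : ∀ y, 0 ≤ g y := fun y => indicator_nonneg (fun _ _ => zero_le_one) y
  have g1 : ∀ y, ‖g y‖ ≤ 1 := fun y => by
    rw [Real.norm_eq_abs, abs_of_nonneg (g0 y)]; exact indicator_le_self' (fun _ _ => zero_le_one) y
  have gs : ∀ y, y ∉ closedBall x ρ → g y = 0 := fun y hy => indicator_of_notMem (fun h => hy h.1) _
  have k0 : ∀ n y, 0 ≤ moll n g y := fun n y => by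
    rw [moll_eq]
    exact integral_nonneg fun s => smul_nonneg (ContDiffBump.nonneg_normed _ _) (g0 _)
  have kb := moll_bound g1
  have ks : ∀ (n : ℕ) (R : ℝ), ρ + 2 / ((n:ℝ) + 1) ≤ R → ∀ y, y ∉ closedBall x R → moll n g y = 0 := fun n R hR y hy => by
    by_contra hc
    have h1 := moll_tsupport g n (subset_tsupport _ hc)
    have h2 := cthickening_subset_of_subset (2 / ((n:ℝ) + 1)) (fun y (hy : g y ≠ 0) => by_contra fun h => hy (gs y h)) h1
    refine hy (closedBall_subset_closedBall hR ?_)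
    by_cases hρ : 0 ≤ ρ
    · rwa [cthickening_closedBall (by positivity) hρ, add_comm] at h2
    · rw [closedBall_eq_empty.mpr (not_le.mp hρ), cthickening_empty] at h2; exact h2.elim
  have klc : ∀ n, LC (moll n g) := fun n => smooth_LC (moll_smooth gi.locallyIntegrable n) (moll_cs ⟨ρ + ‖x‖, fun y hy => gs y fun hc => by
    rw [mem_closedBall, dist_eq_norm] at hc
    linarith [norm_le_norm_add_norm_sub' y x]⟩ n)
  have hχ1 : ∀ y, ‖χ y‖ ≤ 1 := fun y => by
    by_cases h : y ∈ E <;> simp [hχ, h]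
  have hχm : Measurable χ := measurable_const.indicator P.mE
  have lim : Tendsto (fun n => ∫ y, moll n g y * (χ (y + v) - χ y)) atTop (𝓝 (∫ y, g y * (χ (y + v) - χ y))) := by
    refine tendsto_integral_of_dominated_convergence ((closedBall x (ρ + 2)).indicator fun _ => 2) (fun n => ?_) ?_ (fun n => .of_forall fun y => ?_) ?_
    · exact (klc n).cont.aestronglyMeasurable.mul ((hχm.comp (measurable_add_const v)).sub hχm).aestronglyMeasurable
    · exact (integrable_indicator_iff measurableSet_closedBall).mpr (integrableOn_const (measure_closedBall_lt_top).ne)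
    · by_cases hy : y ∈ closedBall x (ρ + 2)
      · rw [indicator_of_mem hy, norm_mul]
        have h1 := kb n y
        have h2 := norm_sub_le (χ (y + v)) (χ y)
        nlinarith [hχ1 (y + v), hχ1 y, norm_nonneg (moll n g y), norm_nonneg (χ (y + v) - χ y)]
      · rw [ks n (ρ + 2) (by rw [add_le_add_iff_left, div_le_iff₀ (by positivity)]; linarith [n.cast_nonneg (α := ℝ)]) y hy, zero_mul, norm_zero, indicator_of_notMem hy]
    · filter_upwards [moll_ae gi.locallyIntegrable] with y hy using hy.mul_const _
  have e1 : ∫ y, g y * (χ (y + v) - χ y) = mvol A := by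
    rw [show (fun y => g y * (χ (y + v) - χ y)) = A.indicator fun _ => 1 from funext fun y => by
      by_cases h : y ∈ A
      · simp [hg, hχ, h, h.2.1, h.2.2]
      · simp [hg, h], integral_indicator mA, setIntegral_const, smul_eq_mul, mul_one]
    rfl
  rw [e1] at lim
  have l0 : Tendsto (fun n : ℕ => 2 / ((n:ℝ) + 1)) atTop (𝓝 0) := by
    simpa [div_eq_mul_inv] using (tendsto_one_div_add_atTop_nhds_zero_nat (𝕜 := ℝ)).const_mul 2
  refine le_of_tendsto lim ((l0.eventually_lt_const ht).mono fun n hn => ?_)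
  exact P.tr hE (klc n) (k0 n) (fun y => (le_abs_self _).trans (kb n y)) (ks n (ρ + t) (by linarith)) hv

/-- the basic double-counting inequality -/
theorem Per.dblT (P : Per E ν σ) (hE : volume E ≠ ⊤) {x ν0 : Euc d} {r t : ℝ} (ht : 0 < t) {Y Z : Set (Euc d)}
    (mY : MeasurableSet Y) (mZ : MeasurableSet Z) (hY : Y ⊆ closedBall x r) (hYE : ∀ y ∈ Y, y ∉ E) (hZE : Z ⊆ E)
    (hv : ∀ y ∈ Y, ∀ z ∈ Z, 0 ≤ ⟪z - y, ν0⟫) : MeasurableSet {p : Euc d × Euc d | p.1 ∈ Y ∧ p.2 ∈ Z ∧ dist p.2 p.1 ≤ t} ∧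
    (volume.prod volume) {p : Euc d × Euc d | p.1 ∈ Y ∧ p.2 ∈ Z ∧ dist p.2 p.1 ≤ t} ≤
      ENNReal.ofReal (t ^ d * omg d * (t * ∫ y in closedBall x (r + 2 * t), ‖ν y - ν0‖ ∂σ)) := by
  set T := {p : Euc d × Euc d | p.1 ∈ Y ∧ p.2 ∈ Z ∧ dist p.2 p.1 ≤ t} with hT
  set I := ∫ y in closedBall x (r + 2 * t), ‖ν y - ν0‖ ∂σ with hI
  have I0 : 0 ≤ I := integral_nonneg fun y => norm_nonneg _
  have mT : MeasurableSet T := (mY.preimage measurable_fst).inter ((mZ.preimage measurable_snd).inter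
    (measurableSet_le (measurable_snd.dist measurable_fst) measurable_const))
  refine ⟨mT, ?_⟩
  have hm := measurePreserving_prod_add (volume : Measure (Euc d)) (volume : Measure (Euc d))
  rw [← hm.measure_preimage mT.nullMeasurableSet, Measure.prod_apply_symm (hm.measurable mT)]
  have h1 : ∀ v : Euc d, volume ((fun y => (y, v)) ⁻¹' ((fun z : Euc d × Euc d => (z.1, z.1 + z.2)) ⁻¹' T)) ≤
      (closedBall (0 : Euc d) t).indicator (fun _ => ENNReal.ofReal (t * I)) v := fun v => by
    set B := (fun y => (y, v)) ⁻¹' ((fun z : Euc d × Euc d => (z.1, z.1 + z.2)) ⁻¹' T) with hB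
    have hb : ∀ y ∈ B, y ∈ Y ∧ y + v ∈ Z ∧ ‖v‖ ≤ t := fun y hy => ⟨hy.1, hy.2.1, by simpa [dist_eq_norm] using hy.2.2⟩
    rcases B.eq_empty_or_nonempty with h0 | ⟨y0, h0⟩
    · rw [h0, measure_empty]; exact zero_le
    have h0 := hb y0 h0
    rw [indicator_of_mem (by simpa using h0.2.2)]
    have h2 := P.tv1 hE x r ht (ν0 := ν0) (v := v) (by simpa using hv _ h0.1 _ h0.2.1)
    have h3 : volume B ≤ ENNReal.ofReal (mvol {y | y ∈ closedBall x r ∧ y ∉ E ∧ y + v ∈ E}) := by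
      rw [mvol, ENNReal.ofReal_toReal (measure_ne_top_of_subset (fun y hy => hy.1) (measure_closedBall_lt_top (x := x) (r := r)).ne)]
      exact measure_mono fun y hy => ⟨hY (hb y hy).1, hYE _ (hb y hy).1, hZE (hb y hy).2.1⟩
    refine h3.trans (ENNReal.ofReal_le_ofReal (h2.trans (mul_le_mul h0.2.2 ?_ (integral_nonneg fun y => norm_nonneg _) ht.le)))
    exact setIntegral_mono_set (P.dev_int ν0).integrableOn (.of_forall fun y => norm_nonneg _)
      (HasSubset.Subset.eventuallyLE (closedBall_subset_closedBall (by linarith [h0.2.2])))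
  refine (lintegral_mono h1).trans ?_
  rw [lintegral_indicator measurableSet_closedBall, setLIntegral_const, mul_comm,
    ← ENNReal.ofReal_toReal (measure_closedBall_lt_top (μ := volume) (x := (0 : Euc d)) (r := t)).ne, ← ENNReal.ofReal_mul ENNReal.toReal_nonneg]
  exact ENNReal.ofReal_le_ofReal (le_of_eq (by rw [show (volume (closedBall (0 : Euc d) t)).toReal = t ^ d * omg d from mvol_closedBall 0 ht.le]))

theorem slice_le {S : Set (Euc d)} {F : Euc d → ℝ≥0∞} {c A : ℝ} (mS : MeasurableSet S) (hc : 0 ≤ c) (hA : 0 ≤ A) (h : ∀ y ∈ S, ENNReal.ofReal c ≤ F y)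
    (hF : ∫⁻ y, F y ≤ ENNReal.ofReal A) : c * mvol S ≤ A := by
  have h1 : ENNReal.ofReal c * volume S ≤ ENNReal.ofReal A := by
    rw [← setLIntegral_const]
    exact ((setLIntegral_mono' mS h).trans (setLIntegral_le_lintegral _ _)).trans hF
  have h2 := ENNReal.toReal_mono ENNReal.ofReal_ne_top h1
  rwa [ENNReal.toReal_mul, ENNReal.toReal_ofReal hc, ENNReal.toReal_ofReal hA] at h2

theorem Per.dblY (P : Per E ν σ) (hE : volume E ≠ ⊤) {x ν0 : Euc d} {r t : ℝ} (ht : 0 < t) {Y Z : Set (Euc d)}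
    (mY : MeasurableSet Y) (mZ : MeasurableSet Z) (hY : Y ⊆ closedBall x r) (hYE : ∀ y ∈ Y, y ∉ E) (hZE : Z ⊆ E)
    (hv : ∀ y ∈ Y, ∀ z ∈ Z, 0 ≤ ⟪z - y, ν0⟫) {c : ℝ} (hc : 0 ≤ c) (h : ∀ y ∈ Y, c ≤ mvol (Z ∩ closedBall y t)) :
    c * mvol Y ≤ t ^ d * omg d * (t * ∫ y in closedBall x (r + 2 * t), ‖ν y - ν0‖ ∂σ) := by
  have I0 : 0 ≤ ∫ y in closedBall x (r + 2 * t), ‖ν y - ν0‖ ∂σ := integral_nonneg fun y => norm_nonneg _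
  have o := omg_pos (d := d)
  obtain ⟨h1, h2⟩ := P.dblT hE ht mY mZ hY hYE hZE hv
  rw [Measure.prod_apply h1] at h2
  refine slice_le mY hc (by positivity) (fun y hy => ?_) h2
  refine (ENNReal.ofReal_le_ofReal (h y hy)).trans (ENNReal.ofReal_toReal_le.trans (measure_mono fun z hz => ⟨hy, hz.1, hz.2⟩))

theorem Per.dblZ (P : Per E ν σ) (hE : volume E ≠ ⊤) {x ν0 : Euc d} {r t : ℝ} (ht : 0 < t) {Y Z : Set (Euc d)}
    (mY : MeasurableSet Y) (mZ : MeasurableSet Z) (hY : Y ⊆ closedBall x r) (hYE : ∀ y ∈ Y, y ∉ E) (hZE : Z ⊆ E)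
    (hv : ∀ y ∈ Y, ∀ z ∈ Z, 0 ≤ ⟪z - y, ν0⟫) {c : ℝ} (hc : 0 ≤ c) (h : ∀ z ∈ Z, c ≤ mvol (Y ∩ closedBall z t)) :
    c * mvol Z ≤ t ^ d * omg d * (t * ∫ y in closedBall x (r + 2 * t), ‖ν y - ν0‖ ∂σ) := by
  have I0 : 0 ≤ ∫ y in closedBall x (r + 2 * t), ‖ν y - ν0‖ ∂σ := integral_nonneg fun y => norm_nonneg _
  have o := omg_pos (d := d)
  obtain ⟨h1, h2⟩ := P.dblT hE ht mY mZ hY hYE hZE hv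
  rw [Measure.prod_apply_symm h1] at h2
  refine slice_le mZ hc (by positivity) (fun z hz => ?_) h2
  refine (ENNReal.ofReal_le_ofReal (h z hz)).trans (ENNReal.ofReal_toReal_le.trans (measure_mono fun y hy => ⟨hy.1, hz, ?_⟩))
  rw [dist_comm]; exact hy.2
end

section
variable {E : Set (Euc d)} {ν : Euc d → Euc d} {σ : Measure (Euc d)}

/-- good (Lebesgue) points of the perimeter measure -/
def GP (ν : Euc d → Euc d) (σ : Measure (Euc d)) (x : Euc d) : Prop :=
  ‖ν x‖ = 1 ∧ (∀ r, 0 < r → 0 < σ (closedBall x r)) ∧ ∀ ε > 0, ∃ R > 0, ∀ r, 0 < r → r ≤ R →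
    ∫ y in closedBall x r, ‖ν y - ν x‖ ∂σ ≤ ε * σ.real (closedBall x r)

theorem Per.gp_ae (P : Per E ν σ) : ∀ᵐ x ∂σ, GP ν σ x := by
  haveI := P.fin
  have hi : Integrable ν σ := Integrable.of_bound (C := 1) P.mν.aestronglyMeasurable (.of_forall P.νle)
  filter_upwards [P.ν1, (Besicovitch.vitaliFamily σ).ae_eventually_measure_pos,
    (Besicovitch.vitaliFamily σ).ae_tendsto_average_norm_sub hi.locallyIntegrable] with x h1 h2 h3
  have h2 := (Besicovitch.tendsto_filterAt σ x).eventually h2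
  have h3 := h3.comp (Besicovitch.tendsto_filterAt σ x)
  refine ⟨h1, fun r hr => ?_, fun ε hε => ?_⟩
  · obtain ⟨s, hs, hs2⟩ := (h2.and (Ioo_mem_nhdsGT hr)).exists
    exact hs.trans_le (measure_mono (closedBall_subset_closedBall hs2.2.le))
  · obtain ⟨R, hR, h⟩ := (mem_nhdsGT_iff_exists_Ioc_subset).mp (h2.and (h3.eventually_lt_const hε))
    refine ⟨R, hR, fun r hr hrR => ?_⟩
    obtain ⟨h4, h5⟩ := h ⟨hr, hrR⟩
    have h6 : 0 < σ.real (closedBall x r) := ENNReal.toReal_pos h4.ne' (measure_ne_top _ _)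
    simp only [Function.comp] at h5
    rw [setAverage_eq, smul_eq_mul, inv_mul_lt_iff₀ h6] at h5
    linarith

theorem cut_flux {F : Set (Euc d)} (mF : MeasurableSet F) (x : Euc d) (ρ : ℝ) {δ : ℝ} (hδ : 0 < δ) (e : Euc d) :
    |∫ y in F, ⟪gradient (cut x ρ δ) y, e⟫| ≤ 1 / δ * ‖e‖ * mvol (F ∩ closedBall x (ρ + δ)) := by
  have h1 : ∫ y in F, ⟪gradient (cut x ρ δ) y, e⟫ = ∫ y in F ∩ closedBall x (ρ + δ), ⟪gradient (cut x ρ δ) y, e⟫ := by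
    refine setIntegral_eq_of_subset_of_forall_sdiff_eq_zero mF inter_subset_left fun y hy => ?_
    have h2 : gradient (cut x ρ δ) y = 0 := by
      rw [(cut_ev x hδ (fun h => hy.2 ⟨hy.1, h⟩) : cut x ρ δ =ᶠ[𝓝 y] _).gradient_eq]; exact gradient_const _ _
    rw [h2, inner_zero_left]
  rw [h1, ← Real.norm_eq_abs]
  exact norm_setIntegral_le_of_norm_le_const (measure_ne_top_of_subset inter_subset_right (measure_closedBall_lt_top (x := x)).ne).lt_top
    fun y _ => (norm_inner_le_norm _ _).trans (mul_le_mul_of_nonneg_right (cut_grad x ρ hδ y) (norm_nonneg _))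

theorem cut_layer (P : Per E ν σ) {x ν0 : Euc d} {R : ℝ} {ε : ℝ} (hε : 0 ≤ ε) (h : ∀ r, 0 < r → r ≤ R → ∫ y in closedBall x r, ‖ν y - ν0‖ ∂σ ≤ ε * σ.real (closedBall x r))
    {ρ δ : ℝ} (hρ : 0 < ρ) (hδ : 0 < δ) (hR : ρ + δ ≤ R) : ∫ y, ‖ν y - ν0‖ * cut x ρ δ y ∂σ ≤ ε * ∫ y, cut x ρ δ y ∂σ := by
  haveI := P.fin
  have hc := (cut_lc x ρ hδ).cont
  have hci : Integrable (cut x ρ δ) σ := memLp_one_iff_integrable.mp ((cut_lc x ρ hδ).memLps 1 σ)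
  have c0 := cut_nonneg x ρ δ
  have hp : Integrable (fun y => ‖ν y - ν0‖ * cut x ρ δ y) σ := (P.dev_int ν0).mul_bdd (c := 1) hc.aestronglyMeasurable
    (.of_forall fun y => by rw [Real.norm_eq_abs, abs_of_nonneg (c0 y)]; exact cut_le_one _ _ _ _)
  have hm : Measurable fun y => ENNReal.ofReal ‖ν y - ν0‖ := (P.mν.sub_const ν0).norm.ennreal_ofReal
  have key : ∫⁻ y, ENNReal.ofReal (cut x ρ δ y) ∂(σ.withDensity fun y => ENNReal.ofReal ‖ν y - ν0‖) ≤ ENNReal.ofReal ε * ∫⁻ y, ENNReal.ofReal (cut x ρ δ y) ∂σ := by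
    rw [lintegral_eq_lintegral_meas_le _ (.of_forall c0) hc.aemeasurable, lintegral_eq_lintegral_meas_le _ (.of_forall c0) hc.aemeasurable,
      ← lintegral_const_mul' _ _ ENNReal.ofReal_ne_top]
    refine setLIntegral_mono' measurableSet_Ioi fun t ht => ?_
    rcases le_or_gt t 1 with h1 | h1
    · have e1 : {y | t ≤ cut x ρ δ y} = closedBall x (ρ + δ - t * δ) := by
        ext y
        rw [mem_ofPred_eq, cut, le_max_iff, le_min_iff, le_div_iff₀ hδ, mem_closedBall, dist_eq_norm]
        constructor
        · rintro (h2 | h2)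
          · linarith [h2.1]
          · exact absurd h2 (not_le.mpr ht)
        · intro h2; exact Or.inl ⟨by linarith, h1⟩
      have ht' : 0 < t := ht
      rw [e1, withDensity_apply _ measurableSet_closedBall, ← ofReal_integral_eq_lintegral_ofReal (P.dev_int ν0).integrableOn (.of_forall fun y => norm_nonneg _),
        ← ofReal_measureReal, ← ENNReal.ofReal_mul hε]
      exact ENNReal.ofReal_le_ofReal (h _ (by nlinarith) (by nlinarith))
    · have e1 : {y | t ≤ cut x ρ δ y} = ∅ := by
        ext y; simp only [mem_ofPred_eq, mem_empty_iff_false, iff_false, not_le]; exact (cut_le_one x ρ δ y).trans_lt h1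
      rw [e1]; simp
  rw [lintegral_withDensity_eq_lintegral_mul _ hm hc.measurable.ennreal_ofReal] at key
  simp only [Pi.mul_apply, ← ENNReal.ofReal_mul (norm_nonneg _)] at key
  rw [← ofReal_integral_eq_lintegral_ofReal hp (.of_forall fun y => mul_nonneg (norm_nonneg _) (c0 y)),
    ← ofReal_integral_eq_lintegral_ofReal hci (.of_forall c0), ← ENNReal.ofReal_mul hε] at key
  exact (ENNReal.ofReal_le_ofReal_iff (mul_nonneg hε (integral_nonneg c0))).mp key

theorem Per.lp (P : Per E ν σ) {x ν0 : Euc d} (h1 : ‖ν0‖ = 1) {R : ℝ} (h : ∀ r, 0 < r → r ≤ R → ∫ y in closedBall x r, ‖ν y - ν0‖ ∂σ ≤ 1 / 2 * σ.real (closedBall x r))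
    {ρ δ : ℝ} (hρ : 0 < ρ) (hδ : 0 < δ) (hR : ρ + δ ≤ R) {F : Set (Euc d)} (hF : F = E ∨ F = Eᶜ) :
    σ.real (closedBall x ρ) ≤ 2 / δ * mvol (F ∩ closedBall x (ρ + δ)) := by
  haveI := P.fin
  have hl := cut_lc x ρ hδ
  have hci : Integrable (cut x ρ δ) σ := memLp_one_iff_integrable.mp (hl.memLps 1 σ)
  have c0 := cut_nonneg x ρ δ
  have hcb : ∀ᵐ y ∂σ, ‖cut x ρ δ y‖ ≤ 1 := .of_forall fun y => by rw [Real.norm_eq_abs, abs_of_nonneg (c0 y)]; exact cut_le_one _ _ _ _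
  have e1 := cut_layer P (by norm_num) h hρ hδ hR
  have e2 : σ.real (closedBall x ρ) ≤ ∫ y, cut x ρ δ y ∂σ := by
    rw [← integral_indicator_one measurableSet_closedBall]
    refine integral_mono ((integrable_indicator_iff measurableSet_closedBall).mpr (integrable_const _)) hci fun y => ?_
    by_cases hy : y ∈ closedBall x ρ
    · rw [indicator_of_mem hy, cut_one hδ (by rwa [mem_closedBall, dist_eq_norm] at hy)]; rfl
    · rw [indicator_of_notMem hy]; exact c0 y
  have e3 : (∫ y, cut x ρ δ y ∂σ) ≤ (∫ y, ‖ν y - ν0‖ * cut x ρ δ y ∂σ) + ∫ y, cut x ρ δ y * ⟪ν y, ν0⟫ ∂σ := by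
    have i1 : Integrable (fun y => ‖ν y - ν0‖ * cut x ρ δ y) σ := (P.dev_int ν0).mul_bdd (c := 1) hl.cont.aestronglyMeasurable hcb
    have i2 : Integrable (fun y => cut x ρ δ y * ⟪ν y, ν0⟫) σ := (P.inner_int ν0).bdd_mul (c := 1) hl.cont.aestronglyMeasurable hcb
    rw [← integral_add i1 i2]
    refine integral_mono hci (i1.add i2) fun y => ?_
    have h2 := (abs_le.mp (abs_real_inner_le_norm (ν y - ν0) ν0)).1
    rw [inner_sub_left, real_inner_self_eq_norm_sq, h1] at h2
    beta_reduce
    nlinarith [c0 y]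
  have e4 : |∫ y, cut x ρ δ y * ⟪ν y, ν0⟫ ∂σ| = |∫ y in F, ⟪gradient (cut x ρ δ) y, ν0⟫| := by
    rw [← P.eq _ hl ν0]
    rcases hF with rfl | rfl
    · rfl
    · have h2 := integral_add_compl P.mE (hl.gbc.innerc ν0).integrable
      rw [int_grad_zero hl] at h2
      rw [eq_neg_of_add_eq_zero_left h2, abs_neg]
  have mF : MeasurableSet F := by rcases hF with rfl | rfl; exacts [P.mE, P.mE.compl]
  have e5 := cut_flux mF x ρ hδ ν0
  rw [← e4, h1, mul_one] at e5
  have e6 := le_abs_self (∫ y, cut x ρ δ y * ⟪ν y, ν0⟫ ∂σ)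
  rw [show 2 / δ = 2 * (1 / δ) by ring]
  linarith
end

section
variable {E : Set (Euc d)} {ν : Euc d → Euc d} {σ : Measure (Euc d)}

theorem mvol_split {A : Set (Euc d)} (mA : MeasurableSet A) (y : Euc d) {t : ℝ} (ht : 0 ≤ t) :
    mvol (A ∩ closedBall y t) + mvol (Aᶜ ∩ closedBall y t) = t ^ d * omg d := by
  have h := measureReal_inter_add_sdiff (μ := volume) (s := closedBall y t) mA (measure_closedBall_lt_top).ne
  rw [← mvol_closedBall y ht]
  refine Eq.trans ?_ h
  rw [inter_comm, inter_comm Aᶜ]; rfl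

theorem Per.I_le (P : Per E ν σ) (x : Euc d) (r : ℝ) : ∫ y in closedBall x r, ‖ν y - 0‖ ∂σ ≤ σ.real (closedBall x r) := by
  haveI := P.fin
  refine (setIntegral_mono (P.dev_int 0).integrableOn (integrable_const (1:ℝ)) fun y => ?_).trans ?_
  · beta_reduce; rw [sub_zero]; exact P.νle y
  · simp

theorem Per.dens_aux (P : Per E ν σ) (hE : volume E ≠ ⊤) {x ν0 : Euc d} (h1 : ‖ν0‖ = 1) {R : ℝ}
    (h : ∀ r, 0 < r → r ≤ R → ∫ y in closedBall x r, ‖ν y - ν0‖ ∂σ ≤ 1 / 2 * σ.real (closedBall x r)) {F : Set (Euc d)} (hF : F = E ∨ F = Eᶜ)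
    {s h' t : ℝ} (hh : 0 < h') (ht : 0 < t) (hth : 8 * t ≤ h') (hs : 0 < s - h') (hsR : s ≤ R) (hV : mvol (F ∩ closedBall x s) ≤ omg d / 2 * t ^ d) :
    mvol (F ∩ closedBall x (s - h')) ≤ 8 * (t / h') * mvol (F ∩ closedBall x s) := by
  have o := omg_pos (d := d)
  have sm : ∀ y ∈ closedBall x (s - h'), F ∩ closedBall y t ⊆ F ∩ closedBall x s := fun y hy =>
    inter_subset_inter_right _ (closedBall_subset_closedBall' (by rw [mem_closedBall] at hy; linarith))
  have fx : volume (F ∩ closedBall x s) ≠ ⊤ := measure_ne_top_of_subset inter_subset_right (measure_closedBall_lt_top (x := x) (r := s)).ne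
  have c0 : 0 ≤ t ^ d * omg d / 2 := by positivity
  have mF : MeasurableSet F := by rcases hF with rfl | rfl; exacts [P.mE, P.mE.compl]
  have cb : ∀ y ∈ closedBall x (s - h'), t ^ d * omg d / 2 ≤ mvol (Fᶜ ∩ closedBall y t) := fun y hy => by
    have h2 := mvol_split mF y ht.le
    have h3 := mvol_mono (sm y hy) fx
    linarith
  have main : t ^ d * omg d / 2 * mvol (F ∩ closedBall x (s - h')) ≤ t ^ d * omg d * (t * σ.real (closedBall x (s - h' / 2))) := by
    have mo : ∀ r ≤ s - h' / 2, t ^ d * omg d * (t * ∫ y in closedBall x r, ‖ν y - 0‖ ∂σ) ≤ t ^ d * omg d * (t * σ.real (closedBall x (s - h' / 2))) := fun r hr => by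
      haveI := P.fin
      have h2 : σ.real (closedBall x r) ≤ σ.real (closedBall x (s - h' / 2)) := measureReal_mono (closedBall_subset_closedBall hr) (measure_ne_top _ _)
      have h3 := (P.I_le x r).trans h2
      gcongr
    rcases hF with rfl | rfl
    · refine (P.dblZ hE (x := x) (r := s - h' + t) (ν0 := 0) ht (P.mE.compl.inter measurableSet_closedBall) (P.mE.inter measurableSet_closedBall) inter_subset_right (fun y hy => hy.1) inter_subset_left
        (fun y _ z _ => by rw [inner_zero_right]) c0 (fun z hz => (cb z hz.2).trans (mvol_mono ?_ (measure_ne_top_of_subset inter_subset_right (measure_closedBall_lt_top (x := z) (r := t)).ne)))).trans (mo _ (by linarith))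
      exact fun y hy => ⟨⟨hy.1, closedBall_subset_closedBall' (by have := hz.2; rw [mem_closedBall] at this; linarith) hy.2⟩, hy.2⟩
    · refine (P.dblY hE (x := x) (r := s - h') (Z := E) (ν0 := 0) ht (P.mE.compl.inter measurableSet_closedBall) P.mE inter_subset_right (fun y hy => hy.1) Subset.rfl
        (fun y _ z _ => by rw [inner_zero_right]) c0 (fun y hy => ?_)).trans (mo _ (by linarith))
      have := cb y hy.2
      rwa [compl_compl] at this
  have h2 := P.lp h1 h (ρ := s - h' / 2) (δ := h' / 2) (by linarith) (by linarith) (by linarith) hF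
  rw [sub_add_cancel] at h2
  have h3 : t ^ d * omg d / 2 * mvol (F ∩ closedBall x (s - h')) ≤ t ^ d * omg d / 2 * (8 * (t / h') * mvol (F ∩ closedBall x s)) := by
    refine main.trans ((mul_le_mul_of_nonneg_left (mul_le_mul_of_nonneg_left h2 ht.le) (by positivity)).trans (le_of_eq (by field_simp; ring)))
  exact le_of_mul_le_mul_left h3 (by positivity)

theorem Per.dens (hd : 0 < d) : ∃ c > 0, ∀ {E : Set (Euc d)} {ν : Euc d → Euc d} {σ : Measure (Euc d)} (_ : Per E ν σ) (_ : volume E ≠ ⊤) {x ν0 : Euc d} (_ : ‖ν0‖ = 1)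
    (_ : ∀ r, 0 < r → 0 < σ (closedBall x r)) {R : ℝ}
    (_ : ∀ r, 0 < r → r ≤ R → ∫ y in closedBall x r, ‖ν y - ν0‖ ∂σ ≤ 1 / 2 * σ.real (closedBall x r)) {F : Set (Euc d)} (_ : F = E ∨ F = Eᶜ)
    {r : ℝ} (_ : 0 < r) (_ : r ≤ R), c * r ^ d ≤ mvol (F ∩ closedBall x r) := by
  have o := omg_pos (d := d)
  obtain ⟨κ, hκ, H⟩ := FG d 0 1 le_rfl (κ0 := omg d / 2) (C := 8) (by positivity) (by norm_num)
  refine ⟨κ, hκ, fun {E ν σ} P hE {x ν0} h1 hp {R} h {F} hF {r} hr hrR => ?_⟩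
  haveI := P.fin
  by_contra hc
  have fx : ∀ s, volume (F ∩ closedBall x s) ≠ ⊤ := fun s => measure_ne_top_of_subset inter_subset_right (measure_closedBall_lt_top (x := x) (r := s)).ne
  have hmono : Monotone fun s => mvol (F ∩ closedBall x s) := fun s s' hs => mvol_mono (inter_subset_inter_right _ (closedBall_subset_closedBall hs)) (fx s')
  have h0 := H (fun s => mvol (F ∩ closedBall x s)) r hr (fun s => mvol_nonneg _) hmono (fun s h' t hh ht htr hsr hs hV => by
    rw [pow_zero, mul_one] at hV
    rw [pow_one]
    rcases le_or_gt (8 * t) h' with h8 | h8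
    · exact P.dens_aux hE h1 h hF hh ht h8 (by linarith) (by linarith) hV
    · have h2 : 1 ≤ 8 * (t / h') := by rw [← mul_div_assoc, le_div_iff₀ hh]; linarith
      exact (hmono (by linarith : s - h' ≤ s)).trans (le_mul_of_one_le_left (mvol_nonneg _) h2)) (not_le.mp hc).le
  have h2 := P.lp h1 h (ρ := r / 4) (δ := r / 4) (by linarith) (by linarith) (by linarith) hF
  rw [show r / 4 + r / 4 = r / 2 by ring, show mvol (F ∩ closedBall x (r / 2)) = 0 from h0, mul_zero] at h2
  exact absurd (ENNReal.toReal_pos (hp (r / 4) (by linarith)).ne' (measure_ne_top _ _)) (not_lt.mpr h2)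

theorem Per.pair (P : Per E ν σ) (hE : volume E ≠ ⊤) {x ν0 : Euc d} {r : ℝ} (hr : 0 < r) {Y Z : Set (Euc d)}
    (mY : MeasurableSet Y) (mZ : MeasurableSet Z) (hY : Y ⊆ closedBall x r) (hZ : Z ⊆ closedBall x r) (hYE : ∀ y ∈ Y, y ∉ E) (hZE : Z ⊆ E)
    (hv : ∀ y ∈ Y, ∀ z ∈ Z, 0 ≤ ⟪z - y, ν0⟫) :
    mvol Z * mvol Y ≤ (2 * r) ^ d * omg d * (2 * r * ∫ y in closedBall x (5 * r), ‖ν y - ν0‖ ∂σ) := by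
  have := P.dblY hE (x := x) (ν0 := ν0) (r := r) (t := 2 * r) (by linarith) mY mZ hY hYE hZE hv (mvol_nonneg Z) (fun y hy => by
    rw [inter_eq_left.mpr fun z hz => ?_]
    have h1 := hY hy
    have h2 := hZ hz
    rw [mem_closedBall] at h1 h2 ⊢
    linarith [dist_triangle_right z y x])
  rwa [show r + 2 * (2 * r) = 5 * r by ring] at this
end

section
variable {E : Set (Euc d)} {ν : Euc d → Euc d} {σ : Measure (Euc d)}

theorem slab {ν0 : Euc d} (h1 : ‖ν0‖ = 1) (x : Euc d) {η : ℝ} (hη : 0 < η) : ∃ θ, 0 < θ ∧ θ ≤ 1 ∧ ∀ r, 0 < r →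
    mvol {y | y ∈ closedBall x r ∧ |⟪y - x, ν0⟫| ≤ θ * r} ≤ η * r ^ d := by
  set f : Euc d → ℝ := fun y => innerSL ℝ ν0 y - ⟪ν0, x⟫ with hf
  have hfe : ∀ y, f y = ⟪y - x, ν0⟫ := fun y => by rw [hf, inner_sub_left]; simp [real_inner_comm]
  have hl : LipschitzWith ‖innerSL ℝ ν0‖₊ f := LipschitzWith.of_dist_le_mul fun y z => by
    rw [hf]; beta_reduce; rw [dist_sub_right]; exact (innerSL ℝ ν0).lipschitz.dist_le_mul y z
  have hz : volume {y | f y = 0} = 0 := by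
    have h2 := grad_zero_ae hl 0
    refine measure_mono_null (show {y | f y = 0} ⊆ {y | ¬ (f y = 0 → gradient f y = 0)} from fun y hy hc => ?_) h2
    have h3 := inner_grad f y ν0
    rw [hc hy, inner_zero_left, hf, fderiv_sub_const, ContinuousLinearMap.fderiv, innerSL_apply_apply, real_inner_self_eq_norm_sq, h1] at h3
    norm_num at h3
  set S : ℕ → Set (Euc d) := fun n => {y | y ∈ closedBall x 1 ∧ |f y| ≤ 1 / ((n:ℝ) + 1)} with hS
  have hfc : Continuous f := hl.continuous
  have hSm : ∀ n, MeasurableSet (S n) := fun n => measurableSet_closedBall.inter (measurableSet_le hfc.abs.measurable measurable_const)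
  have hSf : ∀ n, volume (S n) ≠ ⊤ := fun n => measure_ne_top_of_subset (fun y hy => hy.1) (measure_closedBall_lt_top (x := x) (r := 1)).ne
  have lim := tendsto_measure_iInter_atTop (μ := volume) (s := S) (fun n => (hSm n).nullMeasurableSet) (fun n m hnm y hy => ⟨hy.1, hy.2.trans (by
    have : (n:ℝ) ≤ m := by exact_mod_cast hnm
    gcongr)⟩) ⟨0, hSf 0⟩
  have h0 : volume (⋂ n, S n) = 0 := measure_mono_null (show (⋂ n, S n) ⊆ {y | f y = 0} from fun y hy => by
    rw [mem_iInter] at hy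
    exact abs_nonpos_iff.mp (ge_of_tendsto' (tendsto_one_div_add_atTop_nhds_zero_nat (𝕜 := ℝ)) fun n => (hy n).2)) hz
  rw [h0] at lim
  obtain ⟨n, hn⟩ := (lim.eventually_lt_const (ENNReal.ofReal_pos.mpr hη)).exists
  refine ⟨1 / ((n:ℝ) + 1), by positivity, by rw [div_le_one (by positivity)]; linarith [n.cast_nonneg (α := ℝ)], fun r hr => ?_⟩
  have hsub : {y | y ∈ closedBall x r ∧ |⟪y - x, ν0⟫| ≤ 1 / ((n:ℝ) + 1) * r} ⊆ AffineMap.homothety x r '' S n := fun y hy => by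
    refine ⟨r⁻¹ • (y - x) + x, ⟨?_, ?_⟩, ?_⟩
    · have := hy.1
      rw [mem_closedBall, dist_eq_norm] at this ⊢
      rw [add_sub_cancel_right, norm_smul, norm_inv, Real.norm_eq_abs, abs_of_pos hr, inv_mul_le_iff₀ hr]; linarith
    · rw [hfe, add_sub_cancel_right, inner_smul_left, abs_mul]
      simp only [conj_trivial]
      rw [abs_inv, abs_of_pos hr, inv_mul_le_iff₀ hr]; linarith [hy.2]
    · rw [AffineMap.homothety_apply, vsub_eq_sub, vadd_eq_add, add_sub_cancel_right, smul_smul, mul_inv_cancel₀ hr.ne', one_smul, sub_add_cancel]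
  have h2 : volume (AffineMap.homothety x r '' S n) ≤ ENNReal.ofReal (η * r ^ d) := by
    rw [Measure.addHaar_image_homothety, finrank_euclideanSpace_fin, abs_of_pos (by positivity), mul_comm η, ENNReal.ofReal_mul (by positivity)]
    gcongr
    exact hn.le
  exact ENNReal.toReal_le_of_le_ofReal (by positivity) ((measure_mono hsub).trans h2)

theorem Per.reduced (hd : 0 < d) (P : Per E ν σ) (hE : volume E ≠ ⊤) {x : Euc d} (hx : GP ν σ x) : x ∈ reducedBoundary E := by
  haveI := P.fin
  obtain ⟨h1, hp, hL⟩ := hx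
  have o := omg_pos (d := d)
  obtain ⟨c, hc, Hc⟩ := Per.dens hd
  obtain ⟨R0, hR0, h0⟩ := hL (1 / 2) (by norm_num)
  refine ⟨ν x, h1, ?_⟩
  rw [ENNReal.tendsto_nhds_zero]
  intro η' hη'
  obtain ⟨η, hη, hηη⟩ : ∃ η : ℝ, 0 < η ∧ ENNReal.ofReal (3 * η) ≤ η' := by
    rcases eq_or_ne η' ⊤ with rfl | ht
    · exact ⟨1, one_pos, le_top⟩
    · exact ⟨η'.toReal / 3, div_pos (ENNReal.toReal_pos hη'.ne' ht) (by norm_num), by rw [mul_div_cancel₀ _ (by norm_num : (3:ℝ) ≠ 0), ENNReal.ofReal_toReal ht]⟩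
  obtain ⟨θ, hθ, hθ1, hs⟩ := slab h1 x hη
  set K : ℝ := 4 * 12 ^ d * omg d ^ 2 with hK
  have hK0 : 0 < K := by positivity
  obtain ⟨R1, hR1, hl⟩ := hL (η * c * θ ^ d / K) (by positivity)
  have hR : 0 < min R0 R1 / 6 := by positivity
  filter_upwards [Ioo_mem_nhdsGT hR] with r hr
  have r0 : 0 < r := hr.1
  have hrR0 : 6 * r ≤ R0 := by have := hr.2; have := min_le_left R0 R1; linarith
  have hrR1 : 6 * r ≤ R1 := by have := hr.2; have := min_le_right R0 R1; linarith
  have hI : (2 * r) ^ d * omg d * (2 * r * ∫ y in closedBall x (5 * r), ‖ν y - ν x‖ ∂σ) ≤ η * c * θ ^ d * (r ^ d) ^ 2 := by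
    have e1 := hl (5 * r) (by linarith) (by linarith)
    have e2 := P.lp h1 h0 (ρ := 5 * r) (δ := r) (by linarith) r0 (by linarith) (Or.inl rfl)
    have e3 : mvol (E ∩ closedBall x (5 * r + r)) ≤ (6 * r) ^ d * omg d := by
      rw [← mvol_closedBall x (by linarith), show 5 * r + r = 6 * r by ring]
      exact mvol_mono inter_subset_right (measure_closedBall_lt_top).ne
    have e4 : σ.real (closedBall x (5 * r)) ≤ 2 / r * ((6 * r) ^ d * omg d) := e2.trans (by gcongr)
    have e5 : ∫ y in closedBall x (5 * r), ‖ν y - ν x‖ ∂σ ≤ η * c * θ ^ d / K * (2 / r * ((6 * r) ^ d * omg d)) := e1.trans (by gcongr)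
    refine (mul_le_mul_of_nonneg_left (mul_le_mul_of_nonneg_left e5 (by positivity)) (by positivity)).trans (le_of_eq ?_)
    rw [hK, show (12:ℝ) ^ d = 2 ^ d * 6 ^ d by rw [← mul_pow]; norm_num, mul_pow, mul_pow]
    field_simp; ring
  have hd1 : ∀ F : Set (Euc d), F = E ∨ F = Eᶜ → c * (θ * r) ^ d ≤ mvol (F ∩ closedBall x (θ * r)) := fun F hF =>
    Hc P hE h1 hp h0 hF (by positivity) (by nlinarith)
  have fin : ∀ {a b : ℝ}, c * (θ * r) ^ d ≤ a → 0 ≤ b → a * b ≤ η * c * θ ^ d * (r ^ d) ^ 2 → b ≤ η * r ^ d := fun {a b} ha hb hab => by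
    have h2 : c * (θ * r) ^ d * b ≤ c * (θ * r) ^ d * (η * r ^ d) := (mul_le_mul_of_nonneg_right ha hb).trans (hab.trans (le_of_eq (by rw [mul_pow]; ring)))
    exact le_of_mul_le_mul_left h2 (by positivity)
  have hcb : closedBall x (θ * r) ⊆ closedBall x r := closedBall_subset_closedBall (by nlinarith)
  have hin : ∀ y ∈ closedBall x (θ * r), |⟪y - x, ν x⟫| ≤ θ * r := fun y hy => by
    rw [mem_closedBall, dist_eq_norm] at hy
    have := abs_real_inner_le_norm (y - x) (ν x)
    rw [h1] at this; linarith
  have hfm : Continuous fun y => ⟪y - x, ν x⟫ := by fun_prop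
  set Z := E ∩ (closedBall x r ∩ {y | θ * r ≤ ⟪y - x, ν x⟫}) with hZ
  set Y := Eᶜ ∩ (closedBall x r ∩ {y | ⟪y - x, ν x⟫ ≤ -(θ * r)}) with hY
  have mZ : MeasurableSet Z := P.mE.inter (measurableSet_closedBall.inter (measurableSet_le measurable_const hfm.measurable))
  have mY : MeasurableSet Y := P.mE.compl.inter (measurableSet_closedBall.inter (measurableSet_le hfm.measurable measurable_const))
  have bZ : mvol Z ≤ η * r ^ d := fin (hd1 _ (Or.inr rfl)) (mvol_nonneg _) (by
    rw [mul_comm]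
    refine (P.pair hE r0 (P.mE.compl.inter measurableSet_closedBall) mZ (inter_subset_right.trans hcb) (fun y hy => hy.2.1) (fun y hy => hy.1) inter_subset_left (fun y hy z hz => ?_)).trans hI
    have e1 := (abs_le.mp (hin y hy.2)).2
    have e2 : θ * r ≤ ⟪z - x, ν x⟫ := hz.2.2
    rw [← sub_sub_sub_cancel_right z y x, inner_sub_left]; linarith)
  have bY : mvol Y ≤ η * r ^ d := fin (hd1 _ (Or.inl rfl)) (mvol_nonneg _) (by
    refine (P.pair hE r0 mY (P.mE.inter measurableSet_closedBall) (fun y hy => hy.2.1) (inter_subset_right.trans hcb) (fun y hy => hy.1) inter_subset_left (fun y hy z hz => ?_)).trans hI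
    have e1 := (abs_le.mp (hin z hz.2)).1
    have e2 : ⟪y - x, ν x⟫ ≤ -(θ * r) := hy.2.2
    rw [← sub_sub_sub_cancel_right z y x, inner_sub_left]; linarith)
  have bS := hs r r0
  have tot : ∀ {A : Set (Euc d)}, A ⊆ closedBall x r → mvol A ≤ η * r ^ d → volume A ≤ ENNReal.ofReal (η * r ^ d) := fun {A} hA h2 => by
    rw [← ENNReal.ofReal_toReal (measure_ne_top_of_subset hA (measure_closedBall_lt_top (x := x) (r := r)).ne)]
    exact ENNReal.ofReal_le_ofReal h2
  have sub : symmDiff (E ∩ ball x r) ({y | ⟪y - x, ν x⟫ ≤ 0} ∩ ball x r) ⊆ Z ∪ Y ∪ {y | y ∈ closedBall x r ∧ |⟪y - x, ν x⟫| ≤ θ * r} := by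
    have ht : 0 < θ * r := by positivity
    rintro y (⟨⟨hy1, hy2⟩, hy3⟩ | ⟨⟨hy1, hy2⟩, hy3⟩)
    · have h2 : 0 < ⟪y - x, ν x⟫ := not_le.mp fun h => hy3 ⟨h, hy2⟩
      rcases le_or_gt (θ * r) ⟪y - x, ν x⟫ with h3 | h3
      · exact Or.inl (Or.inl ⟨hy1, ball_subset_closedBall hy2, h3⟩)
      · exact Or.inr ⟨ball_subset_closedBall hy2, abs_le.mpr ⟨by linarith, h3.le⟩⟩
    · have h2 : y ∉ E := fun h => hy3 ⟨h, hy2⟩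
      have hy1 : ⟪y - x, ν x⟫ ≤ 0 := hy1
      rcases le_or_gt ⟪y - x, ν x⟫ (-(θ * r)) with h3 | h3
      · exact Or.inl (Or.inr ⟨h2, ball_subset_closedBall hy2, h3⟩)
      · exact Or.inr ⟨ball_subset_closedBall hy2, abs_le.mpr ⟨h3.le, by linarith⟩⟩
  have rd : 0 < r ^ d := by positivity
  rw [ENNReal.div_le_iff (by simpa using rd) ENNReal.ofReal_ne_top]
  refine le_trans ?_ (mul_le_mul_left hηη _)
  refine (measure_mono sub).trans ((measure_union_le _ _).trans ((add_le_add ((measure_union_le _ _).trans (add_le_add (tot (fun y hy => hy.2.1) bZ) (tot (fun y hy => hy.2.1) bY))) (tot (fun y hy => hy.1) bS)).trans (le_of_eq ?_)))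
  have : 0 ≤ η * r ^ d := by positivity
  rw [← ENNReal.ofReal_add this this, ← ENNReal.ofReal_add (by positivity) this, ← ENNReal.ofReal_mul (by positivity)]
  congr 1; ring
end

section
variable {D Ω : Set (Euc d)} {a lam : ℝ} {φ : ℕ → Euc d → ℝ} {u : Euc d → ℝ} {G : Euc d → Euc d}
  {E : Set (Euc d)} {ν : Euc d → Euc d} {σ : Measure (Euc d)}

theorem vol_cont {A : Set (Euc d)} (mA : MeasurableSet A) (x : Euc d) : ContinuousOn (fun r => mvol (A ∩ closedBall x r)) (Ici 0) := by
  have fx : ∀ (A : Set (Euc d)) s, volume (A ∩ closedBall x s) ≠ ⊤ := fun A s => measure_ne_top_of_subset inter_subset_right (measure_closedBall_lt_top (x := x) (r := s)).ne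
  have mono : ∀ (A : Set (Euc d)) {s r : ℝ}, s ≤ r → mvol (A ∩ closedBall x s) ≤ mvol (A ∩ closedBall x r) := fun A s r h =>
    mvol_mono (inter_subset_inter_right _ (closedBall_subset_closedBall h)) (fx A r)
  intro r hr
  have h1 : ∀ s ∈ Ici (0:ℝ), dist (mvol (A ∩ closedBall x s)) (mvol (A ∩ closedBall x r)) ≤ |s ^ d * omg d - r ^ d * omg d| := fun s hs => by
    have e1 := mvol_split mA x (show (0:ℝ) ≤ s from hs)
    have e2 := mvol_split mA x (show (0:ℝ) ≤ r from hr)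
    rw [Real.dist_eq]
    rcases le_total s r with h | h
    · have e3 := mono A h
      have e4 := mono Aᶜ h
      rw [abs_of_nonpos (by linarith), abs_of_nonpos (by linarith)]; linarith
    · have e3 := mono A h
      have e4 := mono Aᶜ h
      rw [abs_of_nonneg (by linarith), abs_of_nonneg (by linarith)]; linarith
  refine tendsto_iff_dist_tendsto_zero.mpr (squeeze_zero' (.of_forall fun _ => dist_nonneg) (eventually_nhdsWithin_of_forall h1) ?_)
  have h2 : Continuous fun s : ℝ => |s ^ d * omg d - r ^ d * omg d| := by fun_prop
  have := h2.tendsto r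
  rw [sub_self, abs_zero] at this
  exact this.mono_left nhdsWithin_le_nhds

theorem Per.alt (hd : 0 < d) (P : Per E ν σ) (hE : volume E ≠ ⊤) {x : Euc d} {τ : ℝ} (hτ : 0 < τ)
    (h0 : ∀ R > 0, ∃ r, 0 < r ∧ r ≤ R ∧ τ * r ^ d ≤ mvol (E ∩ closedBall x r))
    (h1 : ∀ R > 0, ∃ r, 0 < r ∧ r ≤ R ∧ τ * r ^ d ≤ mvol (Eᶜ ∩ closedBall x r)) :
    ∃ k : ℕ, ∀ R > 0, ∃ r, 0 < r ∧ r ≤ R ∧ r ^ (d - 1) ≤ (k + 1) * σ.real (closedBall x r) := by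
  by_contra hc
  push Not at hc
  have o := omg_pos (d := d)
  set V := fun r => mvol (E ∩ closedBall x r) with hV
  set W := fun r => mvol (Eᶜ ∩ closedBall x r) with hW
  set τ' := min τ (omg d / 2) with hτ'
  have ht0 : 0 < τ' := lt_min hτ (by positivity)
  set K : ℝ := 2 ^ d * omg d * 2 * 5 ^ (d - 1) with hK
  obtain ⟨k, hk⟩ := exists_nat_gt (K / (τ' * τ'))
  obtain ⟨R, hR, h⟩ := hc k
  have key : ∀ r, 0 < r → r ≤ R / 5 → V r * W r < τ' * τ' * (r ^ d) ^ 2 := fun r hr hrR => by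
    have e1 := P.pair hE (x := x) (ν0 := 0) hr (P.mE.compl.inter measurableSet_closedBall) (P.mE.inter measurableSet_closedBall) inter_subset_right inter_subset_right
      (fun y hy => hy.1) inter_subset_left (fun y _ z _ => by rw [inner_zero_right])
    have e2 := P.I_le x (5 * r)
    have e3 := h (5 * r) (by linarith) (by linarith)
    have hk0 : (0:ℝ) < k + 1 := by positivity
    have e4 : σ.real (closedBall x (5 * r)) < (5 * r) ^ (d - 1) / (k + 1) := by rw [lt_div_iff₀ hk0]; linarith
    have e5 : V r * W r < (2 * r) ^ d * omg d * (2 * r * ((5 * r) ^ (d - 1) / (k + 1))) := e1.trans_lt (by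
      refine mul_lt_mul_of_pos_left (mul_lt_mul_of_pos_left (e2.trans_lt e4) (by positivity)) (by positivity))
    have e6 : (2 * r) ^ d * omg d * (2 * r * ((5 * r) ^ (d - 1) / (k + 1))) = K / (k + 1) * (r ^ d) ^ 2 := by
      obtain ⟨n, rfl⟩ : ∃ n, d = n + 1 := ⟨d - 1, by omega⟩
      rw [hK, Nat.add_sub_cancel, mul_pow, mul_pow]; field_simp; ring
    rw [e6] at e5
    refine e5.trans_le (mul_le_mul_of_nonneg_right ?_ (by positivity))
    rw [div_le_iff₀ hk0]
    rw [div_lt_iff₀ (by positivity)] at hk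
    nlinarith
  have hsp : ∀ r, 0 < r → V r + W r = r ^ d * omg d := fun r hr => mvol_split P.mE x hr.le
  have big : ∀ {r v w : ℝ}, 0 < r → τ' * r ^ d ≤ v → v * w < τ' * τ' * (r ^ d) ^ 2 → w < τ' * r ^ d := fun {r v w} hr hv hvw => by
    by_contra hcc
    have : τ' * r ^ d * (τ' * r ^ d) ≤ v * w := mul_le_mul hv (not_lt.mp hcc) (by positivity) (le_trans (by positivity) hv)
    nlinarith
  have hle : τ' ≤ omg d / 2 := min_le_right _ _
  have hle' : τ' ≤ τ := min_le_left _ _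
  obtain ⟨r1, r10, r1R, hr1⟩ := h0 (R / 5) (by positivity)
  obtain ⟨r2, r20, r2R, hr2⟩ := h1 (R / 5) (by positivity)
  have p1 : 0 < r1 ^ d := by positivity
  have p2 : 0 < r2 ^ d := by positivity
  have b1 : W r1 < τ' * r1 ^ d := big r10 (le_trans (by gcongr) hr1) (key r1 r10 r1R)
  have b2 : V r2 < τ' * r2 ^ d := big r20 (le_trans (by gcongr) hr2) (by rw [mul_comm]; exact key r2 r20 r2R)
  have hcont : ContinuousOn (fun r => V r - r ^ d * omg d / 2) (uIcc r2 r1) := by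
    refine ((vol_cont P.mE x).mono fun r hr => ?_).sub (by fun_prop)
    exact le_trans (le_min r20.le r10.le) hr.1
  obtain ⟨r, hr, hr'⟩ := intermediate_value_uIcc hcont (show (0:ℝ) ∈ uIcc _ _ from by
    refine mem_uIcc_of_le ?_ ?_
    · nlinarith
    · have := hsp r1 r10; nlinarith)
  have r0 : 0 < r := (lt_min r20 r10).trans_le hr.1
  have rR : r ≤ R / 5 := hr.2.trans (max_le r2R r1R)
  have p : 0 < r ^ d := by positivity
  beta_reduce at hr'
  have e1 := hsp r r0
  have e2 : W r < τ' * r ^ d := big r0 (by nlinarith) (key r r0 rR)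
  nlinarith

theorem Per.null (hd : 0 < d) (P : Per E ν σ) (hE : volume E ≠ ⊤) (k : ℕ) :
    μH[(d : ℝ) - 1] {x | x ∉ reducedBoundary E ∧ ∀ R > 0, ∃ r, 0 < r ∧ r ≤ R ∧ r ^ (d - 1) ≤ ((k:ℝ) + 1) * σ.real (closedBall x r)} = 0 := by
  haveI := P.fin
  set N := {x | x ∉ reducedBoundary E ∧ ∀ R > 0, ∃ r, 0 < r ∧ r ≤ R ∧ r ^ (d - 1) ≤ ((k:ℝ) + 1) * σ.real (closedBall x r)} with hN
  have hk0 : (0:ℝ) < k + 1 := by positivity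
  have h0 : σ N = 0 := measure_mono_null (show N ⊆ {x | ¬ GP ν σ x} from fun x hx hg => hx.1 (P.reduced hd hE hg)) P.gp_ae
  refine HP hd fun R hR ε hε => ?_
  obtain ⟨U, hNU, hU, hUσ⟩ := N.exists_isOpen_lt_of_lt (μ := σ) (ENNReal.ofReal (ε / (k + 1))) (by rw [h0]; simpa using div_pos hε hk0)
  refine ⟨ENNReal.ofReal ((k:ℝ) + 1) • σ.restrict U, ?_, fun x hx => ?_⟩
  · rw [Measure.smul_apply, Measure.restrict_apply_univ, smul_eq_mul]
    refine (mul_le_mul_right hUσ.le _).trans (le_of_eq ?_)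
    rw [← ENNReal.ofReal_mul hk0.le, mul_div_cancel₀ _ hk0.ne']
  · obtain ⟨δ, hδ, hδU⟩ := Metric.isOpen_iff.mp hU x (hNU hx)
    obtain ⟨r, r0, rR, hr⟩ := hx.2 (min R (δ / 2)) (by positivity)
    refine ⟨r, r0, rR.trans (min_le_left _ _), ?_⟩
    have hs : closedBall x r ⊆ U := (closedBall_subset_ball (by have := rR.trans (min_le_right _ _); linarith)).trans hδU
    rw [Measure.smul_apply, Measure.restrict_apply measurableSet_closedBall, inter_eq_left.mpr hs, smul_eq_mul, ← ofReal_measureReal, ← ENNReal.ofReal_mul hk0.le]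
    exact ENNReal.ofReal_le_ofReal hr

theorem Sol.final (S : Sol D Ω a lam φ u G) : HasLocFinPerimeterIn D Ω ∧ μH[(d : ℝ) - 1] ((frontier Ω \ reducedBoundary Ω) ∩ D) = 0 := by
  obtain ⟨ν, σ, P⟩ := S.exists_per
  refine ⟨P.finper D, ?_⟩
  refine measure_mono_null (t := {x | x ∉ Ω ∧ ∃ ε > 0, ∀ r, 0 < r → r ≤ 1 → ε ≤ Ak u x r} ∪ ⋃ k : ℕ, {x | x ∉ reducedBoundary Ω ∧ ∀ R > 0, ∃ r, 0 < r ∧ r ≤ R ∧ r ^ (d - 1) ≤ ((k:ℝ) + 1) * σ.real (closedBall x r)}) ?_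
    (measure_union_null S.Anull (measure_iUnion_null fun k => P.null S.hd S.finO k))
  rintro x ⟨⟨hx, hxr⟩, hxD⟩
  have hxO : x ∉ Ω := fun h => by rw [S.hO.frontier_eq] at hx; exact hx.2 h
  by_cases hA : ∃ ε > 0, ∀ r, 0 < r → r ≤ 1 → ε ≤ Ak u x r
  · exact Or.inl ⟨hxO, hA⟩
  push Not at hA
  obtain ⟨τ0, t0, H0⟩ := S.dens0 hx
  obtain ⟨τ1, t1, H1⟩ := S.dens1 hx hxD hA
  obtain ⟨k, hk⟩ := P.alt S.hd S.finO (lt_min t0 t1) (fun R hR => by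
    obtain ⟨r, h1, h2, h3⟩ := H0 R hR
    exact ⟨r, h1, h2, le_trans (by gcongr; exact min_le_left _ _) h3⟩) (fun R hR => by
    obtain ⟨r, h1, h2, h3⟩ := H1 R hR
    refine ⟨r, h1, h2, le_trans (by gcongr; exact min_le_right _ _) (h3.trans (mvol_mono (fun y hy => ⟨hy.2, ball_subset_closedBall hy.1⟩)
      (measure_ne_top_of_subset inter_subset_right (measure_closedBall_lt_top (x := x) (r := r)).ne)))⟩)
  exact Or.inr (mem_iUnion.mpr ⟨k, hxr, hk⟩)
end

/-- If `D` is open, bounded and connected, any optimal shape `Ω*` has locally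
finite perimeter in `D` and `H^{d-1}((∂Ω* \ ∂*Ω*) ∩ D) = 0`. -/
theorem locally_finite_perimeter_and_small_singular_boundary
    {d : ℕ} (D : Set (Euc d)) (a : ℝ) (Ωstar : Set (Euc d))
    (hD : IsOpen D) (hDb : Bornology.IsBounded D) (hDc : IsConnected D)
    (ha : 0 < a) (ha' : a < mvol D)
    (hopt : IsOptimalShape D a Ωstar) :
    HasLocFinPerimeterIn D Ωstar ∧
      μH[(d : ℝ) - 1] ((frontier Ωstar \ reducedBoundary Ωstar) ∩ D) = 0 := by
  rcases Nat.eq_zero_or_pos d with rfl | hd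
  · exfalso
    have hne : Ωstar.Nonempty := by
      rw [nonempty_iff_ne_empty]
      rintro rfl
      have := hopt.meas
      simp [mvol] at this
      linarith
    obtain ⟨x, hx⟩ := hne
    have hDΩ : D ⊆ Ωstar := fun y _ => by rwa [Subsingleton.elim y x]
    have h2 := hopt.meas
    rw [Subset.antisymm hopt.subset hDΩ] at h2
    linarith
  · obtain ⟨φ, u, G, S⟩ := exists_sol hd hD hDb hDc ha ha' hopt
    exact S.final

end
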